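/- Let q ≥ 2 be an integer and β > q, and let λ ∈ (0,1) be a constant. There exists a constant Ĉ > 0 such that the following holds: if X₀ and Y₀ are configurations and 𝒱 = {V₁,…,V_q} is a λ-partition such that (A1) ‖α(X₀) − m‖_∞ ≤ Ĉ/√n and ‖α(Y₀) − m‖_∞ ≤ Ĉ/√n, and (A2) |α_{1,i}(X₀) − α_{1,i}(Y₀)| ≤ Ĉ/√|V_i| for all i ∈ [q], then there exists a coupling of the two SW chains started from X₀ and Y₀ and a constant integer ℓ ≥ 0 such that, for all sufficiently large n, Pr(⋃_{i=1}^ℓ {A_i = A_i′}) ≥ 3/4, where A_i and A_i′ are the projections of the two chains at time i. -/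

import Mathlib

open scoped Classical
open Finset

/-- Spin configurations on `n` vertices with `q` spins. -/
abbrev Conf (n q : ℕ) := Fin n → Fin q

/-- Number of vertices assigned spin `j`. -/
def cntN {n q : ℕ} (X : Conf n q) (j : Fin q) : ℕ :=
  (Finset.univ.filter (fun v => X v = j)).card

/-- Number of monochromatic pairs `{u,v}` (`u < v`, same spin). -/
def numMono {n q : ℕ} (σ : Conf n q) : ℕ :=
  (Finset.univ.filter (fun p : Fin n × Fin n => p.1 < p.2 ∧ σ p.1 = σ p.2)).card

/-- The mean-field `q`-state Potts measure: probability of `σ`. -/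
noncomputable def pottsProb (n q : ℕ) (β : ℝ) (σ : Conf n q) : ℝ :=
  Real.exp (β / n * numMono σ) / ∑ τ : Conf n q, Real.exp (β / n * numMono τ)

/-- The set of monochromatic pairs of a configuration. -/
def monoPairs {n q : ℕ} (σ : Conf n q) : Finset (Fin n × Fin n) :=
  Finset.univ.filter (fun p : Fin n × Fin n => p.1 < p.2 ∧ σ p.1 = σ p.2)

/-- The graph on `Fin n` whose edges are the pairs in `E`. -/
def graphOf {n : ℕ} (E : Finset (Fin n × Fin n)) : SimpleGraph (Fin n) :=
  SimpleGraph.fromRel (fun u v => (u, v) ∈ E)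

/-- Number of connected components of the graph `(V, E)`. -/
noncomputable def numComps {n : ℕ} (E : Finset (Fin n × Fin n)) : ℕ :=
  Nat.card (graphOf E).ConnectedComponent

/-- One-step transition probability of the Swendsen–Wang dynamics:
percolate on monochromatic pairs with probability `p = 1 - exp (-β/n)`,
then color each connected component uniformly at random. -/
noncomputable def swStep (n q : ℕ) (β : ℝ) (σ τ : Conf n q) : ℝ :=
  ∑ E ∈ (monoPairs σ).powerset,
    ((1 - Real.exp (-(β / n))) ^ E.card *
        Real.exp (-(β / n)) ^ ((monoPairs σ).card - E.card)) *
      (if ∀ u v : Fin n, (graphOf E).Reachable u v → τ u = τ v then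
        ((q : ℝ))⁻¹ ^ numComps E else 0)

/-- `t`-step transition probability of the Swendsen–Wang dynamics. -/
noncomputable def swProb (n q : ℕ) (β : ℝ) : ℕ → Conf n q → Conf n q → ℝ
  | 0, σ, τ => if σ = τ then 1 else 0
  | t + 1, σ, τ => ∑ η : Conf n q, swStep n q β σ η * swProb n q β t η τ

/-- Probability of observing the trajectory `ω 0, ω 1, …, ω (ℓ-1)` at times
`1, …, ℓ` for the SW dynamics started at `X₀`. -/
noncomputable def pathProb (n q : ℕ) (β : ℝ) (X₀ : Conf n q) (ℓ : ℕ)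
    (ω : Fin ℓ → Conf n q) : ℝ :=
  ∏ i : Fin ℓ, swStep n q β
    (if _h : 0 < (i : ℕ) then
        ω ⟨(i : ℕ) - 1, lt_of_le_of_lt (Nat.sub_le _ _) i.isLt⟩
      else X₀) (ω i)

/-- Total variation distance between two probability vectors on configurations. -/
noncomputable def tvDist {n q : ℕ} (f g : Conf n q → ℝ) : ℝ :=
  (∑ τ : Conf n q, |f τ - g τ|) / 2

/-- Mixing time `τ_mix(ε)` of the SW dynamics. -/
noncomputable def mixingTime (n q : ℕ) (β ε : ℝ) : ℕ :=
  sInf {t : ℕ | ∀ σ : Conf n q, tvDist (swProb n q β t σ) (pottsProb n q β) ≤ ε}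

/-- `theta lam` is the unique root in `(0,1)` of `exp (-lam * x) = 1 - x`
for `lam > 1`, and `0` for `lam ≤ 1`. -/
noncomputable def theta (lam : ℝ) : ℝ :=
  if lam ≤ 1 then 0
  else sSup {x : ℝ | x ∈ Set.Ioo (0 : ℝ) 1 ∧ Real.exp (-lam * x) = 1 - x}

/-- The drift function `F`. -/
noncomputable def F (q : ℕ) (β : ℝ) (x : ℝ) : ℝ :=
  1 / q + (1 - 1 / q) * theta (β * x) * x

/-- The unique fixed point of `F` in `(1/q, 1]` (for `β > q`). -/
noncomputable def aFix (q : ℕ) (β : ℝ) : ℝ :=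
  sSup {x : ℝ | x ∈ Set.Ioc (1 / (q : ℝ)) 1 ∧ F q β x = x}

/-- The cutoff constant `c(β,q) = (2 log (1 / F'(a)))⁻¹`. -/
noncomputable def cConst (q : ℕ) (β : ℝ) : ℝ :=
  (2 * Real.log (1 / deriv (F q β) (aFix q β)))⁻¹

/-- Fraction of vertices assigned spin `j`. -/
noncomputable def cntFrac {n q : ℕ} (X : Conf n q) : Fin q → ℝ :=
  fun j => (cntN X j : ℝ) / n

/-- The proportions vector `α(X)`: fractions of vertices of each spin,
sorted in nonincreasing order. -/
noncomputable def alphaVec {n q : ℕ} (X : Conf n q) : Fin q → ℝ :=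
  fun i => cntFrac X (Tuple.sort (cntFrac X) i.rev)

/-- `ℓ∞` distance between two vectors indexed by `Fin q`. -/
noncomputable def linf {q : ℕ} (f g : Fin q → ℝ) : ℝ :=
  ⨆ i : Fin q, |f i - g i|

/-- The vector `κ(b) = (b, (1-b)/(q-1), …, (1-b)/(q-1))`. -/
noncomputable def kappaVec (q : ℕ) (b : ℝ) : Fin q → ℝ :=
  fun i => if (i : ℕ) = 0 then b else (1 - b) / ((q : ℝ) - 1)

/-- The majority vector `m = (a, (1-a)/(q-1), …, (1-a)/(q-1))`. -/
noncomputable def mVec (q : ℕ) (β : ℝ) : Fin q → ℝ :=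
  kappaVec q (aFix q β)

/-- Index of the most common spin of `X` (least such index on ties). -/
noncomputable def domIdx {n q : ℕ} (X : Conf n q) : ℕ :=
  sInf {j : ℕ | ∃ hj : j < q, ∀ j' : Fin q, cntN X j' ≤ cntN X ⟨j, hj⟩}

/-- `α₁(X)`: fraction of vertices carrying the most common spin of `X`. -/
noncomputable def alpha1 {n q : ℕ} (X : Conf n q) : ℝ :=
  ((Finset.univ.filter (fun v : Fin n => (X v : ℕ) = domIdx X)).card : ℝ) / n

/-- `α_{1,k}(X)`: fraction of vertices of `Vk` carrying the most common spin of `X`. -/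
noncomputable def alpha1In {n q : ℕ} (X : Conf n q) (Vk : Finset (Fin n)) : ℝ :=
  ((Vk.filter (fun v => (X v : ℕ) = domIdx X)).card : ℝ) / Vk.card

/-- `P` is a partition of the vertex set into `q` classes. -/
def IsPartition {n q : ℕ} (P : Fin q → Finset (Fin n)) : Prop :=
  (∀ i j, i ≠ j → Disjoint (P i) (P j)) ∧ ∀ v : Fin n, ∃ i, v ∈ P i

/-- A `λ`-partition: a partition with all classes of size at least `λ n`. -/
def IsLamPartition {n q : ℕ} (lam : ℝ) (P : Fin q → Finset (Fin n)) : Prop :=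
  IsPartition P ∧ ∀ i, lam * n ≤ ((P i).card : ℝ)

/-- Projection: `projCnt P X i j` is the number of vertices of `P i`
assigned spin `j` in `X`. -/
def projCnt {n q : ℕ} (P : Fin q → Finset (Fin n)) (X : Conf n q) :
    Fin q → Fin q → ℕ :=
  fun i j => ((P i).filter (fun v => X v = j)).card

/-- All potential edges of the complete graph on `Fin n`. -/
def allPairs (n : ℕ) : Finset (Fin n × Fin n) :=
  Finset.univ.filter (fun p : Fin n × Fin n => p.1 < p.2)

/-- Probability of the edge set `E` under the Erdős–Rényi measure `G(n,p)`. -/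
noncomputable def erProb (n : ℕ) (p : ℝ) (E : Finset (Fin n × Fin n)) : ℝ :=
  p ^ E.card * (1 - p) ^ ((allPairs n).card - E.card)

/-- Size of the connected component of `v` in the graph `(V, E)`. -/
noncomputable def compCard {n : ℕ} (E : Finset (Fin n × Fin n)) (v : Fin n) : ℕ :=
  (Finset.univ.filter (fun u => (graphOf E).Reachable v u)).card

/-- `L₁`: size of the largest connected component. -/
noncomputable def L1 {n : ℕ} (E : Finset (Fin n × Fin n)) : ℕ :=
  Finset.univ.sup (fun v => compCard E v)

/-- Sum of the squares of the component sizes, `Σ_j L_j²`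
(computed as `Σ_v |C(v)|`). -/
noncomputable def sumCompSq {n : ℕ} (E : Finset (Fin n × Fin n)) : ℕ :=
  ∑ v : Fin n, compCard E v

/-- Expectation of `f` under the Erdős–Rényi measure `G(n,p)`. -/
noncomputable def erExp (n : ℕ) (p : ℝ) (f : Finset (Fin n × Fin n) → ℝ) : ℝ :=
  ∑ E ∈ (allPairs n).powerset, erProb n p E * f E

/-- Random-cluster weight of an edge set with parameters `q`, `p = 1 - exp (-β/n)`. -/
noncomputable def rcWeight (n q : ℕ) (β : ℝ) (E : Finset (Fin n × Fin n)) : ℝ :=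
  (1 - Real.exp (-(β / n))) ^ E.card *
    Real.exp (-(β / n)) ^ ((allPairs n).card - E.card) * (q : ℝ) ^ numComps E

/-- The mean-field random-cluster measure: probability of the edge set `E`. -/
noncomputable def rcProb (n q : ℕ) (β : ℝ) (E : Finset (Fin n × Fin n)) : ℝ :=
  rcWeight n q β E / ∑ B ∈ (allPairs n).powerset, rcWeight n q β B

/-- Two probability vectors whose images under `π` both dominate `κ` on a finite set `Box` can be
coupled so that the images agree with probability at least `κ * #Box`. -/
theorem exists_coupling_of_minorized {Ω Γ : Type*} [Fintype Ω] (π : Ω → Γ) (f g : Ω → ℝ)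
    (hf : ∀ x, 0 ≤ f x) (hg : ∀ x, 0 ≤ g x) (hf1 : ∑ x, f x = 1) (hg1 : ∑ x, g x = 1)
    (Box : Finset Γ) (κ ε : ℝ) (hκ : 0 < κ) (hε : κ * Box.card = ε) (hε1 : ε < 1)
    (hfB : ∀ T ∈ Box, κ ≤ ∑ x, if π x = T then f x else 0)
    (hgB : ∀ T ∈ Box, κ ≤ ∑ x, if π x = T then g x else 0) :
    ∃ Q : Ω × Ω → ℝ, (∀ z, 0 ≤ Q z) ∧ (∀ x, ∑ y, Q (x, y) = f x) ∧ (∀ y, ∑ x, Q (x, y) = g y) ∧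
      ε ≤ ∑ z : Ω × Ω, if π z.1 = π z.2 then Q z else 0 := by
  have key : ∀ f : Ω → ℝ, (∀ x, 0 ≤ f x) → (∑ x, f x = 1) →
      (∀ T ∈ Box, κ ≤ ∑ x, if π x = T then f x else 0) →
      ∃ k : Γ → Ω → ℝ, (∀ T x, 0 ≤ k T x) ∧ (∀ T x, π x ≠ T → k T x = 0) ∧
        (∀ T ∈ Box, ∑ x, k T x = 1) ∧ (∀ x, ∑ T ∈ Box, κ * k T x ≤ f x) := by
    intro f hf hf1 hfB
    refine ⟨fun T x => if π x = T then f x / (∑ x, if π x = T then f x else 0) else 0, ?_, ?_, ?_, ?_⟩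
    · intro T x
      dsimp only
      split_ifs
      · exact div_nonneg (hf x) (sum_nonneg fun y _ => by split_ifs <;> simp [hf])
      · exact le_rfl
    · intro T x h
      simp [h]
    · intro T hT
      have hp : 0 < ∑ x, if π x = T then f x else 0 := lt_of_lt_of_le hκ (hfB T hT)
      have : ∀ x, (if π x = T then f x / (∑ x, if π x = T then f x else 0) else 0) =
          (if π x = T then f x else 0) / (∑ x, if π x = T then f x else 0) := by
        intro x; split_ifs <;> simp
      simp only [this]
      rw [← sum_div, div_self hp.ne']
    · intro x
      by_cases hx : π x ∈ Box
      · rw [sum_eq_single_of_mem (π x) hx]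
        · simp only [if_true]
          have hp : κ ≤ ∑ y, if π y = π x then f y else 0 := hfB _ hx
          rw [mul_div_assoc', div_le_iff₀ (lt_of_lt_of_le hκ hp)]
          nlinarith [hf x]
        · intro T _ hT
          simp [hT.symm]
      · rw [sum_eq_zero]
        · exact hf x
        · intro T hT
          have : π x ≠ T := fun h => hx (h ▸ hT)
          simp [this]
  obtain ⟨k, hk0, hkπ, hk1, hkf⟩ := key f hf hf1 hfB
  obtain ⟨l, hl0, hlπ, hl1, hlg⟩ := key g hg hg1 hgB
  have hε0 : 0 ≤ ε := by rw [← hε]; positivity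
  set f' : Ω → ℝ := fun x => f x - ∑ T ∈ Box, κ * k T x with hf'
  set g' : Ω → ℝ := fun x => g x - ∑ T ∈ Box, κ * l T x with hg'
  have hsk : ∀ k : Γ → Ω → ℝ, (∀ T ∈ Box, ∑ x, k T x = 1) → ∑ x, ∑ T ∈ Box, κ * k T x = ε := by
    intro k hk
    rw [sum_comm, ← hε, sum_congr rfl (g := fun _ => κ)]
    · simp [mul_comm]
    · intro T hT
      rw [← mul_sum, hk T hT, mul_one]
  have hsf : ∑ x, f' x = 1 - ε := by
    simp only [hf', sum_sub_distrib]
    rw [hsk k hk1, hf1]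
  have hsg : ∑ x, g' x = 1 - ε := by
    simp only [hg', sum_sub_distrib]
    rw [hsk l hl1, hg1]
  have h1ε : (1 - ε) ≠ 0 := by linarith
  refine ⟨fun z => ∑ T ∈ Box, κ * (k T z.1 * l T z.2) + f' z.1 * g' z.2 / (1 - ε), ?_, ?_, ?_, ?_⟩
  · intro z
    apply add_nonneg
    · exact sum_nonneg fun T _ => mul_nonneg hκ.le (mul_nonneg (hk0 _ _) (hl0 _ _))
    · exact div_nonneg (mul_nonneg (sub_nonneg.2 (hkf _)) (sub_nonneg.2 (hlg _))) (by linarith)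
  · intro x
    simp only [sum_add_distrib]
    rw [sum_comm, ← sum_div, ← mul_sum, hsg, mul_div_cancel_right₀ _ h1ε]
    rw [sum_congr rfl (g := fun T => κ * k T x)]
    · simp [hf']
    · intro T hT
      rw [← mul_sum, ← mul_sum, hl1 T hT, mul_one]
  · intro y
    simp only [sum_add_distrib]
    rw [sum_comm, ← sum_div, ← sum_mul, hsf, mul_div_cancel_left₀ _ h1ε]
    rw [sum_congr rfl (g := fun T => κ * l T y)]
    · simp [hg']
    · intro T hT
      rw [← mul_sum, ← sum_mul, hk1 T hT, one_mul]
  · have : ∀ z : Ω × Ω, ∑ T ∈ Box, κ * (k T z.1 * l T z.2) ≤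
        (if π z.1 = π z.2 then ∑ T ∈ Box, κ * (k T z.1 * l T z.2) + f' z.1 * g' z.2 / (1 - ε) else 0) := by
      intro z
      split_ifs with h
      · have : 0 ≤ f' z.1 * g' z.2 / (1 - ε) :=
          div_nonneg (mul_nonneg (sub_nonneg.2 (hkf _)) (sub_nonneg.2 (hlg _))) (by linarith)
        linarith
      · apply le_of_eq
        apply sum_eq_zero
        intro T _
        by_cases h1 : π z.1 = T
        · rw [hlπ T z.2 (fun h2 => h (h1.trans h2.symm))]; simp
        · rw [hkπ T z.1 h1]; simp
    refine le_trans ?_ (sum_le_sum fun z _ => this z)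
    rw [Fintype.sum_prod_type, ← hsk k hk1]
    apply sum_le_sum
    intro x _
    rw [sum_comm]
    apply sum_le_sum
    intro T hT
    dsimp only
    rw [← mul_sum, ← mul_sum, hl1 T hT, mul_one]

/-- The probability of a trajectory of the chain with transition matrix `Pr` started at `x`. -/
noncomputable def trajProb {Ω : Type*} (Pr : Ω → Ω → ℝ) (x : Ω) (l : ℕ) (ω : Fin l → Ω) : ℝ :=
  ∏ i : Fin l, Pr (if _h : 0 < (i : ℕ) then
      ω ⟨(i : ℕ) - 1, lt_of_le_of_lt (Nat.sub_le _ _) i.isLt⟩ else x) (ω i)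

theorem trajProb_succ {Ω : Type*} (Pr : Ω → Ω → ℝ) (x : Ω) (l : ℕ) (ω : Fin (l + 1) → Ω) :
    trajProb Pr x (l + 1) ω = Pr x (ω 0) * trajProb Pr (ω 0) l (Fin.tail ω) := by
  unfold trajProb
  rw [Fin.prod_univ_succ]
  congr 1
  apply prod_congr rfl
  intro i _
  congr 1
  by_cases h : 0 < (i : ℕ)
  · simp only [Fin.val_succ, Nat.succ_pos, dif_pos, h, Fin.tail]
    congr 1
    ext
    simp
    omega
  · have : (i : ℕ) = 0 := by omega
    simp [this]

/-- The law of a trajectory of a time-inhomogeneous chain with kernels `Q t, Q (t+1), …`. -/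
noncomputable def cplProb {Z : Type*} (Q : ℕ → Z → Z → ℝ) : (l : ℕ) → ℕ → Z → (Fin l → Z) → ℝ
  | 0, _, _, _ => 1
  | l + 1, t, z, ω => Q t z (ω 0) * cplProb Q l (t + 1) (ω 0) (Fin.tail ω)

theorem sum_fin_succ_fun {Z : Type*} [Fintype Z] (l : ℕ) (G : (Fin (l + 1) → Z) → ℝ) :
    ∑ ω, G ω = ∑ z : Z, ∑ ω : Fin l → Z, G (Fin.cons z ω) := by
  rw [← Fintype.sum_prod_type', ← (Fin.consEquiv (fun _ : Fin (l+1) => Z)).sum_comp]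
  rfl

theorem cplProb_marginal {Ω Z : Type*} [Fintype Ω] [Fintype Z] (p : Z → Ω) (Pr : Ω → Ω → ℝ)
    (Q : ℕ → Z → Z → ℝ)
    (hQ : ∀ t z x, (∑ z', if p z' = x then Q t z z' else 0) = Pr (p z) x) (l : ℕ) :
    ∀ t z (ωx : Fin l → Ω), (∑ ω : Fin l → Z, if (fun i => p (ω i)) = ωx then cplProb Q l t z ω else 0)
      = trajProb Pr (p z) l ωx := by
  induction l with
  | zero =>
    intro t z ωx
    rw [Fintype.sum_unique]
    rw [if_pos (Subsingleton.elim _ _)]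
    simp [cplProb, trajProb]
  | succ l ih =>
    intro t z ωx
    rw [sum_fin_succ_fun, trajProb_succ, ← hQ t, sum_mul]
    apply sum_congr rfl
    intro z' _
    by_cases h : p z' = ωx 0
    · rw [if_pos h, ← h, ← ih (t + 1), mul_sum]
      apply sum_congr rfl
      intro ω _
      have : ((fun i => p ((Fin.cons z' ω : Fin (l + 1) → Z) i)) = ωx) ↔
          (fun i => p (ω i)) = Fin.tail ωx := by
        rw [← Fin.cons_self_tail ωx]
        constructor
        · intro hh
          ext i
          have := congrFun hh i.succ
          simpa using this
        · intro hh
          ext i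
          refine Fin.cases ?_ (fun j => ?_) i
          · simpa using h
          · have := congrFun hh j
            simpa using this
      simp only [this, cplProb, Fin.cons_zero, Fin.tail_cons, mul_ite, mul_zero]
    · rw [if_neg h, zero_mul]
      apply sum_eq_zero
      intro ω _
      rw [if_neg]
      intro hh
      apply h
      have := congrFun hh 0
      simpa using this

theorem cplProb_nonneg {Z : Type*} (Q : ℕ → Z → Z → ℝ) (hQ : ∀ t z z', 0 ≤ Q t z z') (l : ℕ) :
    ∀ t z ω, 0 ≤ cplProb Q l t z ω := by
  induction l with
  | zero => intros; simp [cplProb]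
  | succ l ih => intro t z ω; exact mul_nonneg (hQ _ _ _) (ih _ _ _)

theorem cplProb_sum {Z : Type*} [Fintype Z] (Q : ℕ → Z → Z → ℝ) (hQ : ∀ t z, ∑ z', Q t z z' = 1)
    (l : ℕ) : ∀ t z, ∑ ω, cplProb Q l t z ω = 1 := by
  induction l with
  | zero => intros; simp [cplProb]
  | succ l ih =>
    intro t z
    rw [sum_fin_succ_fun]
    simp only [cplProb, Fin.cons_zero, Fin.tail_cons, ← mul_sum, ih, mul_one, hQ]

/-- The weighted occupation of `{W > K}` that controls the failure of the coupling. -/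
noncomputable def occup {Ω : Type*} [Fintype Ω] (Pr : Ω → Ω → ℝ) (W : ℕ → Ω → ℝ) (K ε : ℝ) :
    ℕ → ℕ → Ω → ℝ
  | 0, _, _ => 0
  | l + 1, t, x => (if W t x ≤ K then 0 else ε * (1 - ε) ^ l) + ∑ z, Pr x z * occup Pr W K ε l (t + 1) z

theorem occup_nonneg {Ω : Type*} [Fintype Ω] (Pr : Ω → Ω → ℝ) (W : ℕ → Ω → ℝ) (K ε : ℝ)
    (hP : ∀ x z, 0 ≤ Pr x z) (hε : 0 < ε) (hε1 : ε < 1) (l : ℕ) :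
    ∀ t x, 0 ≤ occup Pr W K ε l t x := by
  induction l with
  | zero => intros; simp [occup]
  | succ l ih =>
    intro t x
    have : 0 ≤ ε * (1 - ε) ^ l := mul_nonneg hε.le (pow_nonneg (by linarith) _)
    apply add_nonneg
    · split_ifs <;> simp [this]
    · exact sum_nonneg fun z _ => mul_nonneg (hP _ _) (ih _ _)

theorem occup_le_one {Ω : Type*} [Fintype Ω] (Pr : Ω → Ω → ℝ) (W : ℕ → Ω → ℝ) (K ε : ℝ)
    (hP : ∀ x z, 0 ≤ Pr x z) (hP1 : ∀ x, ∑ z, Pr x z = 1) (hε : 0 < ε) (hε1 : ε < 1) (l : ℕ) :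
    ∀ t x, occup Pr W K ε l t x ≤ 1 - (1 - ε) ^ l := by
  induction l with
  | zero => intros; simp [occup]
  | succ l ih =>
    intro t x
    have : 0 ≤ ε * (1 - ε) ^ l := mul_nonneg hε.le (pow_nonneg (by linarith) _)
    have h1 : (if W t x ≤ K then 0 else ε * (1 - ε) ^ l) ≤ ε * (1 - ε) ^ l := by
      split_ifs <;> simp [this]
    have h2 : ∑ z, Pr x z * occup Pr W K ε l (t + 1) z ≤ ∑ z, Pr x z * (1 - (1 - ε) ^ l) :=
      sum_le_sum fun z _ => mul_le_mul_of_nonneg_left (ih _ _) (hP _ _)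
    rw [← sum_mul, hP1, one_mul] at h2
    simp only [occup]
    rw [pow_succ]
    linarith

/-- Coefficients of the linear bound on `occup`. -/
noncomputable def occCoeff (K ε ρ R : ℝ) : ℕ → ℝ
  | 0 => 0
  | l + 1 => ε * (1 - ε) ^ l / K + 1 / R + ρ * occCoeff K ε ρ R l

theorem occCoeff_nonneg {K ε ρ R : ℝ} (hK : 0 < K) (hR : 0 < R) (hρ : 0 ≤ ρ) (hε : 0 < ε)
    (hε1 : ε < 1) (l : ℕ) : 0 ≤ occCoeff K ε ρ R l := by
  induction l with
  | zero => simp [occCoeff]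
  | succ l ih =>
    have : 0 ≤ 1 - ε := by linarith
    simp only [occCoeff]
    positivity

theorem occCoeff_sum (K ε ρ R : ℝ) (l : ℕ) :
    occCoeff K ε ρ R l + (1 - ρ) * ∑ i ∈ range l, occCoeff K ε ρ R i =
      (1 - (1 - ε) ^ l) / K + l / R := by
  induction l with
  | zero => simp [occCoeff]
  | succ l ih =>
    rw [sum_range_succ]
    simp only [occCoeff]
    push_cast
    have : (1 - (1 - ε) ^ (l + 1)) / K = (1 - (1 - ε) ^ l) / K + ε * (1 - ε) ^ l / K := by
      rw [pow_succ]; ring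
    rw [this, add_div]
    linarith

theorem occup_le {Ω : Type*} [Fintype Ω] (Pr : Ω → Ω → ℝ) (W : ℕ → Ω → ℝ) (K ε ρ C R : ℝ)
    (hP : ∀ x z, 0 ≤ Pr x z) (hP1 : ∀ x, ∑ z, Pr x z = 1) (hW : ∀ t x, 0 ≤ W t x)
    (hK : 0 < K) (hR : 0 < R) (hε : 0 < ε) (hε1 : ε < 1) (hρ : 0 ≤ ρ) (hC : 0 ≤ C)
    (drift : ∀ t x, W t x ≤ R → ∑ z, Pr x z * W (t + 1) z ≤ ρ * W t x + C) (l : ℕ) :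
    ∀ t x, occup Pr W K ε l t x ≤ W t x * occCoeff K ε ρ R l +
      C * ∑ i ∈ range l, occCoeff K ε ρ R i := by
  induction l with
  | zero => intros; simp [occup, occCoeff]
  | succ l ih =>
    intro t x
    have hB : 0 ≤ occCoeff K ε ρ R l := occCoeff_nonneg hK hR hρ hε hε1 l
    have hS : 0 ≤ ∑ i ∈ range l, occCoeff K ε ρ R i :=
      sum_nonneg fun i _ => occCoeff_nonneg hK hR hρ hε hε1 i
    have he : 0 ≤ (1 - ε) ^ l := pow_nonneg (by linarith) _
    by_cases hx : W t x ≤ R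
    · have h1 : (if W t x ≤ K then 0 else ε * (1 - ε) ^ l) ≤ W t x * (ε * (1 - ε) ^ l / K) := by
        split_ifs with h
        · have := hW t x
          positivity
        · have : 1 ≤ W t x / K := by rw [le_div_iff₀ hK]; linarith
          calc ε * (1 - ε) ^ l = 1 * (ε * (1 - ε) ^ l) := by ring
            _ ≤ (W t x / K) * (ε * (1 - ε) ^ l) := by gcongr
            _ = _ := by ring
      have h2 : ∑ z, Pr x z * occup Pr W K ε l (t + 1) z ≤
          ∑ z, Pr x z * (W (t+1) z * occCoeff K ε ρ R l + C * ∑ i ∈ range l, occCoeff K ε ρ R i) :=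
        sum_le_sum fun z _ => mul_le_mul_of_nonneg_left (ih _ _) (hP _ _)
      have h3 : ∑ z, Pr x z * (W (t+1) z * occCoeff K ε ρ R l + C * ∑ i ∈ range l, occCoeff K ε ρ R i)
          = (∑ z, Pr x z * W (t+1) z) * occCoeff K ε ρ R l + C * ∑ i ∈ range l, occCoeff K ε ρ R i := by
        simp only [mul_add, sum_add_distrib, ← mul_assoc, ← sum_mul, hP1, one_mul]
      have h4 := mul_le_mul_of_nonneg_right (drift t x hx) hB
      have h5 : 0 ≤ W t x * (1 / R) := mul_nonneg (hW _ _) (by positivity)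
      simp only [occup, occCoeff]
      rw [sum_range_succ]
      nlinarith
    · have h1 := occup_le_one Pr W K ε hP hP1 hε hε1 (l + 1) t x
      have h2 : 1 ≤ W t x * (1 / R) := by
        rw [mul_one_div, le_div_iff₀ hR]; linarith
      have h3 : 0 ≤ W t x * (ε * (1 - ε) ^ l / K) := by
        have := hW t x
        positivity
      have h4 : 0 ≤ W t x * (ρ * occCoeff K ε ρ R l) := by
        have := hW t x
        positivity
      have h5 : 0 ≤ (1 - ε) ^ (l + 1) := pow_nonneg (by linarith) _
      have h6 : 0 ≤ C * (∑ i ∈ range (l + 1), occCoeff K ε ρ R i) := by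
        rw [sum_range_succ]; positivity
      simp only [occCoeff]
      nlinarith

theorem fail_le {Ω Γ : Type*} [Fintype Ω] (π : Ω → Γ) (Pr : Ω → Ω → ℝ) (W : ℕ → Ω → ℝ) (K ε : ℝ)
    (hP : ∀ x z, 0 ≤ Pr x z) (hε : 0 < ε) (hε1 : ε < 1)
    (Q : ℕ → Ω × Ω → Ω × Ω → ℝ) (hQ : ∀ t z z', 0 ≤ Q t z z')
    (hQ1 : ∀ t z x, ∑ y, Q t z (x, y) = Pr z.1 x) (hQ2 : ∀ t z y, ∑ x, Q t z (x, y) = Pr z.2 y)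
    (hQt : ∀ t z, ∑ z', Q t z z' = 1)
    (hQε : ∀ t z, W t z.1 ≤ K → W t z.2 ≤ K →
      ε ≤ ∑ z' : Ω × Ω, if π z'.1 = π z'.2 then Q t z z' else 0) (l : ℕ) :
    ∀ t z, (∑ ω : Fin l → Ω × Ω, if ∀ i, π (ω i).1 ≠ π (ω i).2 then cplProb Q l t z ω else 0) ≤
      (1 - ε) ^ l + occup Pr W K ε l t z.1 + occup Pr W K ε l t z.2 := by
  induction l with
  | zero => intro t z; simp [occup, cplProb]
  | succ l ih =>
    intro t z
    rw [sum_fin_succ_fun]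
    have e1 : ∀ z' : Ω × Ω, (∑ ω : Fin l → Ω × Ω,
        if ∀ i, π ((Fin.cons z' ω : Fin (l + 1) → Ω × Ω) i).1 ≠ π ((Fin.cons z' ω : Fin (l + 1) → Ω × Ω) i).2
          then cplProb Q (l + 1) t z (Fin.cons z' ω) else 0) =
        (if π z'.1 = π z'.2 then 0 else Q t z z' *
          ∑ ω : Fin l → Ω × Ω, if ∀ i, π (ω i).1 ≠ π (ω i).2 then cplProb Q l (t + 1) z' ω else 0) := by
      intro z'
      split_ifs with h
      · apply sum_eq_zero
        intro ω _
        rw [if_neg]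
        intro hh
        exact hh 0 (by simpa using h)
      · rw [mul_sum]
        apply sum_congr rfl
        intro ω _
        have : (∀ i, π ((Fin.cons z' ω : Fin (l + 1) → Ω × Ω) i).1 ≠
            π ((Fin.cons z' ω : Fin (l + 1) → Ω × Ω) i).2) ↔ ∀ i, π (ω i).1 ≠ π (ω i).2 := by
          rw [Fin.forall_fin_succ]
          simp [h]
        simp only [this, cplProb, Fin.cons_zero, Fin.tail_cons, mul_ite, mul_zero]
    simp only [e1]
    have he : 0 ≤ (1 - ε) ^ l := pow_nonneg (by linarith) _
    have b1 : ∑ z' : Ω × Ω, Q t z z' * occup Pr W K ε l (t + 1) z'.1 =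
        ∑ x, Pr z.1 x * occup Pr W K ε l (t + 1) x := by
      rw [Fintype.sum_prod_type]
      simp only [← sum_mul, hQ1]
    have b2 : ∑ z' : Ω × Ω, Q t z z' * occup Pr W K ε l (t + 1) z'.2 =
        ∑ x, Pr z.2 x * occup Pr W K ε l (t + 1) x := by
      rw [Fintype.sum_prod_type_right]
      simp only [← sum_mul, hQ2]
    have b3 : ∀ z' : Ω × Ω, (if π z'.1 = π z'.2 then 0 else Q t z z' *
          ∑ ω : Fin l → Ω × Ω, if ∀ i, π (ω i).1 ≠ π (ω i).2 then cplProb Q l (t + 1) z' ω else 0) ≤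
        (Q t z z' - (if π z'.1 = π z'.2 then Q t z z' else 0)) * (1 - ε) ^ l +
        Q t z z' * occup Pr W K ε l (t + 1) z'.1 + Q t z z' * occup Pr W K ε l (t + 1) z'.2 := by
      intro z'
      have o1 := mul_nonneg (hQ t z z') (occup_nonneg Pr W K ε hP hε hε1 l (t+1) z'.1)
      have o2 := mul_nonneg (hQ t z z') (occup_nonneg Pr W K ε hP hε hε1 l (t+1) z'.2)
      split_ifs with h
      · simp only [sub_self, zero_mul]; linarith
      · have := mul_le_mul_of_nonneg_left (ih (t + 1) z') (hQ t z z')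
        rw [sub_zero]
        linarith
    refine (sum_le_sum fun z' _ => b3 z').trans ?_
    rw [sum_add_distrib, sum_add_distrib, b1, b2, ← sum_mul, sum_sub_distrib, hQt]
    have b4 : (1 - ∑ z' : Ω × Ω, if π z'.1 = π z'.2 then Q t z z' else 0) * (1 - ε) ^ l ≤
        (1 - ε) ^ (l + 1) + (if W t z.1 ≤ K then 0 else ε * (1 - ε) ^ l) +
          (if W t z.2 ≤ K then 0 else ε * (1 - ε) ^ l) := by
      have n0 : 0 ≤ ∑ z' : Ω × Ω, if π z'.1 = π z'.2 then Q t z z' else 0 :=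
        sum_nonneg fun z' _ => by split_ifs <;> simp [hQ]
      have n1 := mul_nonneg n0 he
      have n2 := mul_nonneg hε.le he
      by_cases h1 : W t z.1 ≤ K
      · by_cases h2 : W t z.2 ≤ K
        · have := mul_le_mul_of_nonneg_right (hQε t z h1 h2) he
          simp only [h1, h2, if_true, pow_succ]
          nlinarith
        · simp only [h1, h2, if_true, if_false, pow_succ]; nlinarith
      · by_cases h2 : W t z.2 ≤ K
        · simp only [h1, h2, if_true, if_false, pow_succ]; nlinarith
        · simp only [h1, h2, if_false, pow_succ]; nlinarith
    simp only [occup]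
    linarith

/-- A chain with a Lyapunov drift and a minorization for the projection `π` on the sublevel sets
admits a Markovian coupling under which the projections meet. -/
theorem exists_trajectory_coupling {Ω Γ : Type*} [Fintype Ω] (π : Ω → Γ) (Pr : Ω → Ω → ℝ)
    (W : ℕ → Ω → ℝ) (K ε ρ C R : ℝ)
    (hP : ∀ x z, 0 ≤ Pr x z) (hP1 : ∀ x, ∑ z, Pr x z = 1) (hW : ∀ t x, 0 ≤ W t x)
    (hK : 0 < K) (hR : 0 < R) (hε : 0 < ε) (hε1 : ε < 1) (hρ : 0 ≤ ρ) (hρ1 : ρ < 1) (hC : 0 ≤ C)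
    (drift : ∀ t x, W t x ≤ R → ∑ z, Pr x z * W (t + 1) z ≤ ρ * W t x + C)
    (minor : ∀ t, ∃ Box : Finset Γ, Box.Nonempty ∧ ∀ x, W t x ≤ K → ∀ T ∈ Box,
      ε / Box.card ≤ ∑ z, if π z = T then Pr x z else 0) (l : ℕ) (x y : Ω) :
    ∃ μ : (Fin l → Ω × Ω) → ℝ, (∀ ω, 0 ≤ μ ω) ∧
      (∀ ωx : Fin l → Ω, (∑ ω : Fin l → Ω × Ω, if (fun i => (ω i).1) = ωx then μ ω else 0) =
        trajProb Pr x l ωx) ∧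
      (∀ ωy : Fin l → Ω, (∑ ω : Fin l → Ω × Ω, if (fun i => (ω i).2) = ωy then μ ω else 0) =
        trajProb Pr y l ωy) ∧
      1 - (1 - ε) ^ l - (W 0 x + W 0 y + 2 * C) * ((1 / K + l / R) / (1 - ρ)) ≤
        ∑ ω : Fin l → Ω × Ω, if ∃ i, π (ω i).1 = π (ω i).2 then μ ω else 0 := by
  have hQex : ∀ t (z : Ω × Ω), ∃ Q : Ω × Ω → ℝ, (∀ z', 0 ≤ Q z') ∧
      (∀ x, ∑ y, Q (x, y) = Pr z.1 x) ∧ (∀ y, ∑ x, Q (x, y) = Pr z.2 y) ∧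
      (W t z.1 ≤ K → W t z.2 ≤ K → ε ≤ ∑ z' : Ω × Ω, if π z'.1 = π z'.2 then Q z' else 0) := by
    intro t z
    by_cases h : W t z.1 ≤ K ∧ W t z.2 ≤ K
    · obtain ⟨Box, hne, hB⟩ := minor t
      have hc : (0 : ℝ) < Box.card := by exact_mod_cast hne.card_pos
      obtain ⟨Q, h1, h2, h3, h4⟩ := exists_coupling_of_minorized π (Pr z.1) (Pr z.2) (hP _) (hP _)
        (hP1 _) (hP1 _) Box (ε / Box.card) ε (by positivity) (by field_simp) hε1 (hB _ h.1) (hB _ h.2)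
      exact ⟨Q, h1, h2, h3, fun _ _ => h4⟩
    · refine ⟨fun z' => Pr z.1 z'.1 * Pr z.2 z'.2, fun z' => mul_nonneg (hP _ _) (hP _ _), ?_, ?_,
        fun h1 h2 => absurd ⟨h1, h2⟩ h⟩
      · intro x; simp [← mul_sum, hP1]
      · intro x; simp [← sum_mul, hP1]
  choose Q hQ hQ1 hQ2 hQε using hQex
  have hQt : ∀ t z, ∑ z', Q t z z' = 1 := by
    intro t z
    rw [Fintype.sum_prod_type]
    simp [hQ1, hP1]
  refine ⟨cplProb Q l 0 (x, y), cplProb_nonneg Q hQ l 0 _, ?_, ?_, ?_⟩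
  · refine cplProb_marginal (Z := Ω × Ω) Prod.fst Pr Q ?_ l 0 (x, y)
    intro t z x
    rw [← hQ1 t z x, Fintype.sum_prod_type, Finset.sum_eq_single x]
    · simp
    · intro b _ hb; simp [hb]
    · simp
  · refine cplProb_marginal (Z := Ω × Ω) Prod.snd Pr Q ?_ l 0 (x, y)
    intro t z x
    rw [← hQ2 t z x, Fintype.sum_prod_type_right, Finset.sum_eq_single x]
    · simp
    · intro b _ hb; simp [hb]
    · simp
  · have htot := cplProb_sum Q hQt l 0 (x, y)
    have hfail := fail_le π Pr W K ε hP hε hε1 Q hQ hQ1 hQ2 hQt hQε l 0 (x, y)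
    have hsplit : (∑ ω : Fin l → Ω × Ω, if ∃ i, π (ω i).1 = π (ω i).2 then cplProb Q l 0 (x, y) ω else 0)
        + (∑ ω : Fin l → Ω × Ω, if ∀ i, π (ω i).1 ≠ π (ω i).2 then cplProb Q l 0 (x, y) ω else 0) = 1 := by
      rw [← htot, ← sum_add_distrib]
      apply sum_congr rfl
      intro ω _
      by_cases h : ∃ i, π (ω i).1 = π (ω i).2
      · have h' : ¬ ∀ i, π (ω i).1 ≠ π (ω i).2 := by push Not; exact h
        rw [if_pos h, if_neg h', add_zero]
      · have h' : ∀ i, π (ω i).1 ≠ π (ω i).2 := by push Not at h; exact h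
        rw [if_neg h, if_pos h', zero_add]
    have hB0 := occCoeff_nonneg hK hR hρ hε hε1 l
    have hS0 : 0 ≤ ∑ i ∈ range l, occCoeff K ε ρ R i :=
      sum_nonneg fun i _ => occCoeff_nonneg hK hR hρ hε hε1 i
    have hsum := occCoeff_sum K ε ρ R l
    have he : 0 ≤ (1 - ε) ^ l := pow_nonneg (by linarith) _
    have hle : occCoeff K ε ρ R l + (1 - ρ) * ∑ i ∈ range l, occCoeff K ε ρ R i ≤ 1 / K + l / R := by
      rw [hsum, sub_div]
      have : 0 ≤ (1 - ε) ^ l / K := by positivity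
      linarith
    have h1ρ : 0 < 1 - ρ := by linarith
    have hSle : ∑ i ∈ range l, occCoeff K ε ρ R i ≤ (1 / K + l / R) / (1 - ρ) := by
      rw [le_div_iff₀ h1ρ]; nlinarith
    have hBle : occCoeff K ε ρ R l ≤ (1 / K + l / R) / (1 - ρ) := by
      rw [le_div_iff₀ h1ρ]; nlinarith [mul_nonneg h1ρ.le hS0]
    have o := occup_le Pr W K ε ρ C R hP hP1 hW hK hR hε hε1 hρ hC drift l 0
    have ox := o x
    have oy := o y
    have m1 := mul_le_mul_of_nonneg_left hBle (hW 0 x)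
    have m2 := mul_le_mul_of_nonneg_left hBle (hW 0 y)
    have m3 := mul_le_mul_of_nonneg_left hSle hC
    dsimp only at hfail
    linarith

theorem theta_eq_of_root {l y : ℝ} (hl : 1 < l) (hy : y ∈ Set.Ioo (0 : ℝ) 1)
    (h : Real.exp (-l * y) = 1 - y) : theta l = y := by
  have huniq : ∀ y z : ℝ, 0 < y → y < z → Real.exp (-l * y) = 1 - y →
      Real.exp (-l * z) = 1 - z → False := by
    intro y z hy hyz h1 h2
    have hz : 0 < z := hy.trans hyz
    have hlz : (-l * z) ≠ 0 := by nlinarith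
    have := strictConvexOn_exp.2 (Set.mem_univ (-l * z)) (Set.mem_univ (0 : ℝ)) hlz
      (show 0 < y / z by positivity)
      (show 0 < 1 - y / z by rw [sub_pos, div_lt_one hz]; exact hyz) (by ring)
    simp only [smul_eq_mul, mul_zero, add_zero, Real.exp_zero, mul_one] at this
    have e : y / z * (-l * z) = -l * y := by field_simp
    rw [e, h1, h2] at this
    have e2 : y / z * (1 - z) + (1 - y / z) = 1 - y := by field_simp; ring
    linarith
  have hs : {x : ℝ | x ∈ Set.Ioo (0 : ℝ) 1 ∧ Real.exp (-l * x) = 1 - x} = {y} := by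
    ext x
    simp only [Set.mem_ofPred_eq, Set.mem_singleton_iff]
    constructor
    · rintro ⟨hx, hx'⟩
      rcases lt_trichotomy x y with hlt | heq | hlt
      · exact (huniq x y hx.1 hlt hx' h).elim
      · exact heq
      · exact (huniq y x hy.1 hlt h hx').elim
    · rintro rfl
      exact ⟨hy, h⟩
  rw [theta, if_neg (not_le.2 hl), hs, csSup_singleton]

theorem theta_root_of_ne_zero {l : ℝ} (h : theta l ≠ 0) :
    theta l ∈ Set.Ioo (0 : ℝ) 1 ∧ Real.exp (-l * theta l) = 1 - theta l := by
  have hl : 1 < l := by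
    by_contra hl
    exact h (if_pos (not_lt.1 hl))
  have hne : {x : ℝ | x ∈ Set.Ioo (0 : ℝ) 1 ∧ Real.exp (-l * x) = 1 - x}.Nonempty := by
    rw [Set.nonempty_iff_ne_empty]
    intro he
    apply h
    rw [theta, if_neg (not_le.2 hl), he, Real.sSup_empty]
  obtain ⟨y, hy, hy'⟩ := hne
  rw [theta_eq_of_root hl hy hy']
  exact ⟨hy, hy'⟩

theorem exp_neg_lt_quadratic {u : ℝ} (hu : 0 < u) : Real.exp (-u) ≤ 1 - u + u ^ 2 / 2 := by
  have h1 := Real.quadratic_le_exp_of_nonneg hu.le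
  rw [Real.exp_neg, inv_le_iff_one_le_mul₀ (Real.exp_pos u)]
  have h2 : 0 ≤ 1 - u + u ^ 2 / 2 := by nlinarith [sq_nonneg (1 - u)]
  have h3 := mul_le_mul_of_nonneg_left h1 h2
  nlinarith [sq_nonneg (u ^ 2)]

theorem lt_one_sub_exp_neg {u : ℝ} (hu : 0 < u) : 1 - Real.exp (-u) < u := by
  have := Real.add_one_lt_exp (neg_ne_zero.2 hu.ne')
  linarith

/-- The fixed point `aFix` and the giant density `y` of the percolation step at `aFix`. -/
theorem aFix_spec (q : ℕ) (hq : 2 ≤ q) (β : ℝ) (hβ : (q : ℝ) < β) :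
    ∃ y : ℝ, 0 < y ∧ y < 1 ∧ 1 / (q : ℝ) < aFix q β ∧ aFix q β < 1 ∧
      aFix q β = 1 / q + (1 - 1 / q) * y * aFix q β ∧
      Real.exp (-(β * aFix q β * y)) = 1 - y := by
  have hq2 : (2 : ℝ) ≤ q := by exact_mod_cast hq
  have hq0 : (0 : ℝ) < q := by linarith
  have hβ0 : 0 < β := by linarith
  set G : ℝ → ℝ := fun u => u * (1 / q + (1 - 1 / q) * Real.exp (-u)) - β / q * (1 - Real.exp (-u))
    with hG
  set g : ℝ → ℝ := fun u => u / (β * (1 - Real.exp (-u))) with hg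
  have hqi : 1 / (q : ℝ) ≤ 1 / 2 := by
    apply one_div_le_one_div_of_le <;> linarith
  have hqi0 : 0 < 1 / (q : ℝ) := by positivity
  set ε : ℝ := 1 - q / β with hε
  have hqβ : q / β < 1 := by rw [div_lt_one hβ0]; exact hβ
  have hqβ0 : 0 < q / β := by positivity
  have hε0 : 0 < ε := by linarith
  have hneg : ∀ u, 0 < u → u ≤ ε → G u < 0 := by
    intro u hu hue
    have h1 := exp_neg_lt_quadratic hu
    have h2 : Real.exp (-u) ≤ 1 := Real.exp_le_one_iff.2 (by linarith)
    have h3 : 1 / (q : ℝ) + (1 - 1 / q) * Real.exp (-u) ≤ 1 := by nlinarith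
    have h4 : β / q * (u - u ^ 2 / 2) ≤ β / q * (1 - Real.exp (-u)) := by
      apply mul_le_mul_of_nonneg_left _ (by positivity); linarith
    have h5 : u < β / q * (u - u ^ 2 / 2) := by
      have : β / q * (u - u ^ 2 / 2) = u * ((1 - u / 2) / (q / β)) := by field_simp
      rw [this]
      have : 1 < (1 - u / 2) / (q / β) := by
        rw [lt_div_iff₀ hqβ0]; linarith
      nlinarith
    have h6 : u * (1 / (q : ℝ) + (1 - 1 / q) * Real.exp (-u)) ≤ u * 1 :=
      mul_le_mul_of_nonneg_left h3 hu.le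
    simp only [hG]
    linarith
  have hGc : Continuous G := by fun_prop
  have hεβ : ε ≤ β := by linarith
  have hGβ : 0 < G β := by
    have : G β = Real.exp (-β) * (β * (1 - 1 / q) + β / q) := by simp only [hG]; ring
    rw [this]
    have : β * (1 - 1 / q) + β / q = β := by ring
    rw [this]
    positivity
  set Z : Set ℝ := {u | u ∈ Set.Icc ε β ∧ G u = 0} with hZ
  have hZc : IsCompact Z := isCompact_Icc.inter_right (isClosed_eq hGc continuous_const)
  have hZne : Z.Nonempty := by
    obtain ⟨u, hu, hu'⟩ := intermediate_value_Icc hεβ hGc.continuousOn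
      (show (0 : ℝ) ∈ Set.Icc (G ε) (G β) from ⟨(hneg ε hε0 le_rfl).le, hGβ.le⟩)
    exact ⟨u, hu, hu'⟩
  have hepos : ∀ u, 0 < u → 0 < 1 - Real.exp (-u) := by
    intro u hu
    have : Real.exp (-u) < 1 := by rw [Real.exp_lt_one_iff]; linarith
    linarith
  have hgc : ContinuousOn g Z := by
    apply ContinuousOn.div (by fun_prop) (by fun_prop)
    intro u hu
    have := hepos u (hε0.trans_le hu.1.1)
    positivity
  have himg : {x : ℝ | x ∈ Set.Ioc (1 / (q : ℝ)) 1 ∧ F q β x = x} = g '' Z := by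
    ext x
    simp only [Set.mem_ofPred_eq, Set.mem_image]
    constructor
    · rintro ⟨hx, hF⟩
      have hx0 : 0 < x := hqi0.trans hx.1
      unfold F at hF
      have hne : theta (β * x) ≠ 0 := by
        intro h0
        rw [h0] at hF
        linarith [hx.1]
      obtain ⟨hy, hy'⟩ := theta_root_of_ne_zero hne
      set y := theta (β * x)
      have hu : 0 < β * x * y := by have := hy.1; positivity
      have hGu : G (β * x * y) = 0 := by
        simp only [hG]
        have : -(β * x * y) = -(β * x) * y := by ring
        rw [this, hy']
        have : β * x * y * (1 / q + (1 - 1 / q) * (1 - y)) - β / q * (1 - (1 - y)) =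
          β * y * (x - (1 / q + (1 - 1 / q) * y * x)) := by ring
        rw [this, hF]; ring
      refine ⟨β * x * y, ⟨⟨?_, ?_⟩, hGu⟩, ?_⟩
      · by_contra hlt
        exact (hneg _ hu (not_le.1 hlt).le).ne hGu
      · have : x * y ≤ 1 * 1 := mul_le_mul hx.2 hy.2.le hy.1.le (by norm_num)
        nlinarith
      · simp only [hg]
        have : -(β * x * y) = -(β * x) * y := by ring
        rw [this, hy']
        have := hy.1.ne'
        have e : β * (1 - (1 - y)) = β * y := by ring
        rw [e]
        field_simp
    · rintro ⟨u, hu, rfl⟩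
      have hu0 : 0 < u := hε0.trans_le hu.1.1
      have he := hepos u hu0
      have hx0 : 0 < g u := by simp only [hg]; positivity
      have hβx : β * g u = u / (1 - Real.exp (-u)) := by simp only [hg]; field_simp
      have hth : theta (β * g u) = 1 - Real.exp (-u) := by
        rw [hβx]
        apply theta_eq_of_root
        · rw [one_lt_div he]; exact lt_one_sub_exp_neg hu0
        · exact ⟨he, by linarith [Real.exp_pos (-u)]⟩
        · rw [neg_mul, div_mul_cancel₀ _ he.ne']; ring
      have hfix : F q β (g u) = g u := by
        unfold F
        rw [hth]
        have h0 : G u = 0 := hu.2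
        simp only [hG] at h0
        have h1 : g u * (β * (1 - Real.exp (-u))) = u := by
          simp only [hg]; field_simp
        have h2 : β * (1 - Real.exp (-u)) * (1 / q + (1 - 1 / q) * (1 - Real.exp (-u)) * g u - g u) = 0 := by
          have : β * (1 - Real.exp (-u)) * (1 / q + (1 - 1 / q) * (1 - Real.exp (-u)) * g u - g u) =
            β / q * (1 - Real.exp (-u)) - (g u * (β * (1 - Real.exp (-u)))) *
              (1 - (1 - 1 / q) * (1 - Real.exp (-u))) := by ring
          rw [this, h1]
          linear_combination -h0
        have h3 : β * (1 - Real.exp (-u)) ≠ 0 := by positivity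
        have := (mul_eq_zero.1 h2).resolve_left h3
        linarith
      refine ⟨⟨?_, ?_⟩, hfix⟩
      · unfold F at hfix
        rw [hth] at hfix
        have : 0 < (1 - 1 / (q : ℝ)) * (1 - Real.exp (-u)) * g u := by
          have : 0 < 1 - 1 / (q : ℝ) := by linarith
          positivity
        linarith
      · unfold F at hfix
        rw [hth] at hfix
        have h1 : g u * (1 - (1 - 1 / q) * (1 - Real.exp (-u))) = 1 / q := by linarith
        by_contra hgt
        push Not at hgt
        have h2 : 1 / (q : ℝ) < 1 - (1 - 1 / q) * (1 - Real.exp (-u)) := by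
          nlinarith [Real.exp_pos (-u)]
        nlinarith
  have hmem : aFix q β ∈ {x : ℝ | x ∈ Set.Ioc (1 / (q : ℝ)) 1 ∧ F q β x = x} := by
    have hc : IsCompact {x : ℝ | x ∈ Set.Ioc (1 / (q : ℝ)) 1 ∧ F q β x = x} := by
      rw [himg]; exact hZc.image_of_continuousOn hgc
    exact hc.sSup_mem (by rw [himg]; exact hZne.image g)
  obtain ⟨hx, hF⟩ := hmem
  set x := aFix q β
  have hx0 : 0 < x := hqi0.trans hx.1
  unfold F at hF
  have hne : theta (β * x) ≠ 0 := by
    intro h0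
    rw [h0] at hF
    linarith [hx.1]
  obtain ⟨hy, hy'⟩ := theta_root_of_ne_zero hne
  refine ⟨theta (β * x), hy.1, hy.2, hx.1, ?_, hF.symm, ?_⟩
  · have h1 : x * (1 - (1 - 1 / q) * theta (β * x)) = 1 / q := by linarith
    have h2 : 1 / (q : ℝ) < 1 - (1 - 1 / q) * theta (β * x) := by
      nlinarith [hy.2]
    by_contra hge
    push Not at hge
    nlinarith
  · rw [← hy']; congr 1; ring

/-- The stability condition at the fixed point. -/
theorem stability {q β a y : ℝ} (hq : 2 ≤ q) (hβ : q < β) (hy : 0 < y) (hy1 : y < 1)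
    (ha : 1 / q < a) (hfix : a = 1 / q + (1 - 1 / q) * y * a)
    (hexp : Real.exp (-(β * a * y)) = 1 - y) :
    (1 - 1 / q) * y + β * a * (1 - y) < 1 := by
  have hqi : 0 < 1 / q := by positivity
  have ha0 : 0 < a := by linarith
  set l := β * a with hl
  have hl0 : 0 < l := by have : 0 < β := by linarith
                         positivity
  have h1 : 1 < l * (1 - (1 - 1 / q) * y) := by
    have : l * (1 - (1 - 1 / q) * y) = β * (a - (1 - 1 / q) * y * a) := by rw [hl]; ring
    rw [this]
    have : a - (1 - 1 / q) * y * a = 1 / q := by linarith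
    rw [this, mul_one_div, one_lt_div (by linarith)]
    exact hβ
  have h2 : l ^ 2 * (1 - y) ≤ 1 := by
    set u := l * y / 2 with hu
    have hu0 : 0 < u := by positivity
    have hs := (Real.self_le_sinh_iff).2 hu0.le
    have e1 : Real.exp (-u) ^ 2 = 1 - y := by
      rw [← hexp, ← Real.exp_nat_mul]; congr 1; rw [hu]; push_cast; ring
    rw [Real.sinh_eq] at hs
    have e2 : Real.exp (-u) * Real.exp u = 1 := by rw [← Real.exp_add]; simp
    have hp := Real.exp_pos (-u)
    have h3 := mul_le_mul_of_nonneg_left hs hp.le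
    have h4 : Real.exp (-u) * (l * y) ≤ y := by
      have : Real.exp (-u) * (l * y) = 2 * (Real.exp (-u) * u) := by rw [hu]; ring
      nlinarith
    have h5 : l * Real.exp (-u) ≤ 1 := by
      by_contra h
      push Not at h
      nlinarith
    rw [← e1]
    have : 0 ≤ l * Real.exp (-u) := by positivity
    nlinarith
  nlinarith

/-- Constants governing one step of the dynamics near the majority point: `d` is the giant
density window, `y` the giant density. -/
structure StepConsts (q : ℕ) (β a y r₀ κ x₀ D ρ c : ℝ) : Prop where
  hr : 0 < r₀
  hra : r₀ < a / 2
  hκ : 0 < κ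
  hx₀ : x₀ < 1
  hx₀' : 0 < x₀
  hD : 0 < D
  hD1 : D ≤ 1
  hρ : 0 < ρ
  hρ1 : ρ < 1
  hc : 0 < c
  slope : (a + r₀) * β * Real.exp (-(β * κ)) ≤ 1 - D
  contr : (1 - 1 / (q : ℝ)) * y ≤ ρ * D
  below : (1 + c) * κ ≤ (a - r₀) * (1 - Real.exp (-(β * κ)))
  sub : β * (a + r₀ - κ) ≤ x₀
  sub' : β * ((1 - y * a) / q + r₀) ≤ x₀

theorem exists_stepConsts (q : ℕ) (hq : 2 ≤ q) {β a y : ℝ} (hβ : (q : ℝ) < β) (hy : 0 < y)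
    (hy1 : y < 1) (ha : 1 / (q : ℝ) < a) (hfix : a = 1 / q + (1 - 1 / q) * y * a)
    (hexp : Real.exp (-(β * a * y)) = 1 - y) :
    ∃ r₀ κ x₀ D ρ c, StepConsts q β a y r₀ κ x₀ D ρ c := by
  have hq2 : (2 : ℝ) ≤ q := by exact_mod_cast hq
  have hq0 : (0 : ℝ) < q := by linarith
  have hβ0 : 0 < β := by linarith
  have hqi : 0 < 1 / (q : ℝ) := by positivity
  have hqi2 : 1 / (q : ℝ) ≤ 1 / 2 := by apply one_div_le_one_div_of_le <;> linarith
  have ha0 : 0 < a := by linarith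
  have hst := stability hq2 hβ hy hy1 ha hfix hexp
  set m := 1 - β * a * (1 - y) with hm
  have hcy : 0 < (1 - 1 / (q : ℝ)) * y := by
    have : 0 < 1 - 1 / (q : ℝ) := by linarith
    positivity
  set D := ((1 - 1 / (q : ℝ)) * y + m) / 2 with hDdef
  have hDm : D < m := by linarith
  have hD0 : (1 - 1 / (q : ℝ)) * y < D := by linarith
  have hm1 : m < 1 := by have : 0 < β * a * (1 - y) := by
                           have : 0 < 1 - y := by linarith
                           positivity
                         linarith
  set x₀ := 1 - D with hx
  have hDpos : 0 < D := by linarith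
  -- the point `κ` slightly below `y * a`
  have hbelow : ∀ κ, 0 < κ → κ < y * a → κ < a * (1 - Real.exp (-(β * κ))) := by
    intro κ hκ hκy
    have hlz : (-(β * (y * a))) ≠ 0 := by
      have : 0 < β * (y * a) := by positivity
      linarith
    have := strictConvexOn_exp.2 (Set.mem_univ (-(β * (y * a)))) (Set.mem_univ (0 : ℝ)) hlz
      (show 0 < κ / (y * a) by positivity)
      (show 0 < 1 - κ / (y * a) by rw [sub_pos, div_lt_one (by positivity)]; exact hκy) (by ring)
    simp only [smul_eq_mul, mul_zero, add_zero, Real.exp_zero, mul_one] at this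
    have e : κ / (y * a) * -(β * (y * a)) = -(β * κ) := by field_simp
    have e3 : -(β * (y * a)) = -(β * a * y) := by ring
    rw [e, e3, hexp] at this
    have e2 : κ / (y * a) * (1 - y) + (1 - κ / (y * a)) = 1 - κ / a := by field_simp; ring
    rw [e2] at this
    have h3 : κ / a < 1 - Real.exp (-(β * κ)) := by linarith
    rw [div_lt_iff₀ ha0] at h3
    linarith
  -- choose `κ`
  have hev : ∀ᶠ t in nhdsWithin (0 : ℝ) (Set.Ioi 0),
      t < y * a ∧ (a + t ^ 2) * β * Real.exp (-(β * (y * a - t))) < 1 - D ∧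
      β * (a + t - (y * a - t)) < x₀ ∧ β * ((1 - y * a) / q + t) < x₀ ∧ t < a / 2 := by
    have key : ∀ f : ℝ → ℝ, Continuous f → ∀ b, f 0 < b →
        ∀ᶠ t in nhdsWithin (0 : ℝ) (Set.Ioi 0), f t < b := by
      intro f hf b hb
      exact (hf.tendsto 0).mono_left nhdsWithin_le_nhds |>.eventually_lt_const hb
    have hya : (1 - y * a) / q = a * (1 - y) := by
      field_simp
      have : a * q = 1 + (q - 1) * y * a := by
        have := congrArg (· * (q : ℝ)) hfix
        field_simp at this
        linarith
      linarith
    refine (key (fun t => t) continuous_id _ (by positivity)).and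
      ((key (fun t => (a + t ^ 2) * β * Real.exp (-(β * (y * a - t)))) (by fun_prop) _ ?_).and
      ((key (fun t => β * (a + t - (y * a - t))) (by fun_prop) _ ?_).and
      ((key (fun t => β * ((1 - y * a) / q + t)) (by fun_prop) _ ?_).and
      (key (fun t => t) continuous_id _ (by positivity)))))
    · have : -(β * (y * a - 0)) = -(β * a * y) := by ring
      simp only [this, hexp]
      nlinarith
    · nlinarith
    · simp only [hya, hx]
      nlinarith
  obtain ⟨t, ⟨ht1, ht2, ht3, ht4, ht5⟩, ht0⟩ := (hev.and self_mem_nhdsWithin).exists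
  have ht0 : 0 < t := ht0
  set κ := y * a - t with hκdef
  have hκ0 : 0 < κ := by linarith
  have hb := hbelow κ hκ0 (by linarith)
  set w := a * (1 - Real.exp (-(β * κ))) - κ with hw
  have hw0 : 0 < w := by linarith
  set r₀ := min (min t (t ^ 2)) (w / 2) with hr
  have hr0 : 0 < r₀ := by
    apply lt_min (lt_min ht0 (by positivity)); linarith
  have hr1 : r₀ ≤ t := (min_le_left _ _).trans (min_le_left _ _)
  have hr2 : r₀ ≤ t ^ 2 := (min_le_left _ _).trans (min_le_right _ _)
  have hr3 : r₀ ≤ w / 2 := min_le_right _ _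
  refine ⟨r₀, κ, x₀, D, (1 - 1 / (q : ℝ)) * y / D, w / 2 / κ, ?_⟩
  constructor
  · exact hr0
  · linarith
  · exact hκ0
  · linarith
  · linarith
  · exact hDpos
  · linarith
  · positivity
  · rw [div_lt_one hDpos]; exact hD0
  · positivity
  · have hE := Real.exp_pos (-(β * κ))
    have : (a + r₀) * β * Real.exp (-(β * κ)) ≤ (a + t ^ 2) * β * Real.exp (-(β * κ)) := by gcongr
    linarith
  · rw [div_mul_cancel₀ _ hDpos.ne']
  · have h1 : (1 + w / 2 / κ) * κ = κ + w / 2 := by field_simp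
    rw [h1]
    have hE := Real.exp_pos (-(β * κ))
    nlinarith
  · have : β * (a + r₀ - κ) ≤ β * (a + t - κ) := by gcongr
    linarith
  · have : β * ((1 - y * a) / q + r₀) ≤ β * ((1 - y * a) / q + t) := by gcongr
    linarith

theorem factorial_le_stirling {n : ℕ} (hn : 1 ≤ n) :
    (n.factorial : ℝ) ≤ Real.exp 1 * Real.sqrt n * (n / Real.exp 1) ^ n := by
  obtain ⟨m, rfl⟩ : ∃ m, n = m + 1 := ⟨n - 1, by omega⟩
  have h := Stirling.stirlingSeq'_antitone (Nat.zero_le m)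
  simp only [Function.comp, Nat.succ_eq_add_one, zero_add, Stirling.stirlingSeq_one] at h
  rw [Stirling.stirlingSeq, div_le_iff₀ (by positivity)] at h
  refine h.trans (le_of_eq ?_)
  rw [Real.sqrt_mul (by norm_num : (0 : ℝ) ≤ 2)]
  have : Real.sqrt 2 ≠ 0 := by positivity
  field_simp

theorem central_le {N k : ℕ} (hk : 1 ≤ k) (hkN : k < N) :
    (N.choose k : ℝ) * ((k : ℝ) / N) ^ k * (1 - (k : ℝ) / N) ^ (N - k) ≤
      Real.exp 1 * Real.sqrt N / (Real.sqrt k * Real.sqrt (N - k : ℕ)) := by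
  obtain ⟨j, rfl⟩ : ∃ j, N = k + j := ⟨N - k, by omega⟩
  have hj : 1 ≤ j := by omega
  have hk0 : (0 : ℝ) < k := by exact_mod_cast hk
  have hj0 : (0 : ℝ) < j := by exact_mod_cast hj
  rw [Nat.add_sub_cancel_left]
  have h1 : (((k + j).choose k : ℕ) : ℝ) * (k.factorial * j.factorial) = (k + j).factorial := by
    have := Nat.add_choose_mul_factorial_mul_factorial k j
    rw [← this, Nat.choose_symm_add]; push_cast; ring
  have hNst := factorial_le_stirling (n := k + j) (by omega)
  have hkst := Stirling.le_factorial_stirling k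
  have hjst := Stirling.le_factorial_stirling j
  have e := Real.exp_pos 1
  have hpi : (1 : ℝ) ≤ 2 * Real.pi := by nlinarith [Real.pi_gt_three]
  have hk' : Real.sqrt k * (k / Real.exp 1) ^ k ≤ k.factorial := by
    refine le_trans ?_ hkst
    gcongr
    nlinarith
  have hj' : Real.sqrt j * (j / Real.exp 1) ^ j ≤ j.factorial := by
    refine le_trans ?_ hjst
    gcongr
    nlinarith
  have hsk : 0 < Real.sqrt k := Real.sqrt_pos.2 hk0
  have hsj : 0 < Real.sqrt j := Real.sqrt_pos.2 hj0
  rw [le_div_iff₀ (by positivity)]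
  have h2 : 1 - (k : ℝ) / ((k + j : ℕ) : ℝ) = j / ((k + j : ℕ) : ℝ) := by
    push_cast; field_simp; ring
  rw [h2]
  have hNpos : (0 : ℝ) < ((k + j : ℕ) : ℝ) := by push_cast; positivity
  have h3 : (((k + j).choose k : ℕ) : ℝ) * ((Real.sqrt k * (k / Real.exp 1) ^ k) *
      (Real.sqrt j * (j / Real.exp 1) ^ j)) ≤
      Real.exp 1 * Real.sqrt (k + j : ℕ) * (((k + j : ℕ) : ℝ) / Real.exp 1) ^ (k + j) := by
    refine le_trans ?_ hNst
    rw [← h1]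
    gcongr
  have h4 : 0 < (((k + j : ℕ) : ℝ) / Real.exp 1) ^ (k + j) := by positivity
  rw [← mul_le_mul_iff_left₀ h4]
  refine le_trans (le_of_eq ?_) h3
  rw [pow_add]
  simp only [div_pow]
  field_simp

theorem choose_mul_le_one {N k : ℕ} (hkN : k ≤ N) {y : ℝ} (hy : 0 ≤ y) (hy1 : y ≤ 1) :
    (N.choose k : ℝ) * y ^ k * (1 - y) ^ (N - k) ≤ 1 := by
  have h := add_pow y (1 - y) N
  rw [show y + (1 - y) = 1 by ring, one_pow] at h
  have h1 : 0 ≤ 1 - y := by linarith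
  refine le_trans (le_of_eq ?_) ((single_le_sum (f := fun m => y ^ m * (1 - y) ^ (N - m) * (N.choose m : ℝ))
    (fun i _ => by positivity) (mem_range.2 (Nat.lt_succ_of_le hkN))).trans_eq h.symm)
  ring

theorem pow_le_pow_mul_exp {x y : ℝ} (hx : 0 ≤ x) (hy : 0 ≤ y) (k : ℕ) (M : ℝ)
    (hyM : y * M = k) :
    x ^ k ≤ y ^ k * Real.exp (2 * M * (Real.sqrt x * Real.sqrt y - y)) := by
  rcases hy.eq_or_lt with h0 | hy0
  · have : k = 0 := by rw [← h0, zero_mul] at hyM; exact_mod_cast hyM.symm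
    subst this
    simp [← h0]
  have hsy : 0 < Real.sqrt y := Real.sqrt_pos.2 hy0
  have h1 : Real.sqrt x / Real.sqrt y ≤ Real.exp (Real.sqrt x / Real.sqrt y - 1) := by
    have := Real.add_one_le_exp (Real.sqrt x / Real.sqrt y - 1)
    linarith
  have h2 : Real.sqrt x ≤ Real.sqrt y * Real.exp (Real.sqrt x / Real.sqrt y - 1) := by
    rw [div_le_iff₀ hsy] at h1
    linarith
  have h3 : Real.sqrt x ^ (2 * k) ≤ (Real.sqrt y * Real.exp (Real.sqrt x / Real.sqrt y - 1)) ^ (2 * k) :=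
    pow_le_pow_left₀ (Real.sqrt_nonneg x) h2 _
  rw [mul_pow, pow_mul, pow_mul, Real.sq_sqrt hx, Real.sq_sqrt hy, ← Real.exp_nat_mul] at h3
  refine h3.trans (le_of_eq ?_)
  congr 2
  have e2 : Real.sqrt x * Real.sqrt y - y = y * (Real.sqrt x / Real.sqrt y - 1) := by
    have := Real.mul_self_sqrt hy
    rw [mul_sub, mul_one]
    congr 1
    nth_rewrite 2 [← this]
    field_simp
  rw [e2]
  push_cast
  rw [← hyM]
  ring

theorem binom_hellinger {N k : ℕ} (hN : 1 ≤ N) (hkN : k ≤ N) {x : ℝ} (hx : 0 ≤ x) (hx1 : x ≤ 1) :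
    (N.choose k : ℝ) * x ^ k * (1 - x) ^ (N - k) ≤
      ((N.choose k : ℝ) * ((k : ℝ) / N) ^ k * (1 - (k : ℝ) / N) ^ (N - k)) *
        Real.exp (-(N * (Real.sqrt (k / N) - Real.sqrt x) ^ 2)) := by
  set y : ℝ := (k : ℝ) / N with hy
  have hN0 : (0 : ℝ) < N := by exact_mod_cast hN
  have hkN' : (k : ℝ) ≤ N := by exact_mod_cast hkN
  have hy0 : 0 ≤ y := by positivity
  have hy1 : y ≤ 1 := by rw [hy, div_le_one hN0]; exact hkN'
  have h1 := pow_le_pow_mul_exp hx hy0 k N (by rw [hy]; field_simp)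
  have h2 := pow_le_pow_mul_exp (x := 1 - x) (y := 1 - y) (by linarith) (by linarith) (N - k) N
    (by rw [hy, Nat.cast_sub hkN]; field_simp)
  have h3 : x ^ k * (1 - x) ^ (N - k) ≤
      (y ^ k * Real.exp (2 * N * (Real.sqrt x * Real.sqrt y - y))) *
      ((1 - y) ^ (N - k) * Real.exp (2 * N * (Real.sqrt (1 - x) * Real.sqrt (1 - y) - (1 - y)))) := by
    apply mul_le_mul h1 h2
    · exact pow_nonneg (by linarith) _
    · positivity
  have h4 : Real.exp (2 * N * (Real.sqrt x * Real.sqrt y - y)) *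
      Real.exp (2 * N * (Real.sqrt (1 - x) * Real.sqrt (1 - y) - (1 - y))) ≤
      Real.exp (-(N * (Real.sqrt y - Real.sqrt x) ^ 2)) := by
    rw [← Real.exp_add, Real.exp_le_exp]
    have a1 := Real.sq_sqrt hx
    have a2 := Real.sq_sqrt hy0
    have a3 := Real.sq_sqrt (show 0 ≤ 1 - x by linarith)
    have a4 := Real.sq_sqrt (show 0 ≤ 1 - y by linarith)
    have : 0 ≤ N * (Real.sqrt (1 - x) - Real.sqrt (1 - y)) ^ 2 := by positivity
    nlinarith
  have h5 : 0 ≤ y ^ k * (1 - y) ^ (N - k) := mul_nonneg (by positivity) (pow_nonneg (by linarith) _)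
  calc (N.choose k : ℝ) * x ^ k * (1 - x) ^ (N - k) = (N.choose k : ℝ) * (x ^ k * (1 - x) ^ (N - k)) := by ring
    _ ≤ (N.choose k : ℝ) * ((y ^ k * Real.exp (2 * N * (Real.sqrt x * Real.sqrt y - y))) *
      ((1 - y) ^ (N - k) * Real.exp (2 * N * (Real.sqrt (1 - x) * Real.sqrt (1 - y) - (1 - y))))) := by
        gcongr
    _ = (N.choose k : ℝ) * ((y ^ k * (1 - y) ^ (N - k)) *
        (Real.exp (2 * N * (Real.sqrt x * Real.sqrt y - y)) *
      Real.exp (2 * N * (Real.sqrt (1 - x) * Real.sqrt (1 - y) - (1 - y))))) := by ring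
    _ ≤ (N.choose k : ℝ) * ((y ^ k * (1 - y) ^ (N - k)) * Real.exp (-(N * (Real.sqrt y - Real.sqrt x) ^ 2))) := by
        gcongr
    _ = _ := by ring

/-- The bound on the expected number of components of size `k` in `G(N, 1 - r)`. -/
noncomputable def compWeight (r : ℝ) (N k : ℕ) : ℝ :=
  (N.choose k : ℝ) * (r ^ (k * (N - k)) * (1 - r ^ k) ^ (k - 1))

theorem compWeight_eq {r : ℝ} {N k : ℕ} (hk : 1 ≤ k) (hr : r ^ k < 1) :
    compWeight r N k = (N.choose k : ℝ) * (1 - r ^ k) ^ k * (1 - (1 - r ^ k)) ^ (N - k) / (1 - r ^ k) := by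
  have h0 : (1 - r ^ k) ≠ 0 := by linarith
  rw [eq_div_iff h0, compWeight, sub_sub_cancel, ← pow_mul]
  obtain ⟨j, rfl⟩ : ∃ j, k = j + 1 := ⟨k - 1, by omega⟩
  rw [Nat.add_sub_cancel, pow_succ (1 - r ^ (j + 1)) j]
  ring

theorem compWeight_nonneg {r : ℝ} {N k : ℕ} (hr0 : 0 ≤ r) (hr : r ≤ 1) : 0 ≤ compWeight r N k := by
  have : r ^ k ≤ 1 := pow_le_one₀ hr0 hr
  have : 0 ≤ 1 - r ^ k := by linarith
  unfold compWeight
  positivity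

theorem exp_pow_div (β : ℝ) (n k : ℕ) : Real.exp (-(β / n)) ^ k = Real.exp (-(β * (k / n))) := by
  rw [← Real.exp_nat_mul]; congr 1; ring

theorem compWeight_low {β a r₀ κ c : ℝ} (hβ : 0 < β) (hκ : 0 < κ) (hc : 0 < c) (har : 0 < a - r₀)
    (below : (1 + c) * κ ≤ (a - r₀) * (1 - Real.exp (-(β * κ)))) :
    ∃ c' : ℝ, 0 < c' ∧ ∀ n N k : ℕ, 1 ≤ k → k ≤ N → (k : ℝ) ≤ κ * n → (a - r₀) * n ≤ N →
      compWeight (Real.exp (-(β / n))) N k ≤ N * Real.exp (-(c' * k)) := by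
  refine ⟨(Real.sqrt (1 + c) - 1) ^ 2, ?_, ?_⟩
  · have : 1 < Real.sqrt (1 + c) := by
      rw [Real.lt_sqrt (by norm_num)]; linarith
    have : 0 < Real.sqrt (1 + c) - 1 := by linarith
    positivity
  intro n N k hk hkN hkn hN
  have hk0 : (0 : ℝ) < k := by exact_mod_cast hk
  have hn0 : (0 : ℝ) < n := by
    by_contra h
    have : (n : ℝ) = 0 := le_antisymm (not_lt.1 h) (Nat.cast_nonneg n)
    rw [this] at hkn; linarith
  have hN0 : (0 : ℝ) < N := lt_of_lt_of_le (by positivity) hN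
  have hN1 : 1 ≤ N := by omega
  have hlt : Real.exp (-(β / n)) ^ k < 1 := by
    rw [exp_pow_div, Real.exp_lt_one_iff]
    have : 0 < β * (k / n) := by positivity
    linarith
  rw [compWeight_eq hk hlt]
  set x := 1 - Real.exp (-(β / n)) ^ k with hx
  have hx0 : 0 < x := by linarith
  have hx1 : x ≤ 1 := by
    have : 0 ≤ Real.exp (-(β / n)) ^ k := by positivity
    linarith
  have hxk : (1 + c) * k ≤ N * x := by
    set t := (k : ℝ) / n with ht
    have ht0 : 0 < t := by positivity
    have htκ : t ≤ κ := by rw [ht, div_le_iff₀ hn0]; exact hkn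
    have hconv := convexOn_exp.2 (Set.mem_univ (-(β * κ))) (Set.mem_univ (0 : ℝ))
      (show 0 ≤ t / κ by positivity) (show 0 ≤ 1 - t / κ by rw [sub_nonneg, div_le_one hκ]; exact htκ)
      (by ring)
    simp only [smul_eq_mul, mul_zero, add_zero, Real.exp_zero, mul_one] at hconv
    have e : t / κ * -(β * κ) = -(β * t) := by field_simp
    rw [e] at hconv
    have hxe : x = 1 - Real.exp (-(β * t)) := by rw [hx, exp_pow_div]
    have h1 : t / κ * (1 - Real.exp (-(β * κ))) ≤ x := by rw [hxe]; linarith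
    have h2 : (1 + c) * t ≤ (a - r₀) * x := by
      calc (1 + c) * t = t / κ * ((1 + c) * κ) := by field_simp
        _ ≤ t / κ * ((a - r₀) * (1 - Real.exp (-(β * κ)))) := by gcongr
        _ = (a - r₀) * (t / κ * (1 - Real.exp (-(β * κ)))) := by ring
        _ ≤ _ := by gcongr
    have h3 : (k : ℝ) = t * n := by rw [ht]; field_simp
    calc (1 + c) * k = ((1 + c) * t) * n := by rw [h3]; ring
      _ ≤ ((a - r₀) * x) * n := by gcongr
      _ = ((a - r₀) * n) * x := by ring
      _ ≤ N * x := by gcongr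
  have hB := binom_hellinger hN1 hkN hx0.le hx1
  have hkN' : (k : ℝ) ≤ N := by exact_mod_cast hkN
  have hC := choose_mul_le_one hkN (y := (k : ℝ) / N) (by positivity) (by rw [div_le_one hN0]; exact hkN')
  have hE : Real.exp (-(N * (Real.sqrt (k / N) - Real.sqrt x) ^ 2)) ≤
      Real.exp (-((Real.sqrt (1 + c) - 1) ^ 2 * k)) := by
    rw [Real.exp_le_exp, neg_le_neg_iff]
    have h1 : Real.sqrt (1 + c) * Real.sqrt (k / N) ≤ Real.sqrt x := by
      rw [← Real.sqrt_mul (by linarith)]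
      apply Real.sqrt_le_sqrt
      rw [mul_div_assoc', div_le_iff₀ hN0]; linarith
    have h2 : 1 ≤ Real.sqrt (1 + c) := by
      rw [Real.one_le_sqrt]; linarith
    have h3 := Real.sqrt_nonneg ((k : ℝ) / N)
    have h4 : ((Real.sqrt (1 + c) - 1) * Real.sqrt (k / N)) ^ 2 ≤ (Real.sqrt x - Real.sqrt (k / N)) ^ 2 := by
      apply pow_le_pow_left₀
      · exact mul_nonneg (by linarith) h3
      · linarith
    have h5 : (k : ℝ) = N * Real.sqrt (k / N) ^ 2 := by
      rw [Real.sq_sqrt (by positivity)]; field_simp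
    calc (Real.sqrt (1 + c) - 1) ^ 2 * k = N * ((Real.sqrt (1 + c) - 1) * Real.sqrt (k / N)) ^ 2 := by
          conv_lhs => rw [h5]
          ring
      _ ≤ N * (Real.sqrt x - Real.sqrt (k / N)) ^ 2 := by gcongr
      _ = _ := by ring
  have hx2 : 1 / x ≤ N := by
    rw [div_le_iff₀ hx0]
    have : (1 : ℝ) ≤ k := by exact_mod_cast hk
    nlinarith
  rw [div_eq_mul_one_div]
  calc _ ≤ (1 * Real.exp (-((Real.sqrt (1 + c) - 1) ^ 2 * k))) * (N : ℝ) := by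
        apply mul_le_mul _ hx2 (by positivity) (by positivity)
        refine hB.trans ?_
        gcongr
    _ = _ := by ring

theorem sum_separated_le {D s : ℝ} (hD : 0 < D) (hD1 : D ≤ 1) (hs : 1 ≤ s) (d : ℕ → ℝ) (a b : ℕ)
    (hab : a ≤ b) (hd : ∀ k, a ≤ k → d k + D ≤ d (k + 1)) :
    ∑ k ∈ Ico a b, s / (s ^ 2 + d k ^ 2) ≤ 8 / D := by
  set T : ℝ → ℝ := fun x => x / (s + |x|) with hT
  have hTb : ∀ x, |T x| ≤ 1 := by
    intro x
    simp only [hT]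
    have h1 : 0 < s + |x| := by positivity
    rw [abs_div, abs_of_pos h1, div_le_one h1]
    linarith
  have hmono : ∀ x y, x ≤ y → T x ≤ T y := by
    intro x y hxy
    simp only [hT]
    have h1 : 0 < s + |x| := by positivity
    have h2 : 0 < s + |y| := by positivity
    rw [div_le_div_iff₀ h1 h2]
    have : x * |y| ≤ y * |x| := by
      rcases le_total 0 x with hx | hx
      · rw [abs_of_nonneg hx, abs_of_nonneg (hx.trans hxy)]; nlinarith
      · rw [abs_of_nonpos hx]
        rcases le_total 0 y with hy | hy
        · rw [abs_of_nonneg hy]; nlinarith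
        · rw [abs_of_nonpos hy]; nlinarith
    nlinarith
  have hstep : ∀ x, s / (s ^ 2 + x ^ 2) ≤ (4 / D) * (T (x + D) - T x) := by
    intro x
    have hp : 0 < s ^ 2 + x ^ 2 := by positivity
    have key : D * s / (4 * (s ^ 2 + x ^ 2)) ≤ T (x + D) - T x := by
      simp only [hT]
      rcases le_total 0 x with hx | hx
      · rw [abs_of_nonneg hx, abs_of_nonneg (by linarith), div_sub_div _ _ (by positivity) (by positivity),
          div_le_div_iff₀ (by positivity) (by positivity)]
        have e : (x + D) * (s + x) - (s + (x + D)) * x = D * s := by ring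
        rw [e]
        apply mul_le_mul_of_nonneg_left _ (by positivity)
        nlinarith [sq_nonneg (s - x)]
      · rcases le_total (x + D) 0 with hxD | hxD
        · rw [abs_of_nonpos hx, abs_of_nonpos hxD,
            div_sub_div _ _ (by nlinarith) (by nlinarith),
            div_le_div_iff₀ (by positivity) (by nlinarith)]
          have e : (x + D) * (s + -x) - (s + -(x + D)) * x = D * s := by ring
          rw [e]
          apply mul_le_mul_of_nonneg_left _ (by positivity)
          nlinarith [sq_nonneg (s + x)]
        · rw [abs_of_nonpos hx, abs_of_nonneg hxD,
            div_sub_div _ _ (by nlinarith) (by nlinarith),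
            div_le_div_iff₀ (by positivity) (by nlinarith)]
          have e : (x + D) * (s + -x) - (s + (x + D)) * x = D * s + (-x) * (2 * (x + D)) := by ring
          rw [e]
          have h1 : 0 ≤ (-x) * (2 * (x + D)) * (4 * (s ^ 2 + x ^ 2)) :=
            mul_nonneg (mul_nonneg (by linarith) (by linarith)) (by positivity)
          have h2 : (s + (x + D)) * (s + -x) ≤ 4 * (s ^ 2 + x ^ 2) := by nlinarith
          have h3 := mul_le_mul_of_nonneg_left h2 (show 0 ≤ D * s by positivity)
          linarith
    calc s / (s ^ 2 + x ^ 2) = (4 / D) * (D * s / (4 * (s ^ 2 + x ^ 2))) := by field_simp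
      _ ≤ _ := by gcongr
  calc ∑ k ∈ Ico a b, s / (s ^ 2 + d k ^ 2) ≤ ∑ k ∈ Ico a b, (4 / D) * (T (d (k + 1)) - T (d k)) := by
        apply sum_le_sum
        intro k hk
        refine (hstep (d k)).trans ?_
        have := hmono _ _ (hd k (mem_Ico.1 hk).1)
        gcongr
    _ = (4 / D) * (T (d b) - T (d a)) := by
        rw [← mul_sum, sum_Ico_sub (fun k => T (d k)) hab]
    _ ≤ (4 / D) * 2 := by
        have h1 := abs_le.1 (hTb (d b))
        have h2 := abs_le.1 (hTb (d a))
        gcongr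
        linarith [h1.2, h2.1]
    _ = 8 / D := by ring

set_option maxHeartbeats 1600000 in
theorem compWeight_le_gauss {β a r₀ κ : ℝ} (hβ : 0 < β) (hκ : 0 < κ) (hr₀ : 0 < r₀)
    (hra : r₀ < a / 2) :
    ∃ C : ℝ, 0 < C ∧ ∀ n N k : ℕ, 1 ≤ n → k ≤ N → κ * n ≤ k → (a - r₀) * n ≤ N → N ≤ n →
      compWeight (Real.exp (-(β / n))) N k ≤
        C / Real.sqrt n * Real.exp (-(((k : ℝ) - N * (1 - Real.exp (-(β / n)) ^ k)) ^ 2 / (8 * n))) := by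
  have ha : 0 < a := by linarith
  set ξ := 1 - Real.exp (-(β * κ)) with hξ
  have hξ0 : 0 < ξ := by
    have : Real.exp (-(β * κ)) < 1 := by
      rw [Real.exp_lt_one_iff]; have : 0 < β * κ := by positivity
      linarith
    linarith
  set δ := Real.exp (-β) / 2 with hδ
  have hδ0 : 0 < δ := by positivity
  have hδ1 : δ < 1 / 2 := by
    have : Real.exp (-β) < 1 := by rw [Real.exp_lt_one_iff]; linarith
    linarith
  set η := δ * (a / 2) with hη
  have hη0 : 0 < η := by positivity
  set C1 := Real.exp 1 / Real.sqrt (κ * η) with hC1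
  set C2 := 8 / η ^ 2 with hC2
  have hC10 : 0 < C1 := by positivity
  have hC20 : 0 < C2 := by positivity
  refine ⟨(C1 + C2) / ξ, by positivity, ?_⟩
  intro n N k hn hkN hkn hN hNn
  have hn0 : (0 : ℝ) < n := by exact_mod_cast hn
  have hn1 : (1 : ℝ) ≤ n := by exact_mod_cast hn
  have hk0 : (0 : ℝ) < k := lt_of_lt_of_le (by positivity) hkn
  have hk1 : 1 ≤ k := by exact_mod_cast hk0
  have hN2 : a / 2 * n ≤ N := le_trans (by gcongr; linarith) hN
  have hN0 : (0 : ℝ) < N := lt_of_lt_of_le (by positivity) hN2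
  have hN1 : 1 ≤ N := by exact_mod_cast hN0
  have hkN' : (k : ℝ) ≤ N := by exact_mod_cast hkN
  have hNn' : (N : ℝ) ≤ n := by exact_mod_cast hNn
  have hrk : Real.exp (-(β / n)) ^ k ≤ Real.exp (-(β * κ)) := by
    rw [exp_pow_div, Real.exp_le_exp, neg_le_neg_iff]
    gcongr
    rw [le_div_iff₀ hn0]; exact hkn
  have hrk2 : Real.exp (-β) ≤ Real.exp (-(β / n)) ^ k := by
    rw [exp_pow_div, Real.exp_le_exp, neg_le_neg_iff]
    have : (k : ℝ) / n ≤ 1 := by rw [div_le_one hn0]; linarith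
    nlinarith
  have hlt : Real.exp (-(β / n)) ^ k < 1 := by linarith
  rw [compWeight_eq hk1 hlt]
  set x := 1 - Real.exp (-(β / n)) ^ k with hx
  have hxξ : ξ ≤ x := by linarith
  have hx0 : 0 < x := by linarith
  have hx2 : x ≤ 1 - 2 * δ := by rw [hδ]; linarith
  have hx1 : x ≤ 1 := by linarith
  set d := (k : ℝ) - N * x with hd
  have hB := binom_hellinger hN1 hkN hx0.le hx1
  set y := (k : ℝ) / N with hy
  have hy0 : 0 ≤ y := by positivity
  have hy1 : y ≤ 1 := by rw [hy, div_le_one hN0]; exact hkN'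
  have hE : Real.exp (-(N * (Real.sqrt y - Real.sqrt x) ^ 2)) ≤ Real.exp (-(d ^ 2 / (4 * n))) := by
    rw [Real.exp_le_exp, neg_le_neg_iff]
    have h1 : d = N * ((Real.sqrt y - Real.sqrt x) * (Real.sqrt y + Real.sqrt x)) := by
      have e : (Real.sqrt y - Real.sqrt x) * (Real.sqrt y + Real.sqrt x) = y - x := by
        have a1 := Real.mul_self_sqrt hy0
        have a2 := Real.mul_self_sqrt hx0.le
        linear_combination a1 - a2
      rw [e, hd, hy]; field_simp
    have h2 : Real.sqrt y + Real.sqrt x ≤ 2 := by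
      have b1 : Real.sqrt y ≤ 1 := Real.sqrt_le_one.2 hy1
      have b2 : Real.sqrt x ≤ 1 := Real.sqrt_le_one.2 hx1
      linarith
    have h3 : 0 ≤ Real.sqrt y + Real.sqrt x := by positivity
    have h4 : (Real.sqrt y + Real.sqrt x) ^ 2 ≤ 4 := by nlinarith
    rw [div_le_iff₀ (by positivity), h1]
    have h5 : (N * ((Real.sqrt y - Real.sqrt x) * (Real.sqrt y + Real.sqrt x))) ^ 2 =
      N * (Real.sqrt y - Real.sqrt x) ^ 2 * (N * (Real.sqrt y + Real.sqrt x) ^ 2) := by ring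
    rw [h5]
    have h6 : N * (Real.sqrt y + Real.sqrt x) ^ 2 ≤ n * 4 := by gcongr
    have h7 : 0 ≤ N * (Real.sqrt y - Real.sqrt x) ^ 2 := by positivity
    calc _ ≤ N * (Real.sqrt y - Real.sqrt x) ^ 2 * (n * 4) := mul_le_mul_of_nonneg_left h6 h7
      _ = _ := by ring
  have hcen : (N.choose k : ℝ) * y ^ k * (1 - y) ^ (N - k) * Real.exp (-(d ^ 2 / (4 * n))) ≤
      (C1 + C2) / Real.sqrt n * Real.exp (-(d ^ 2 / (8 * n))) := by
    have h48 : Real.exp (-(d ^ 2 / (4 * n))) = Real.exp (-(d ^ 2 / (8 * n))) * Real.exp (-(d ^ 2 / (8 * n))) := by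
      rw [← Real.exp_add]; congr 1; field_simp; ring
    have hle1 : Real.exp (-(d ^ 2 / (8 * n))) ≤ 1 := by
      rw [Real.exp_le_one_iff]
      have : 0 ≤ d ^ 2 / (8 * n) := by positivity
      linarith
    have hsn : 0 < Real.sqrt n := Real.sqrt_pos.2 hn0
    by_cases hcase : (k : ℝ) ≤ (1 - δ) * N
    · have hkltN : k < N := by
        have : (k : ℝ) < N := by nlinarith
        exact_mod_cast this
      have h1 := central_le hk1 hkltN
      have h2 : Real.exp 1 * Real.sqrt N / (Real.sqrt k * Real.sqrt (N - k : ℕ)) ≤ C1 / Real.sqrt n := by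
        have e1 : Real.sqrt k * Real.sqrt (N - k : ℕ) ≥ Real.sqrt (κ * η) * n := by
          rw [← Real.sqrt_mul hk0.le]
          have : Real.sqrt (κ * η) * n = Real.sqrt ((κ * n) * (η * n)) := by
            rw [show (κ * n) * (η * n) = (κ * η) * (n : ℝ) ^ 2 by ring,
              Real.sqrt_mul (show 0 ≤ κ * η by positivity), Real.sqrt_sq hn0.le]
          rw [this]
          apply Real.sqrt_le_sqrt
          apply mul_le_mul hkn _ (by positivity) hk0.le
          rw [Nat.cast_sub hkN, hη]
          calc δ * (a / 2) * n = δ * (a / 2 * n) := by ring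
            _ ≤ δ * N := by gcongr
            _ ≤ N - k := by linarith
        rw [hC1, div_div]
        calc Real.exp 1 * Real.sqrt N / (Real.sqrt k * Real.sqrt (N - k : ℕ)) ≤
            Real.exp 1 * Real.sqrt n / (Real.sqrt (κ * η) * n) := by gcongr
          _ = Real.exp 1 / (Real.sqrt (κ * η) * Real.sqrt n) := by
            have := Real.mul_self_sqrt hn0.le
            have h0 : 0 < Real.sqrt (κ * η) := by positivity
            rw [div_eq_div_iff (by positivity) (by positivity)]
            calc _ = Real.exp 1 * Real.sqrt (κ * η) * (Real.sqrt n * Real.sqrt n) := by ring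
              _ = _ := by rw [this]; ring
      calc _ ≤ (C1 / Real.sqrt n) * Real.exp (-(d ^ 2 / (4 * n))) := by
            gcongr; exact h1.trans h2
        _ ≤ ((C1 + C2) / Real.sqrt n) * Real.exp (-(d ^ 2 / (8 * n))) := by
            rw [h48]
            gcongr
            · linarith
            · nlinarith [Real.exp_pos (-(d ^ 2 / (8 * n)))]
    · push Not at hcase
      have h1 := choose_mul_le_one hkN hy0 hy1
      have hdη : η * n ≤ d := by
        have : N * x ≤ N * (1 - 2 * δ) := by gcongr
        calc η * n = δ * (a / 2 * n) := by rw [hη]; ring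
          _ ≤ δ * N := by gcongr
          _ ≤ d := by rw [hd]; linarith
      have h2 : Real.exp (-(d ^ 2 / (8 * n))) ≤ C2 / Real.sqrt n := by
        have e1 : η ^ 2 * n / 8 ≤ d ^ 2 / (8 * n) := by
          rw [div_le_div_iff₀ (by norm_num) (by positivity)]
          have : (η * n) ^ 2 ≤ d ^ 2 := pow_le_pow_left₀ (by positivity) hdη 2
          nlinarith
        have e2 : Real.exp (-(d ^ 2 / (8 * n))) ≤ (η ^ 2 * n / 8)⁻¹ := by
          rw [Real.exp_neg]
          apply inv_anti₀ (by positivity)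
          have := Real.add_one_le_exp (d ^ 2 / (8 * n))
          linarith
        refine e2.trans ?_
        have : (η ^ 2 * n / 8)⁻¹ = C2 / n := by rw [hC2]; field_simp
        rw [this]
        gcongr
        rw [Real.sqrt_le_left hn0.le]
        nlinarith
      calc _ ≤ 1 * Real.exp (-(d ^ 2 / (4 * n))) := by gcongr
        _ = Real.exp (-(d ^ 2 / (8 * n))) * Real.exp (-(d ^ 2 / (8 * n))) := by rw [h48, one_mul]
        _ ≤ ((C1 + C2) / Real.sqrt n) * Real.exp (-(d ^ 2 / (8 * n))) := by
            gcongr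
            refine h2.trans ?_
            gcongr
            linarith
  have hfin : (N.choose k : ℝ) * x ^ k * (1 - x) ^ (N - k) ≤
      (C1 + C2) / Real.sqrt n * Real.exp (-(d ^ 2 / (8 * n))) := by
    refine hB.trans (le_trans ?_ hcen)
    have : 0 ≤ 1 - y := by linarith
    gcongr
  calc _ ≤ ((C1 + C2) / Real.sqrt n * Real.exp (-(d ^ 2 / (8 * n)))) / ξ := by gcongr
    _ = _ := by ring

theorem compWeight_window {β a r₀ κ D : ℝ} (hβ : 0 < β) (hκ : 0 < κ) (hr₀ : 0 < r₀)
    (hra : r₀ < a / 2) (hD : 0 < D) (hD1 : D ≤ 1)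
    (slope : (a + r₀) * β * Real.exp (-(β * κ)) ≤ 1 - D) :
    ∃ C : ℝ, 0 < C ∧ ∀ n N : ℕ, 1 ≤ n → (a - r₀) * n ≤ N → N ≤ (a + r₀) * n → N ≤ n →
      ∑ k ∈ (range (N + 1)).filter (fun k : ℕ => κ * n ≤ k), compWeight (Real.exp (-(β / n))) N k *
        (1 + ((k : ℝ) - N * (1 - Real.exp (-(β / n)) ^ k)) ^ 2 / n) ≤ C := by
  obtain ⟨C, hC, hCb⟩ := compWeight_le_gauss hβ hκ hr₀ hra
  refine ⟨C * 128 * (8 / D), by positivity, ?_⟩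
  intro n N hn hN hN' hNn
  have hn0 : (0 : ℝ) < n := by exact_mod_cast hn
  have hn1 : (1 : ℝ) ≤ n := by exact_mod_cast hn
  have hs1 : 1 ≤ Real.sqrt n := by rw [Real.one_le_sqrt]; exact hn1
  set d : ℕ → ℝ := fun k => (k : ℝ) - N * (1 - Real.exp (-(β / n)) ^ k) with hd
  set s := Real.sqrt n with hs
  have hss : s ^ 2 = n := Real.sq_sqrt hn0.le
  have hterm : ∀ k ∈ (range (N + 1)).filter (fun k : ℕ => κ * n ≤ k),
      compWeight (Real.exp (-(β / n))) N k * (1 + d k ^ 2 / n) ≤ (C * 128) * (s / (s ^ 2 + d k ^ 2)) := by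
    intro k hk
    rw [mem_filter, mem_range] at hk
    have h1 := hCb n N k hn (by omega) hk.2 hN hNn
    set u := d k ^ 2 / n with hu
    have hu0 : 0 ≤ u := by positivity
    have e1 : d k ^ 2 / (8 * n) = u / 8 := by rw [hu]; field_simp
    have h2 : (1 + u) ^ 2 ≤ 128 * Real.exp (u / 8) := by
      have := Real.quadratic_le_exp_of_nonneg (show 0 ≤ u / 8 by positivity)
      nlinarith
    have h3 : s / (s ^ 2 + d k ^ 2) = 1 / s * (1 / (1 + u)) := by
      have e : s ^ 2 + d k ^ 2 = s ^ 2 * (1 + u) := by rw [hss, hu]; field_simp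
      rw [e]
      field_simp
    have h4 : Real.exp (-(u / 8)) * (1 + u) ≤ 128 * (1 / (1 + u)) := by
      rw [Real.exp_neg, mul_one_div, le_div_iff₀ (by positivity), inv_mul_eq_div, div_mul_eq_mul_div,
        div_le_iff₀ (Real.exp_pos _)]
      nlinarith
    calc _ ≤ (C / s * Real.exp (-(d k ^ 2 / (8 * n)))) * (1 + u) := by gcongr
      _ = C / s * (Real.exp (-(u / 8)) * (1 + u)) := by rw [e1]; ring
      _ ≤ C / s * (128 * (1 / (1 + u))) := by gcongr
      _ = _ := by rw [h3]; ring
  refine (sum_le_sum hterm).trans ?_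
  rw [← mul_sum]
  apply mul_le_mul_of_nonneg_left _ (by positivity)
  set K := ⌈κ * n⌉₊ with hK
  have hsub : (range (N + 1)).filter (fun k : ℕ => κ * n ≤ k) ⊆ Ico K (max K (N + 1)) := by
    intro k hk
    rw [mem_filter, mem_range] at hk
    rw [mem_Ico]
    exact ⟨Nat.ceil_le.2 hk.2, lt_of_lt_of_le hk.1 (le_max_right _ _)⟩
  refine (sum_le_sum_of_subset_of_nonneg hsub (fun i _ _ => by positivity)).trans ?_
  apply sum_separated_le hD hD1 hs1 d _ _ (le_max_left _ _)
  intro k hk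
  have hkκ : κ * n ≤ k := Nat.ceil_le.1 hk
  simp only [hd]
  have h1 : Real.exp (-(β / n)) ^ k ≤ Real.exp (-(β * κ)) := by
    rw [exp_pow_div, Real.exp_le_exp, neg_le_neg_iff]
    gcongr
    rw [le_div_iff₀ hn0]; exact hkκ
  have h2 : 1 - Real.exp (-(β / n)) ≤ β / n := by
    have := Real.add_one_le_exp (-(β / n)); linarith
  have h3 : 0 ≤ 1 - Real.exp (-(β / n)) := by
    have : Real.exp (-(β / n)) ≤ 1 := by
      rw [Real.exp_le_one_iff]; have : 0 ≤ β / n := by positivity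
      linarith
    linarith
  have h4 : N * (Real.exp (-(β / n)) ^ k * (1 - Real.exp (-(β / n)))) ≤
      ((a + r₀) * n) * (Real.exp (-(β * κ)) * (β / n)) := by
    gcongr
    linarith
  have h5 : ((a + r₀) * n) * (Real.exp (-(β * κ)) * (β / n)) = (a + r₀) * β * Real.exp (-(β * κ)) := by
    field_simp
  rw [pow_succ]
  push_cast
  nlinarith

/-- Expectation of `f E` over the random subset `E` of `U` keeping each element independently with
probability `1 - r`. -/
noncomputable def bex {ι : Type*} (r : ℝ) (U : Finset ι) (f : Finset ι → ℝ) : ℝ :=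
  ∑ E ∈ U.powerset, (1 - r) ^ E.card * r ^ (U.card - E.card) * f E

section bex
variable {ι : Type*} {r : ℝ} {U V : Finset ι} {f g : Finset ι → ℝ}

theorem bex_const (c : ℝ) : bex r U (fun _ => c) = c := by
  rw [bex, ← sum_mul, sum_pow_mul_eq_add_pow]; simp

theorem bex_congr (h : ∀ E ⊆ U, f E = g E) : bex r U f = bex r U g :=
  sum_congr rfl fun E hE => by rw [h E (mem_powerset.1 hE)]

theorem bex_mono (hr : 0 ≤ r) (hr1 : r ≤ 1) (h : ∀ E ⊆ U, f E ≤ g E) : bex r U f ≤ bex r U g :=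
  sum_le_sum fun E hE => mul_le_mul_of_nonneg_left (h E (mem_powerset.1 hE))
    (mul_nonneg (pow_nonneg (by linarith) _) (pow_nonneg hr _))

theorem bex_nonneg (hr : 0 ≤ r) (hr1 : r ≤ 1) (h : ∀ E ⊆ U, 0 ≤ f E) : 0 ≤ bex r U f := by
  rw [← bex_const (r := r) (U := U) 0]
  exact bex_mono hr hr1 h

theorem bex_le_const (hr : 0 ≤ r) (hr1 : r ≤ 1) {c : ℝ} (h : ∀ E ⊆ U, f E ≤ c) : bex r U f ≤ c := by
  rw [← bex_const (r := r) (U := U) c]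
  exact bex_mono hr hr1 h

theorem bex_add : bex r U (fun E => f E + g E) = bex r U f + bex r U g := by
  simp only [bex, mul_add, sum_add_distrib]

theorem bex_mul_left (c : ℝ) : bex r U (fun E => c * f E) = c * bex r U f := by
  simp only [bex, mul_sum]
  exact sum_congr rfl fun E _ => by ring

theorem bex_sum {κ : Type*} (s : Finset κ) (h : κ → Finset ι → ℝ) :
    bex r U (fun E => ∑ k ∈ s, h k E) = ∑ k ∈ s, bex r U (h k) := by
  simp only [bex, mul_sum]
  exact sum_comm

theorem bex_empty : bex r ∅ f = f ∅ := by simp [bex]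

variable [DecidableEq ι]

theorem bex_insert {a : ι} (ha : a ∉ U) :
    bex r (insert a U) f = r * bex r U f + (1 - r) * bex r U (fun E => f (insert a E)) := by
  rw [bex, sum_powerset_insert ha, bex, bex, mul_sum, mul_sum]
  congr 1
  · refine sum_congr rfl fun E hE => ?_
    have := card_le_card (mem_powerset.1 hE)
    rw [card_insert_of_notMem ha, show U.card + 1 - E.card = (U.card - E.card) + 1 by omega, pow_succ]
    ring
  · refine sum_congr rfl fun E hE => ?_
    have haE : a ∉ E := fun h => ha (mem_powerset.1 hE h)
    rw [card_insert_of_notMem ha, card_insert_of_notMem haE, Nat.add_sub_add_right, pow_succ]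
    ring

theorem bex_union (h : Disjoint U V) :
    bex r (U ∪ V) f = bex r V (fun E' => bex r U (fun E => f (E ∪ E'))) := by
  induction U using Finset.induction_on generalizing f with
  | empty => simp [bex_empty]
  | insert a U ha ih =>
    have hd := disjoint_insert_left.1 h
    rw [insert_union, bex_insert (by simp [ha, hd.1]), ih hd.2, ih hd.2, ← bex_mul_left,
      ← bex_mul_left, ← bex_add]
    exact bex_congr fun E _ => by rw [bex_insert ha]; simp only [insert_union]

theorem bex_image {κ : Type*} (φ : κ → ι) (W : Finset κ) (h : Set.InjOn φ W) :
    bex r (W.image φ) f = bex r W (fun T => f (T.image φ)) := by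
  induction W using Finset.induction_on generalizing f with
  | empty => simp [bex_empty]
  | insert a U ha ih =>
    have hU : Set.InjOn φ U := h.mono (by simp)
    rw [image_insert, bex_insert, bex_insert ha, ih hU, ih hU]
    · simp only [image_insert]
    · intro hm
      obtain ⟨b, hb, e⟩ := mem_image.1 hm
      have := h (by simp [hb]) (by simp) e
      exact ha (this ▸ hb)

theorem bex_prod (u w : ι → ℝ) :
    bex r U (fun T => ∏ v ∈ U, if v ∈ T then u v else w v) = ∏ v ∈ U, ((1 - r) * u v + r * w v) := by
  induction U using Finset.induction_on with
  | empty => simp [bex_empty]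
  | insert a U ha ih =>
    rw [bex_insert ha, prod_insert ha, ← ih]
    have h1 : bex r U (fun T => ∏ v ∈ insert a U, if v ∈ T then u v else w v) =
        w a * bex r U (fun T => ∏ v ∈ U, if v ∈ T then u v else w v) := by
      rw [← bex_mul_left]
      refine bex_congr fun E hE => ?_
      rw [prod_insert ha, if_neg fun h => ha (hE h)]
    have h2 : bex r U (fun T => ∏ v ∈ insert a U, if v ∈ insert a T then u v else w v) =
        u a * bex r U (fun T => ∏ v ∈ U, if v ∈ T then u v else w v) := by
      rw [← bex_mul_left]
      refine bex_congr fun E hE => ?_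
      rw [prod_insert ha, if_pos (mem_insert_self _ _)]
      congr 1
      refine prod_congr rfl fun v hv => ?_
      have : v ≠ a := fun h => ha (h ▸ hv)
      simp [this]
    rw [h1, h2]; ring

theorem bex_card : bex r U (fun T => (T.card : ℝ)) = (1 - r) * U.card := by
  induction U using Finset.induction_on with
  | empty => simp [bex_empty]
  | insert a U ha ih =>
    have h2 : bex r U (fun T => ((insert a T).card : ℝ)) = bex r U (fun T => (T.card : ℝ) + 1) :=
      bex_congr fun E hE => by
        rw [card_insert_of_notMem fun h => ha (hE h)]; push_cast; rfl
    rw [bex_insert ha, h2, bex_add, ih, bex_const, card_insert_of_notMem ha]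
    push_cast; ring

/-- Elements outside `W` are irrelevant if `f` only looks at `W`. -/
theorem bex_restrict {W : Finset ι} (hW : W ⊆ U) (h : ∀ E ⊆ U, f E = g (E ∩ W)) :
    bex r U f = bex r W g := by
  have e : U = W ∪ (U \ W) := (union_sdiff_of_subset hW).symm
  rw [e, bex_union disjoint_sdiff]
  have : bex r (U \ W) (fun E' => bex r W (fun E => f (E ∪ E'))) = bex r (U \ W) (fun _ => bex r W g) := by
    refine bex_congr fun E' hE' => bex_congr fun E hE => ?_
    rw [h _ (union_subset (hE.trans hW) (hE'.trans sdiff_subset))]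
    congr 1
    ext x
    have h1 := @hE x
    have h2 := @hE' x
    simp only [mem_inter, mem_union, mem_sdiff] at *
    tauto
  rw [this, bex_const]

theorem bex_avoid {W : Finset ι} (hW : W ⊆ U) :
    bex r U (fun E => if Disjoint E W then 1 else 0) = r ^ W.card := by
  rw [bex_restrict (g := fun E => if E = ∅ then 1 else 0) hW]
  · rw [bex, sum_eq_single ∅]
    · simp
    · intro E _ hE; simp [hE]
    · simp
  · intro E _
    simp only [disjoint_iff_inter_eq_empty]

theorem bex_pow_card_sdiff {A W : Finset ι} (t : ℝ) :
    bex r W (fun T => t ^ (A \ T).card) = (1 - r + r * t) ^ (A ∩ W).card * t ^ (A \ W).card := by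
  have h := bex_prod (r := r) (U := W) (fun _ => 1) (fun v => if v ∈ A then t else 1)
  have h2 : ∀ T ⊆ W, t ^ (A \ T).card =
      t ^ (A \ W).card * ∏ v ∈ W, if v ∈ T then (1 : ℝ) else (if v ∈ A then t else 1) := by
    intro T hT
    have e : A \ T = (A \ W) ∪ (W.filter (fun v => v ∉ T ∧ v ∈ A)) := by
      ext x
      have := @hT x
      simp only [mem_sdiff, mem_union, mem_filter]; tauto
    rw [e, card_union_of_disjoint, pow_add]
    · congr 1
      rw [← prod_const, prod_filter]
      refine prod_congr rfl fun v _ => ?_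
      by_cases h1 : v ∈ T <;> by_cases h2 : v ∈ A <;> simp [h1, h2]
    · rw [disjoint_left]; intro x hx hx'
      simp only [mem_sdiff, mem_filter] at *; tauto
  rw [bex_congr h2, bex_mul_left, h, mul_comm]
  congr 1
  rw [← prod_const, inter_comm, ← filter_mem_eq_inter, prod_filter]
  refine prod_congr rfl fun v _ => ?_
  by_cases h2 : v ∈ A <;> simp [h2]

end bex

/-- The vertices reachable from `A` in the graph with edge set `E`. -/
noncomputable def reach {n : ℕ} (E : Finset (Fin n × Fin n)) (A : Finset (Fin n)) : Finset (Fin n) :=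
  univ.filter fun v => ∃ a ∈ A, (graphOf E).Reachable a v

/-- Monochromatic pairs inside `B`. -/
def monoIn {n q : ℕ} (σ : Conf n q) (B : Finset (Fin n)) : Finset (Fin n × Fin n) :=
  univ.filter fun p => p.1 < p.2 ∧ σ p.1 = σ p.2 ∧ p.1 ∈ B ∧ p.2 ∈ B

/-- The pairs joining `a` to the vertices of `T`. -/
def starAt {n : ℕ} (a : Fin n) (T : Finset (Fin n)) : Finset (Fin n × Fin n) :=
  T.image fun v => (min a v, max a v)

section graph
variable {n q : ℕ} {σ : Conf n q} {E E' : Finset (Fin n × Fin n)} {A B T S : Finset (Fin n)}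
  {a u v : Fin n}

theorem graphOf_adj : (graphOf E).Adj u v ↔ u ≠ v ∧ ((u, v) ∈ E ∨ (v, u) ∈ E) := by
  simp [graphOf]

theorem graphOf_mono (h : E ⊆ E') : graphOf E ≤ graphOf E' := by
  intro u v huv
  rw [graphOf_adj] at *
  exact ⟨huv.1, huv.2.imp (fun x => h x) (fun x => h x)⟩

theorem reachable_mem_of_closed {G : SimpleGraph (Fin n)} {S : Set (Fin n)}
    (hS : ∀ x ∈ S, ∀ y, G.Adj x y → y ∈ S) (hu : u ∈ S) (h : G.Reachable u v) : v ∈ S := by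
  obtain ⟨w⟩ := h
  induction w with
  | nil => exact hu
  | cons hadj _ ih => exact ih (hS _ hu _ hadj)

theorem mem_reach : v ∈ reach E A ↔ ∃ a ∈ A, (graphOf E).Reachable a v := by simp [reach]

theorem subset_reach : A ⊆ reach E A := fun v hv => mem_reach.2 ⟨v, hv, .refl _⟩

theorem reach_mono (h : E ⊆ E') (hA : A ⊆ B) : reach E A ⊆ reach E' B := fun v hv => by
  obtain ⟨a, ha, hr⟩ := mem_reach.1 hv
  exact mem_reach.2 ⟨a, hA ha, hr.mono (graphOf_mono h)⟩

theorem reach_adj (h : u ∈ reach E A) (huv : (graphOf E).Adj u v) : v ∈ reach E A := by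
  obtain ⟨a, ha, hr⟩ := mem_reach.1 h
  exact mem_reach.2 ⟨a, ha, hr.trans huv.reachable⟩

theorem reach_subset_of_closed (hA : A ⊆ S) (hS : ∀ x ∈ S, ∀ y, (graphOf E).Adj x y → y ∈ S) :
    reach E A ⊆ S := fun v hv => by
  obtain ⟨a, ha, hr⟩ := mem_reach.1 hv
  exact reachable_mem_of_closed (S := S) hS (hA ha) hr

theorem reach_empty : reach E ∅ = ∅ := by simp [reach]

theorem reach_eq_biUnion : reach E A = A.biUnion fun a => reach E {a} := by
  ext v; simp [reach]

theorem mem_star : (u, v) ∈ starAt a T ↔ ∃ t ∈ T, min a t = u ∧ max a t = v := by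
  simp [starAt]

theorem star_pair (h : (u, v) ∈ starAt a T) : (u = a ∧ v ∈ T) ∨ (v = a ∧ u ∈ T) := by
  obtain ⟨t, ht, h1, h2⟩ := mem_star.1 h
  rcases le_total a t with h | h
  · rw [min_eq_left h] at h1; rw [max_eq_right h] at h2
    subst h1 h2; exact Or.inl ⟨rfl, ht⟩
  · rw [min_eq_right h] at h1; rw [max_eq_left h] at h2
    subst h1 h2; exact Or.inr ⟨rfl, ht⟩

theorem star_adj (h : v ∈ T) (hne : v ≠ a) (hE : starAt a T ⊆ E) : (graphOf E).Adj a v := by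
  rw [graphOf_adj]
  refine ⟨hne.symm, ?_⟩
  rcases le_total a v with hh | hh
  · exact Or.inl (hE (mem_star.2 ⟨v, h, min_eq_left hh, max_eq_right hh⟩))
  · exact Or.inr (hE (mem_star.2 ⟨v, h, min_eq_right hh, max_eq_left hh⟩))

theorem star_injOn (ha : a ∉ B) : Set.InjOn (fun v => (min a v, max a v)) B := by
  intro u hu v hv h
  have hu' : u ≠ a := fun h => ha (h ▸ hu)
  have hv' : v ≠ a := fun h => ha (h ▸ hv)
  simp only [Prod.mk.injEq] at h
  rcases le_total a u with h1 | h1 <;> rcases le_total a v with h2 | h2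
  all_goals simp only [min_eq_left, max_eq_right, min_eq_right, max_eq_left, h1, h2] at h
  · exact h.2
  · exact absurd h.2 hu'
  · exact absurd h.1 hu'
  · exact h.1

theorem mem_monoIn {p : Fin n × Fin n} :
    p ∈ monoIn σ B ↔ p.1 < p.2 ∧ σ p.1 = σ p.2 ∧ p.1 ∈ B ∧ p.2 ∈ B := by simp [monoIn]

theorem monoIn_insert (ha : a ∉ B) :
    monoIn σ (insert a B) = starAt a (B.filter fun v => σ v = σ a) ∪ monoIn σ B := by
  ext ⟨u, v⟩
  simp only [mem_union, mem_monoIn, mem_star, mem_insert, mem_filter]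
  constructor
  · rintro ⟨h1, h2, h3, h4⟩
    rcases h3 with rfl | h3 <;> rcases h4 with rfl | h4
    · exact absurd h1 (lt_irrefl _)
    · exact Or.inl ⟨v, ⟨h4, h2.symm⟩, min_eq_left h1.le, max_eq_right h1.le⟩
    · exact Or.inl ⟨u, ⟨h3, h2⟩, min_eq_right h1.le, max_eq_left h1.le⟩
    · exact Or.inr ⟨h1, h2, h3, h4⟩
  · rintro (⟨t, ⟨ht, hc⟩, h1, h2⟩ | ⟨h1, h2, h3, h4⟩)
    · have hne : t ≠ a := fun h => ha (h ▸ ht)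
      rcases lt_or_gt_of_ne hne with h | h
      · rw [min_eq_right h.le] at h1; rw [max_eq_left h.le] at h2
        subst h1 h2; exact ⟨h, hc, Or.inr ht, Or.inl rfl⟩
      · rw [min_eq_left h.le] at h1; rw [max_eq_right h.le] at h2
        subst h1 h2; exact ⟨h, hc.symm, Or.inl rfl, Or.inr ht⟩
    · exact ⟨h1, h2, Or.inr h3, Or.inr h4⟩

theorem disjoint_star_monoIn (ha : a ∉ B) : Disjoint (starAt a T) (monoIn σ B) := by
  rw [disjoint_left]
  rintro ⟨u, v⟩ h1 h2
  rw [mem_monoIn] at h2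
  rcases star_pair h1 with ⟨rfl, _⟩ | ⟨rfl, _⟩
  · exact ha h2.2.2.1
  · exact ha h2.2.2.2

theorem monoIn_adj_mem (hE : E ⊆ monoIn σ B) (h : (graphOf E).Adj u v) : u ∈ B ∧ v ∈ B := by
  rw [graphOf_adj] at h
  rcases h.2 with h | h
  · have := mem_monoIn.1 (hE h); exact this.2.2
  · have := mem_monoIn.1 (hE h); exact this.2.2.symm

theorem reach_subset_of_monoIn (hE : E ⊆ monoIn σ B) (hA : A ⊆ B) : reach E A ⊆ B :=
  reach_subset_of_closed hA fun _ _ _ h => (monoIn_adj_mem hE h).2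

theorem reach_star_union (hE : E ⊆ monoIn σ B) (ha : a ∉ B) (hT : T ⊆ B) :
    reach (starAt a T ∪ E) (insert a A) = insert a (reach E (A ∪ T)) := by
  have haT : a ∉ T := fun h => ha (hT h)
  apply subset_antisymm
  · apply reach_subset_of_closed
    · exact insert_subset_insert _ (subset_union_left.trans subset_reach)
    · intro x hx y hxy
      rw [graphOf_adj] at hxy
      have key : (x, y) ∈ starAt a T ∨ (y, x) ∈ starAt a T ∨ ((x,y) ∈ E ∨ (y,x) ∈ E) := by
        simp only [mem_union] at hxy; tauto
      have hst : (x = a ∧ y ∈ T) ∨ (y = a ∧ x ∈ T) → y ∈ insert a (reach E (A ∪ T)) := by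
        rintro (⟨rfl, h⟩ | ⟨rfl, h⟩)
        · exact mem_insert_of_mem (subset_reach (mem_union_right _ h))
        · exact mem_insert_self _ _
      rcases key with h | h | h
      · exact hst (star_pair h)
      · exact hst (star_pair h).symm
      · have hadj : (graphOf E).Adj x y := graphOf_adj.2 ⟨hxy.1, h⟩
        have hxB := (monoIn_adj_mem hE hadj).1
        have hxa : x ≠ a := fun h => ha (h ▸ hxB)
        exact mem_insert_of_mem (reach_adj ((mem_insert.1 hx).resolve_left hxa) hadj)
  · apply insert_subset (subset_reach (mem_insert_self _ _))
    apply reach_subset_of_closed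
    · apply union_subset
      · exact (subset_insert _ _).trans subset_reach
      · intro t ht
        exact reach_adj (subset_reach (mem_insert_self a A))
          (star_adj ht (fun h => haT (h ▸ ht)) subset_union_left)
    · intro x hx y hxy
      exact reach_adj hx (graphOf_mono subset_union_right hxy)

/-- Revealing the edges at `a`. -/
theorem bex_reveal {r : ℝ} (f : Finset (Fin n) → ℝ) (ha : a ∉ B) :
    bex r (monoIn σ (insert a B)) (fun E => f (reach E (insert a A))) =
      bex r (B.filter fun v => σ v = σ a) (fun T =>
        bex r (monoIn σ B) fun E => f (insert a (reach E (A ∪ T)))) := by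
  rw [monoIn_insert ha, bex_union (disjoint_star_monoIn ha)]
  have h1 : ∀ E' ⊆ monoIn σ B, bex r (starAt a (B.filter fun v => σ v = σ a))
      (fun E => f (reach (E ∪ E') (insert a A))) =
      bex r (B.filter fun v => σ v = σ a) (fun T => f (insert a (reach E' (A ∪ T)))) := by
    intro E' hE'
    rw [starAt, bex_image _ _ ((star_injOn ha).mono fun x hx => (mem_filter.1 hx).1)]
    refine bex_congr fun T hT => ?_
    rw [← reach_star_union hE' ha (hT.trans (filter_subset _ _)), starAt]
  rw [bex_congr h1]
  simp only [bex, mul_sum]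
  rw [sum_comm]
  exact sum_congr rfl fun _ _ => sum_congr rfl fun _ _ => by ring


theorem bex_connected_le {r : ℝ} (hr : 0 ≤ r) (hr1 : r ≤ 1) (hAB : A ⊆ B)
    (hB : ∀ u ∈ B, ∀ v ∈ B, σ u = σ v) :
    bex r (monoIn σ B) (fun E => if B ⊆ reach E A then 1 else 0) ≤
      (1 - r ^ B.card) ^ (B \ A).card := by
  induction B using Finset.strongInduction generalizing A with
  | H B ih =>
  rcases A.eq_empty_or_nonempty with rfl | ⟨a, ha⟩
  · rcases B.eq_empty_or_nonempty with rfl | hne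
    · exact bex_le_const hr hr1 fun E _ => by simp
    · have : bex r (monoIn σ B) (fun E => if B ⊆ reach E ∅ then 1 else 0) ≤ 0 := by
        refine bex_le_const hr hr1 fun E _ => ?_
        rw [if_neg]
        rw [reach_empty, subset_empty]; exact hne.ne_empty
      exact this.trans (pow_nonneg (sub_nonneg.2 (pow_le_one₀ hr hr1)) _)
  · have haB := hAB ha
    obtain ⟨B₀, haB₀, rfl⟩ : ∃ B₀, a ∉ B₀ ∧ insert a B₀ = B :=
      ⟨B.erase a, notMem_erase _ _, insert_erase haB⟩
    obtain ⟨A₀, haA₀, rfl⟩ : ∃ A₀, a ∉ A₀ ∧ insert a A₀ = A :=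
      ⟨A.erase a, notMem_erase _ _, insert_erase ha⟩
    have hA₀ : A₀ ⊆ B₀ := by
      intro x hx
      exact (mem_insert.1 (hAB (mem_insert_of_mem hx))).resolve_left fun h => haA₀ (h ▸ hx)
    rw [bex_reveal (fun R => if insert a B₀ ⊆ R then 1 else 0) haB₀]
    have hfil : B₀.filter (fun v => σ v = σ a) = B₀ :=
      filter_true_of_mem fun v hv => hB _ (mem_insert_of_mem hv) _ (mem_insert_self _ _)
    rw [hfil]
    have hstep : ∀ T ⊆ B₀, bex r (monoIn σ B₀)
        (fun E => if insert a B₀ ⊆ insert a (reach E (A₀ ∪ T)) then (1 : ℝ) else 0) ≤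
        (1 - r ^ B₀.card) ^ ((B₀ \ A₀) \ T).card := by
      intro T hT
      rw [sdiff_sdiff, sup_eq_union]
      refine le_trans (le_of_eq (bex_congr fun E hE => ?_)) (ih B₀ (ssubset_insert haB₀)
        (union_subset hA₀ hT) fun u hu v hv => hB _ (mem_insert_of_mem hu) _ (mem_insert_of_mem hv))
      congr 1
      simp only [insert_subset_insert_iff haB₀]
    refine (bex_mono hr hr1 hstep).trans (le_of_eq ?_)
    rw [bex_pow_card_sdiff]
    have e1 : (B₀ \ A₀) \ B₀ = ∅ := by ext; simp
    have e2 : (B₀ \ A₀) ∩ B₀ = B₀ \ A₀ := inter_eq_left.2 sdiff_subset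
    have e3 : insert a B₀ \ insert a A₀ = B₀ \ A₀ := by
      ext x; simp only [mem_sdiff, mem_insert]
      constructor
      · tauto
      · rintro ⟨h1, h2⟩
        have : x ≠ a := fun h => haB₀ (h ▸ h1)
        tauto
    rw [e1, e2, e3, card_insert_of_notMem haB₀, card_empty, pow_zero, mul_one]
    congr 1; rw [pow_succ]; ring

theorem bex_reach_small_le {r s : ℝ} {d : ℕ} (hr : 0 ≤ r) (hr1 : r ≤ 1) (hs : 0 ≤ s) (hs1 : s ≤ 1)
    (hd : (r + (1 - r) * s) ^ d ≤ s) (hAB : A ⊆ B) (hB : ∀ u ∈ B, ∀ v ∈ B, σ u = σ v) :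
    bex r (monoIn σ B) (fun E => if (reach E A).card + d ≤ B.card then 1 else 0) ≤ s ^ A.card := by
  induction B using Finset.strongInduction generalizing A with
  | H B ih =>
  rcases A.eq_empty_or_nonempty with rfl | ⟨a, ha⟩
  · rw [card_empty, pow_zero]
    exact bex_le_const hr hr1 fun E _ => by split_ifs <;> norm_num
  · have haB := hAB ha
    obtain ⟨B₀, haB₀, rfl⟩ : ∃ B₀, a ∉ B₀ ∧ insert a B₀ = B :=
      ⟨B.erase a, notMem_erase _ _, insert_erase haB⟩
    obtain ⟨A₀, haA₀, rfl⟩ : ∃ A₀, a ∉ A₀ ∧ insert a A₀ = A :=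
      ⟨A.erase a, notMem_erase _ _, insert_erase ha⟩
    have hA₀ : A₀ ⊆ B₀ := by
      intro x hx
      exact (mem_insert.1 (hAB (mem_insert_of_mem hx))).resolve_left fun h => haA₀ (h ▸ hx)
    by_cases hcard : A₀.card + d ≤ B₀.card
    swap
    · refine le_trans (bex_le_const hr hr1 (c := 0) fun E _ => ?_) (pow_nonneg hs _)
      rw [if_neg]
      have := card_le_card (subset_reach (E := E) (A := insert a A₀))
      rw [card_insert_of_notMem haA₀] at this
      rw [card_insert_of_notMem haB₀]; omega
    rw [bex_reveal (fun R => if R.card + d ≤ (insert a B₀).card then 1 else 0) haB₀]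
    have hfil : B₀.filter (fun v => σ v = σ a) = B₀ :=
      filter_true_of_mem fun v hv => hB _ (mem_insert_of_mem hv) _ (mem_insert_self _ _)
    rw [hfil]
    have hstep : ∀ T ⊆ B₀, bex r (monoIn σ B₀)
        (fun E => if (insert a (reach E (A₀ ∪ T))).card + d ≤ (insert a B₀).card then (1 : ℝ) else 0) ≤
        s ^ A₀.card * ∏ v ∈ B₀, if v ∈ T then (if v ∈ A₀ then 1 else s) else 1 := by
      intro T hT
      refine le_trans (le_of_eq (bex_congr fun E hE => ?_)) ((ih B₀ (ssubset_insert haB₀)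
        (union_subset hA₀ hT) fun u hu v hv =>
          hB _ (mem_insert_of_mem hu) _ (mem_insert_of_mem hv)).trans (le_of_eq ?_))
      · have hsub := reach_subset_of_monoIn hE (union_subset hA₀ hT)
        congr 1
        rw [card_insert_of_notMem haB₀, card_insert_of_notMem fun h => haB₀ (hsub h)]
        simp only [eq_iff_iff]; omega
      · have e : A₀ ∪ T = A₀ ∪ B₀.filter (fun v => v ∈ T ∧ v ∉ A₀) := by
          ext x
          have := @hT x
          simp only [mem_union, mem_filter]; tauto
        rw [e, card_union_of_disjoint, pow_add]
        · congr 1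
          rw [← prod_const, prod_filter]
          refine prod_congr rfl fun v _ => ?_
          by_cases h1 : v ∈ T <;> by_cases h2 : v ∈ A₀ <;> simp [h1, h2]
        · rw [disjoint_left]; intro x hx hx'
          simp only [mem_filter] at hx'; tauto
    refine (bex_mono hr hr1 hstep).trans ?_
    rw [bex_mul_left, bex_prod, card_insert_of_notMem haA₀, pow_succ]
    refine mul_le_mul_of_nonneg_left ?_ (pow_nonneg hs _)
    have e4 : ∏ v ∈ B₀, ((1 - r) * (if v ∈ A₀ then 1 else s) + r * 1) =
        (r + (1 - r) * s) ^ (B₀ \ A₀).card := by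
      rw [← prod_const, sdiff_eq_filter, prod_filter]
      refine prod_congr rfl fun v _ => ?_
      by_cases h2 : v ∈ A₀ <;> simp [h2]
      ring
    rw [e4]
    have hc : (B₀ \ A₀).card = B₀.card - A₀.card := card_sdiff_of_subset hA₀
    refine le_trans (pow_le_pow_of_le_one ?_ ?_ (by omega)) hd
    · have : 0 ≤ 1 - r := by linarith
      positivity
    · nlinarith

/-- Susceptibility bound for subcritical colour classes. -/
theorem bex_card_reach_le {r x : ℝ} (hr : 0 ≤ r) (hr1 : r ≤ 1) (hx : x < 1) (hAB : A ⊆ B)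
    (hB : ∀ a ∈ B, ((B.filter fun v => σ v = σ a).card : ℝ) * (1 - r) ≤ x) :
    bex r (monoIn σ B) (fun E => ((reach E A).card : ℝ)) ≤ A.card / (1 - x) := by
  have hx1 : 0 < 1 - x := by linarith
  induction B using Finset.strongInduction generalizing A with
  | H B ih =>
  rcases A.eq_empty_or_nonempty with rfl | ⟨a, ha⟩
  · simp only [reach_empty, card_empty]
    rw [bex_const]; simp
  · have haB := hAB ha
    obtain ⟨B₀, haB₀, rfl⟩ : ∃ B₀, a ∉ B₀ ∧ insert a B₀ = B :=
      ⟨B.erase a, notMem_erase _ _, insert_erase haB⟩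
    obtain ⟨A₀, haA₀, rfl⟩ : ∃ A₀, a ∉ A₀ ∧ insert a A₀ = A :=
      ⟨A.erase a, notMem_erase _ _, insert_erase ha⟩
    have hA₀ : A₀ ⊆ B₀ := by
      intro x hx
      exact (mem_insert.1 (hAB (mem_insert_of_mem hx))).resolve_left fun h => haA₀ (h ▸ hx)
    have hr1' : 0 ≤ 1 - r := by linarith
    have hmonoc : ∀ b, ((B₀.filter fun v => σ v = σ b).card : ℝ) * (1 - r) ≤
        (((insert a B₀).filter fun v => σ v = σ b).card : ℝ) * (1 - r) := by
      intro b
      gcongr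
      exact subset_insert _ _
    rw [bex_reveal (fun R => (R.card : ℝ)) haB₀]
    have hstep : ∀ T ⊆ B₀.filter (fun v => σ v = σ a), bex r (monoIn σ B₀)
        (fun E => ((insert a (reach E (A₀ ∪ T))).card : ℝ)) ≤
        (1 + A₀.card / (1 - x)) + 1 / (1 - x) * T.card := by
      intro T hT
      have hT' := hT.trans (filter_subset _ _)
      have h1 := ih B₀ (ssubset_insert haB₀) (union_subset hA₀ hT')
        fun b hb => (hmonoc b).trans (hB b (mem_insert_of_mem hb))
      have h2 : ∀ E ⊆ monoIn σ B₀, ((insert a (reach E (A₀ ∪ T))).card : ℝ) ≤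
          1 + (reach E (A₀ ∪ T)).card := by
        intro E _
        have := card_insert_le a (reach E (A₀ ∪ T))
        have h : ((insert a (reach E (A₀ ∪ T))).card : ℝ) ≤ ((reach E (A₀ ∪ T)).card + 1 : ℕ) := by
          exact_mod_cast this
        push_cast at h; linarith
      refine (bex_mono hr hr1 h2).trans ?_
      rw [bex_add, bex_const]
      have h3 : ((A₀ ∪ T).card : ℝ) ≤ A₀.card + T.card := by exact_mod_cast card_union_le _ _
      have h4 : ((A₀ ∪ T).card : ℝ) / (1 - x) ≤ (A₀.card + T.card) / (1 - x) := by gcongr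
      have h5 : ((A₀.card : ℝ) + T.card) / (1 - x) = A₀.card / (1 - x) + 1 / (1 - x) * T.card := by ring
      linarith
    refine (bex_mono hr hr1 hstep).trans ?_
    rw [bex_add, bex_const, bex_mul_left, bex_card, card_insert_of_notMem haA₀]
    have h6 : (1 - r) * ((B₀.filter fun v => σ v = σ a).card : ℝ) ≤ x := by
      rw [mul_comm]; exact (hmonoc a).trans (hB a (mem_insert_self _ _))
    have h7 : 1 / (1 - x) * ((1 - r) * ((B₀.filter fun v => σ v = σ a).card : ℝ)) ≤ 1 / (1 - x) * x := by
      gcongr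
    refine (add_le_add_right h7 _).trans (le_of_eq ?_)
    push_cast
    field_simp
    ring

end graph

/-- `S` is (the vertex set of) a connected component of the graph with edge set `E`. -/
def IsCompOf {n : ℕ} (E : Finset (Fin n × Fin n)) (S : Finset (Fin n)) : Prop :=
  S.Nonempty ∧ ∀ v ∈ S, reach E {v} = S

/-- Monochromatic pairs with exactly one endpoint in `S`. -/
def crossPairs {n q : ℕ} (σ : Conf n q) (S : Finset (Fin n)) : Finset (Fin n × Fin n) :=
  (monoPairs σ).filter fun p => ¬ (p.1 ∈ S ↔ p.2 ∈ S)

section comp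
variable {n q : ℕ} {σ : Conf n q} {E : Finset (Fin n × Fin n)} {S D : Finset (Fin n)}
  {u v : Fin n}

theorem mem_monoPairs {p : Fin n × Fin n} : p ∈ monoPairs σ ↔ p.1 < p.2 ∧ σ p.1 = σ p.2 := by
  simp [monoPairs]

theorem monoIn_subset : monoIn σ S ⊆ monoPairs σ := fun _ hp =>
  mem_monoPairs.2 ⟨(mem_monoIn.1 hp).1, (mem_monoIn.1 hp).2.1⟩

theorem monoPairs_split :
    monoPairs σ = monoIn σ S ∪ (crossPairs σ S ∪ monoIn σ Sᶜ) := by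
  ext p
  simp only [mem_union, mem_monoIn, mem_monoPairs, crossPairs, mem_filter, mem_compl]
  tauto

theorem disjoint_monoIn_cross : Disjoint (monoIn σ S) (crossPairs σ S ∪ monoIn σ Sᶜ) := by
  rw [disjoint_left]; intro p h1 h2
  simp only [mem_union, mem_monoIn, crossPairs, mem_filter, mem_compl] at h1 h2
  tauto

theorem disjoint_cross_monoIn_compl : Disjoint (crossPairs σ S) (monoIn σ Sᶜ) := by
  rw [disjoint_left]; intro p h1 h2
  simp only [mem_monoIn, crossPairs, mem_filter, mem_compl] at h1 h2
  tauto

theorem IsCompOf.mem_of_adj (h : IsCompOf E S) (hu : u ∈ S) (hadj : (graphOf E).Adj u v) : v ∈ S := by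
  rw [← h.2 u hu]; exact reach_adj (subset_reach (mem_singleton_self u)) hadj

theorem IsCompOf.disjoint_cross (h : IsCompOf E S) : Disjoint E (crossPairs σ S) := by
  rw [disjoint_left]; rintro ⟨u, v⟩ h1 h2
  simp only [crossPairs, mem_filter, mem_monoPairs] at h2
  have hadj : (graphOf E).Adj u v := graphOf_adj.2 ⟨h2.1.1.ne, Or.inl h1⟩
  exact h2.2 ⟨fun hu => h.mem_of_adj hu hadj, fun hv => h.mem_of_adj hv hadj.symm⟩

theorem adj_inter {W : Finset (Fin n × Fin n)} (hadj : (graphOf E).Adj u v)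
    (h : ∀ p ∈ E, (p = (u, v) ∨ p = (v, u)) → p ∈ W) : (graphOf (E ∩ W)).Adj u v := by
  rw [graphOf_adj] at *
  exact ⟨hadj.1, hadj.2.imp (fun x => mem_inter.2 ⟨x, h _ x (Or.inl rfl)⟩)
    (fun x => mem_inter.2 ⟨x, h _ x (Or.inr rfl)⟩)⟩

theorem IsCompOf.subset_reach_inter (h : IsCompOf E S) (hE : E ⊆ monoPairs σ) (hv : v ∈ S) :
    S ⊆ reach (E ∩ monoIn σ S) {v} := by
  conv_lhs => rw [← h.2 v hv]
  apply reach_subset_of_closed subset_reach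
  intro x hx y hxy
  have hxS : x ∈ S := reach_subset_of_monoIn inter_subset_right (singleton_subset_iff.2 hv) hx
  have hyS := h.mem_of_adj hxS hxy
  refine reach_adj hx (adj_inter hxy fun p hp hpe => ?_)
  have := mem_monoPairs.1 (hE hp)
  rw [mem_monoIn]
  rcases hpe with rfl | rfl
  · exact ⟨this.1, this.2, hxS, hyS⟩
  · exact ⟨this.1, this.2, hyS, hxS⟩

theorem IsCompOf.reach_inter (h : IsCompOf E S) (hE : E ⊆ monoPairs σ) (hv : v ∉ S) :
    reach (E ∩ monoIn σ Sᶜ) {v} = reach E {v} := by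
  apply subset_antisymm (reach_mono inter_subset_left subset_rfl)
  apply reach_subset_of_closed subset_reach
  intro x hx y hxy
  have hxS : x ∈ Sᶜ := reach_subset_of_monoIn inter_subset_right
    (singleton_subset_iff.2 (mem_compl.2 hv)) hx
  have hyS : y ∈ Sᶜ := mem_compl.2 fun hy => (mem_compl.1 hxS) (h.mem_of_adj hy hxy.symm)
  refine reach_adj hx (adj_inter hxy fun p hp hpe => ?_)
  have := mem_monoPairs.1 (hE hp)
  rw [mem_monoIn]
  rcases hpe with rfl | rfl
  · exact ⟨this.1, this.2, hxS, hyS⟩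
  · exact ⟨this.1, this.2, hyS, hxS⟩

theorem le_card_crossPairs {s : Fin q} (hS : ∀ v ∈ S, σ v = s) :
    S.card * (cntN σ s - S.card) ≤ (crossPairs σ S).card := by
  set D := univ.filter fun v => σ v = s with hD
  have hSD : S ⊆ D := fun v hv => mem_filter.2 ⟨mem_univ _, hS v hv⟩
  have hc : S.card * (cntN σ s - S.card) = (S ×ˢ (D \ S)).card := by
    rw [card_product, card_sdiff_of_subset hSD]; rfl
  rw [hc]
  apply card_le_card_of_injOn (fun p => (min p.1 p.2, max p.1 p.2))
  · rintro ⟨u, v⟩ huv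
    simp only [coe_product, Set.mem_prod, mem_coe, mem_sdiff] at huv
    have hne : u ≠ v := fun e => huv.2.2 (e ▸ huv.1)
    have h1 := hS u huv.1
    have h2 : σ v = s := (mem_filter.1 huv.2.1).2
    simp only [crossPairs, coe_filter, mem_monoPairs, Set.mem_ofPred_eq]
    rcases lt_or_gt_of_ne hne with h | h
    · rw [min_eq_left h.le, max_eq_right h.le]
      exact ⟨⟨h, h1.trans h2.symm⟩, by tauto⟩
    · rw [min_eq_right h.le, max_eq_left h.le]
      exact ⟨⟨h, h2.trans h1.symm⟩, by tauto⟩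
  · rintro ⟨u, v⟩ huv ⟨u', v'⟩ huv' e
    simp only [coe_product, Set.mem_prod, mem_coe, mem_sdiff] at huv huv'
    simp only [Prod.mk.injEq] at e ⊢
    have key : (u = u' ∧ v = v') ∨ (u = v' ∧ v = u') := by
      rcases le_total u v with h | h <;> rcases le_total u' v' with h' | h' <;>
        simp only [min_eq_left, max_eq_right, min_eq_right, max_eq_left, h, h'] at e <;> tauto
    rcases key with h | h
    · exact h
    · exact absurd (h.1 ▸ huv.1) huv'.2.2

theorem bex_isCompOf_le {r : ℝ} (hr : 0 ≤ r) (hr1 : r ≤ 1) {s : Fin q} (hSne : S.Nonempty)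
    (hS : ∀ v ∈ S, σ v = s) (g g' : Finset (Fin n × Fin n) → ℝ) (hg' : ∀ E, 0 ≤ g' E)
    (hgg : ∀ E ⊆ monoPairs σ, IsCompOf E S → g E ≤ g' (E ∩ monoIn σ Sᶜ)) :
    bex r (monoPairs σ) (fun E => if IsCompOf E S then g E else 0) ≤
      r ^ (S.card * (cntN σ s - S.card)) * (1 - r ^ S.card) ^ (S.card - 1) *
        bex r (monoIn σ Sᶜ) g' := by
  obtain ⟨v, hv⟩ := hSne
  have h1 : ∀ E ⊆ monoPairs σ, (if IsCompOf E S then g E else 0) ≤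
      (if S ⊆ reach (E ∩ monoIn σ S) {v} then 1 else 0) *
        ((if Disjoint E (crossPairs σ S) then 1 else 0) * g' (E ∩ monoIn σ Sᶜ)) := by
    intro E hE
    split_ifs with h2 h3 h4 h4 h3 h4 h4
    · rw [one_mul, one_mul]; exact hgg E hE h2
    · exact absurd h2.disjoint_cross h4
    · exact absurd (h2.subset_reach_inter hE hv) h3
    · exact absurd (h2.subset_reach_inter hE hv) h3
    · simpa using hg' _
    all_goals simp
  refine (bex_mono hr hr1 h1).trans ?_
  rw [monoPairs_split (σ := σ) (S := S), bex_union disjoint_monoIn_cross]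
  have h2 : ∀ E' ⊆ crossPairs σ S ∪ monoIn σ Sᶜ, bex r (monoIn σ S) (fun E =>
      (if S ⊆ reach ((E ∪ E') ∩ monoIn σ S) {v} then (1:ℝ) else 0) *
        ((if Disjoint (E ∪ E') (crossPairs σ S) then 1 else 0) * g' ((E ∪ E') ∩ monoIn σ Sᶜ))) =
      ((if Disjoint E' (crossPairs σ S) then 1 else 0) * g' (E' ∩ monoIn σ Sᶜ)) *
        bex r (monoIn σ S) (fun E => if S ⊆ reach E {v} then (1:ℝ) else 0) := by
    intro E' hE'
    rw [← bex_mul_left]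
    refine bex_congr fun E hE => ?_
    have hd := disjoint_monoIn_cross (σ := σ) (S := S)
    have e1 : (E ∪ E') ∩ monoIn σ S = E := by
      rw [union_inter_distrib_right, inter_eq_left.2 hE,
        disjoint_iff_inter_eq_empty.1 (hd.symm.mono_left hE'), union_empty]
    have e2 : (E ∪ E') ∩ monoIn σ Sᶜ = E' ∩ monoIn σ Sᶜ := by
      rw [union_inter_distrib_right,
        disjoint_iff_inter_eq_empty.1 ((hd.mono_left hE).mono_right subset_union_right), empty_union]
    have e3 : Disjoint (E ∪ E') (crossPairs σ S) ↔ Disjoint E' (crossPairs σ S) := by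
      rw [disjoint_union_left]
      exact ⟨fun h => h.2, fun h => ⟨(hd.mono_left hE).mono_right subset_union_left, h⟩⟩
    rw [e1, e2]
    simp only [e3]
    ring
  rw [bex_congr h2]
  simp only [mul_comm _ (bex r (monoIn σ S) _)]
  rw [bex_mul_left]
  have hconst : ∀ u ∈ S, ∀ w ∈ S, σ u = σ w := fun u hu w hw => (hS u hu).trans (hS w hw).symm
  have h3 := bex_connected_le hr hr1 (singleton_subset_iff.2 hv) hconst
  rw [card_sdiff_of_subset (singleton_subset_iff.2 hv), card_singleton] at h3
  have h4 : bex r (crossPairs σ S ∪ monoIn σ Sᶜ) (fun E =>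
      (if Disjoint E (crossPairs σ S) then (1:ℝ) else 0) * g' (E ∩ monoIn σ Sᶜ)) =
      r ^ (crossPairs σ S).card * bex r (monoIn σ Sᶜ) g' := by
    rw [bex_union disjoint_cross_monoIn_compl]
    have : ∀ E' ⊆ monoIn σ Sᶜ, bex r (crossPairs σ S) (fun E =>
        (if Disjoint (E ∪ E') (crossPairs σ S) then (1:ℝ) else 0) * g' ((E ∪ E') ∩ monoIn σ Sᶜ)) =
        r ^ (crossPairs σ S).card * g' E' := by
      intro E' hE'
      have hd := disjoint_cross_monoIn_compl (σ := σ) (S := S)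
      rw [← bex_avoid (subset_refl (crossPairs σ S)), mul_comm, ← bex_mul_left]
      refine bex_congr fun E hE => ?_
      have e1 : (E ∪ E') ∩ monoIn σ Sᶜ = E' := by
        rw [union_inter_distrib_right, disjoint_iff_inter_eq_empty.1 (hd.mono_left hE), empty_union,
          inter_eq_left.2 hE']
      have e3 : Disjoint (E ∪ E') (crossPairs σ S) ↔ Disjoint E (crossPairs σ S) := by
        rw [disjoint_union_left]
        exact ⟨fun h => h.1, fun h => ⟨h, (hd.mono_right hE').symm⟩⟩
      rw [e1]; simp only [e3]; ring
    rw [bex_congr this, bex_mul_left]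
  rw [h4]
  have h5 : r ^ (crossPairs σ S).card ≤ r ^ (S.card * (cntN σ s - S.card)) :=
    pow_le_pow_of_le_one hr hr1 (le_card_crossPairs hS)
  have h6 : 0 ≤ bex r (monoIn σ Sᶜ) g' := bex_nonneg hr hr1 fun E _ => hg' E
  have h7 : 0 ≤ 1 - r ^ S.card := sub_nonneg.2 (pow_le_one₀ hr hr1)
  calc _ ≤ (1 - r ^ S.card) ^ (S.card - 1) *
        (r ^ (S.card * (cntN σ s - S.card)) * bex r (monoIn σ Sᶜ) g') := by gcongr
    _ = _ := by ring

end comp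

theorem hypergeom_bound {ι : Type*} [DecidableEq ι] (D A : Finset ι) (k : ℕ) :
    ∑ S ∈ powersetCard k D, (((S ∩ A).card : ℝ) - k * ((D ∩ A).card / D.card)) ^ 2 ≤
      (D.card.choose k : ℝ) * D.card := by
  set α : ℝ := (D ∩ A).card / D.card with hα
  set x : ι → ℝ := fun u => (if u ∈ A then 1 else 0) - α with hx
  have hα0 : 0 ≤ α := by positivity
  have hα1 : α ≤ 1 := by
    apply div_le_one_of_le₀ _ (by positivity)
    exact_mod_cast card_le_card inter_subset_left
  have hx1 : ∀ u, x u ^ 2 ≤ 1 := by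
    intro u
    simp only [hx]
    split_ifs <;> nlinarith
  have hsum : ∑ u ∈ D, x u = 0 := by
    simp only [hx, sum_sub_distrib, sum_boole, sum_const, nsmul_eq_mul, filter_mem_eq_inter]
    rcases D.eq_empty_or_nonempty with rfl | hD
    · simp
    · have : (D.card : ℝ) ≠ 0 := by exact_mod_cast hD.card_pos.ne'
      rw [hα]; field_simp; ring
  set M2 : ℝ := if 2 ≤ k then ((D.card - 2).choose (k - 2) : ℝ) else 0 with hM2
  have hM20 : 0 ≤ M2 := by rw [hM2]; split_ifs <;> positivity
  have hcount : ∀ u ∈ D, ∀ v ∈ D, u ≠ v →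
      (((powersetCard k D).filter fun S => u ∈ S ∧ v ∈ S).card : ℝ) = M2 := by
    intro u hu v hv huv
    have e : (powersetCard k D).filter (fun S => u ∈ S ∧ v ∈ S) =
        (powersetCard k D).filter (fun S => {u, v} ⊆ S) := by
      refine filter_congr fun S _ => ?_
      simp [insert_subset_iff]
    have hc : ({u, v} : Finset ι).card = 2 := card_pair huv
    rw [e, hM2]
    split_ifs with hk
    · rw [card_filter_powersetCard_subset _ _ _ (by simp [insert_subset_iff, hu, hv]) (by omega), hc]
    · rw [Nat.cast_eq_zero, card_eq_zero, filter_eq_empty_iff]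
      intro S hS hsub
      have := card_le_card hsub
      rw [hc, (mem_powersetCard.1 hS).2] at this
      omega
  have hM1 : ∀ u, (((powersetCard k D).filter fun S => u ∈ S ∧ u ∈ S).card : ℝ) ≤ D.card.choose k := by
    intro u
    have := card_filter_le (powersetCard k D) (fun S => u ∈ S ∧ u ∈ S)
    rw [card_powersetCard] at this
    exact_mod_cast this
  have h1 : ∀ S ∈ powersetCard k D, (((S ∩ A).card : ℝ) - k * α) ^ 2 =
      ∑ u ∈ D, ∑ v ∈ D, (if u ∈ S ∧ v ∈ S then x u * x v else 0) := by
    intro S hS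
    obtain ⟨hSD, hSk⟩ := mem_powersetCard.1 hS
    have e1 : ((S ∩ A).card : ℝ) - k * α = ∑ u ∈ D, if u ∈ S then x u else 0 := by
      rw [← sum_filter, filter_mem_eq_inter, inter_eq_right.2 hSD]
      simp only [hx, sum_sub_distrib, sum_boole, sum_const, nsmul_eq_mul, filter_mem_eq_inter, hSk]
    rw [e1, sq, sum_mul_sum]
    refine sum_congr rfl fun u _ => sum_congr rfl fun v _ => ?_
    by_cases hu : u ∈ S <;> by_cases hv : v ∈ S <;> simp [hu, hv]
  rw [sum_congr rfl h1, sum_comm]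
  have h2 : ∀ u ∈ D, ∑ S ∈ powersetCard k D, ∑ v ∈ D, (if u ∈ S ∧ v ∈ S then x u * x v else 0) ≤
      D.card.choose k + M2 * x u * ∑ v ∈ D, x v := by
    intro u hu
    rw [sum_comm]
    have h3 : ∀ v ∈ D, ∑ S ∈ powersetCard k D, (if u ∈ S ∧ v ∈ S then x u * x v else 0) ≤
        M2 * x u * x v + (if v = u then (D.card.choose k : ℝ) else 0) := by
      intro v hv
      rw [← sum_filter, sum_const, nsmul_eq_mul]
      split_ifs with huv
      · subst huv
        have := hM1 v
        have h5 := hx1 v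
        have h6 : 0 ≤ x v ^ 2 := sq_nonneg _
        have : (((powersetCard k D).filter fun S => v ∈ S ∧ v ∈ S).card : ℝ) * (x v * x v) ≤
            D.card.choose k * 1 := by
          rw [← sq]; gcongr
        have h7 : 0 ≤ M2 * x v * x v := by rw [mul_assoc, ← sq]; positivity
        linarith
      · rw [hcount u hu v hv (Ne.symm huv), add_zero, mul_assoc]
    refine (sum_le_sum h3).trans (le_of_eq ?_)
    rw [sum_add_distrib, ← mul_sum, sum_ite_eq' D u, if_pos hu, add_comm]
  refine (sum_le_sum h2).trans (le_of_eq ?_)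
  rw [hsum]
  simp; ring

/-- Vertex sets of colour `s` with at least `κ n` vertices. -/
noncomputable def wsets {n q : ℕ} (κ : ℝ) (σ : Conf n q) (s : Fin q) : Finset (Finset (Fin n)) :=
  (univ.filter fun v => σ v = s).powerset.filter fun S => κ * n ≤ S.card

/-- Squared fluctuations attached to a large component `S`. -/
noncomputable def errPsi {n q : ℕ} (β : ℝ) (P : Fin q → Finset (Fin n)) (σ : Conf n q) (s : Fin q)
    (E : Finset (Fin n × Fin n)) (S : Finset (Fin n)) : ℝ :=
  ((S.card : ℝ) - cntN σ s * (1 - Real.exp (-(β / n)) ^ S.card)) ^ 2 +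
    ∑ i, (((S ∩ P i).card : ℝ) - S.card * (projCnt P σ i s / cntN σ s)) ^ 2 +
    ∑ u ∈ Sᶜ, ((reach E {u}).card : ℝ)

theorem errPsi_nonneg {n q : ℕ} {β : ℝ} {P : Fin q → Finset (Fin n)} {σ : Conf n q} {s : Fin q}
    {E : Finset (Fin n × Fin n)} {S : Finset (Fin n)} : 0 ≤ errPsi β P σ s E S :=
  add_nonneg (add_nonneg (sq_nonneg _) (sum_nonneg fun _ _ => sq_nonneg _))
    (sum_nonneg fun _ _ => Nat.cast_nonneg _)

theorem exp_neg_div_bounds {β : ℝ} (hβ : 0 < β) (n : ℕ) :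
    0 ≤ Real.exp (-(β / n)) ∧ Real.exp (-(β / n)) ≤ 1 ∧ 1 - Real.exp (-(β / n)) ≤ β / n := by
  refine ⟨(Real.exp_pos _).le, ?_, ?_⟩
  · rw [Real.exp_le_one_iff]
    have : 0 ≤ β / n := by positivity
    linarith
  · have := Real.add_one_le_exp (-(β / n)); linarith

theorem cntN_le {n q : ℕ} (σ : Conf n q) (s : Fin q) : cntN σ s ≤ n := by
  have := card_filter_le (univ : Finset (Fin n)) (fun v => σ v = s)
  rwa [card_univ, Fintype.card_fin] at this

set_option maxHeartbeats 1600000 in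
theorem bex_window_le {q : ℕ} {β a y r₀ κ x₀ D ρ c : ℝ} (h : StepConsts q β a y r₀ κ x₀ D ρ c)
    (hβ : 0 < β) :
    ∃ C : ℝ, 0 < C ∧ ∀ n : ℕ, 1 ≤ n → ∀ (P : Fin q → Finset (Fin n)) (σ : Conf n q) (s : Fin q),
      |(cntN σ s : ℝ) - a * n| ≤ r₀ * n →
      (∀ j, j ≠ s → |(cntN σ j : ℝ) - (1 - y * a) / q * n| ≤ r₀ * n) →
      bex (Real.exp (-(β / n))) (monoPairs σ) (fun E => ∑ S ∈ wsets κ σ s,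
        if IsCompOf E S then 1 + errPsi β P σ s E S / n else 0) ≤ C := by
  obtain ⟨C, hC, hwin⟩ := compWeight_window hβ h.hκ h.hr h.hra h.hD h.hD1 h.slope
  have hx1 : 0 < 1 - x₀ := by linarith [h.hx₀]
  set K : ℝ := 1 + 1 / (1 - x₀) + q with hK
  have hK1 : 1 ≤ K := by
    have : 0 < 1 / (1 - x₀) := by positivity
    have : (0 : ℝ) ≤ q := by positivity
    linarith
  refine ⟨K * C, by positivity, ?_⟩
  intro n hn P σ s hs hj
  have hn0 : (0 : ℝ) < n := by exact_mod_cast hn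
  obtain ⟨hr0, hr1, hrβ⟩ := exp_neg_div_bounds hβ n
  set r := Real.exp (-(β / n)) with hr
  set N := cntN σ s with hN
  have hNn : N ≤ n := cntN_le σ s
  have hNn' : (N : ℝ) ≤ n := by exact_mod_cast hNn
  obtain ⟨hs1, hs2⟩ := abs_le.1 hs
  set Dd := univ.filter fun v => σ v = s with hDd
  have hDc : Dd.card = N := rfl
  -- the bound for a single set
  have hone : ∀ S ∈ wsets κ σ s, bex r (monoPairs σ) (fun E =>
      if IsCompOf E S then 1 + errPsi β P σ s E S / n else 0) ≤
      r ^ (S.card * (N - S.card)) * (1 - r ^ S.card) ^ (S.card - 1) *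
        (1 + 1 / (1 - x₀) + ((S.card : ℝ) - N * (1 - r ^ S.card)) ^ 2 / n +
          (∑ i, (((S ∩ P i).card : ℝ) - S.card * (projCnt P σ i s / N)) ^ 2) / n) := by
    intro S hS
    rw [wsets, mem_filter, mem_powerset] at hS
    obtain ⟨hSD, hSκ⟩ := hS
    have hScard : (0 : ℝ) < S.card := lt_of_lt_of_le (mul_pos h.hκ hn0) hSκ
    have hSne : S.Nonempty := card_pos.1 (by exact_mod_cast hScard)
    have hSs : ∀ v ∈ S, σ v = s := fun v hv => (mem_filter.1 (hSD hv)).2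
    refine (bex_isCompOf_le hr0 hr1 hSne hSs _ (fun E => 1 + errPsi β P σ s E S / n) ?_ ?_).trans ?_
    · intro E
      have := div_nonneg (errPsi_nonneg (β := β) (P := P) (σ := σ) (s := s) (E := E) (S := S)) hn0.le
      linarith
    · intro E hE hcomp
      apply le_of_eq
      simp only [errPsi]
      congr 3
      refine sum_congr rfl fun u hu => ?_
      rw [hcomp.reach_inter hE (mem_compl.1 hu)]
    · have hpos : 0 ≤ 1 - r ^ S.card := sub_nonneg.2 (pow_le_one₀ hr0 hr1)
      refine mul_le_mul_of_nonneg_left ?_ (mul_nonneg (pow_nonneg hr0 _) (pow_nonneg hpos _))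
      have hsplit : ∀ E, 1 + errPsi β P σ s E S / n =
          (1 + ((S.card : ℝ) - N * (1 - r ^ S.card)) ^ 2 / n +
          (∑ i, (((S ∩ P i).card : ℝ) - S.card * (projCnt P σ i s / N)) ^ 2) / n) +
          1 / n * ∑ u ∈ Sᶜ, ((reach E {u}).card : ℝ) := by
        intro E; rw [errPsi]; ring
      simp only [hsplit]
      rw [bex_add, bex_const, bex_mul_left, bex_sum]
      have hsus : ∀ u ∈ Sᶜ, bex r (monoIn σ Sᶜ) (fun E => ((reach E {u}).card : ℝ)) ≤ 1 / (1 - x₀) := by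
        intro u hu
        have := bex_card_reach_le (σ := σ) hr0 hr1 h.hx₀ (singleton_subset_iff.2 hu) ?_
        · simpa using this
        · intro b hb
          have key : (((Sᶜ).filter fun v => σ v = σ b).card : ℝ) * β ≤ x₀ * n := by
            by_cases hbs : σ b = s
            · have e : (Sᶜ).filter (fun v => σ v = σ b) = Dd \ S := by
                ext v; simp only [mem_filter, mem_compl, mem_sdiff, hDd, mem_univ, true_and, hbs]
                tauto
              rw [e, card_sdiff_of_subset hSD, Nat.cast_sub (card_le_card hSD), hDc]
              have : (N : ℝ) - S.card ≤ (a + r₀ - κ) * n := by linarith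
              calc _ ≤ ((a + r₀ - κ) * n) * β := by gcongr
                _ = (β * (a + r₀ - κ)) * n := by ring
                _ ≤ x₀ * n := by gcongr; exact h.sub
            · have h1 : (((Sᶜ).filter fun v => σ v = σ b).card : ℝ) ≤ cntN σ (σ b) := by
                exact_mod_cast card_le_card (filter_subset_filter _ (subset_univ _))
              have h2 := (abs_le.1 (hj _ hbs)).2
              calc _ ≤ (((1 - y * a) / q + r₀) * n) * β := by gcongr; linarith
                _ = (β * ((1 - y * a) / q + r₀)) * n := by ring
                _ ≤ x₀ * n := by gcongr; exact h.sub'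
          calc _ ≤ (((Sᶜ).filter fun v => σ v = σ b).card : ℝ) * (β / n) := by gcongr
            _ = ((((Sᶜ).filter fun v => σ v = σ b).card : ℝ) * β) / n := by ring
            _ ≤ x₀ := by rw [div_le_iff₀ hn0]; exact key
      have h3 : 1 / n * ∑ u ∈ Sᶜ, bex r (monoIn σ Sᶜ) (fun E => ((reach E {u}).card : ℝ)) ≤
          1 / (1 - x₀) := by
        calc _ ≤ 1 / (n : ℝ) * ∑ u ∈ Sᶜ, 1 / (1 - x₀) := by
              gcongr with u hu; exact hsus u hu
          _ = ((Sᶜ).card / n) * (1 / (1 - x₀)) := by rw [sum_const, nsmul_eq_mul]; ring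
          _ ≤ 1 * (1 / (1 - x₀)) := by
              gcongr
              rw [div_le_one hn0]
              have := card_le_univ (Sᶜ)
              rw [Fintype.card_fin] at this
              exact_mod_cast this
          _ = _ := one_mul _
      linarith
  rw [bex_sum]
  refine (sum_le_sum hone).trans ?_
  rw [wsets, sum_filter, sum_powerset]
  have hlevel : ∀ k ∈ range (Dd.card + 1), ∑ S ∈ powersetCard k Dd, (if κ * n ≤ S.card then
      r ^ (S.card * (N - S.card)) * (1 - r ^ S.card) ^ (S.card - 1) *
        (1 + 1 / (1 - x₀) + ((S.card : ℝ) - N * (1 - r ^ S.card)) ^ 2 / n +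
          (∑ i, (((S ∩ P i).card : ℝ) - S.card * (projCnt P σ i s / N)) ^ 2) / n) else 0) ≤
      if κ * n ≤ k then K * (compWeight r N k * (1 + ((k : ℝ) - N * (1 - r ^ k)) ^ 2 / n)) else 0 := by
    intro k _
    have e : ∀ S ∈ powersetCard k Dd, (if κ * n ≤ S.card then
        r ^ (S.card * (N - S.card)) * (1 - r ^ S.card) ^ (S.card - 1) *
        (1 + 1 / (1 - x₀) + ((S.card : ℝ) - N * (1 - r ^ S.card)) ^ 2 / n +
          (∑ i, (((S ∩ P i).card : ℝ) - S.card * (projCnt P σ i s / N)) ^ 2) / n) else 0) =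
        if κ * n ≤ k then r ^ (k * (N - k)) * (1 - r ^ k) ^ (k - 1) *
        ((1 + 1 / (1 - x₀) + ((k : ℝ) - N * (1 - r ^ k)) ^ 2 / n) +
          (∑ i, (((S ∩ P i).card : ℝ) - k * ((Dd ∩ P i).card / Dd.card)) ^ 2) / n) else 0 := by
      intro S hS
      have hp : ∀ i, ((Dd ∩ P i).card : ℝ) = projCnt P σ i s := by
        intro i
        congr 1
        rw [projCnt]; congr 1; ext v; simp [hDd]; tauto
      simp only [hp, hDc, (mem_powersetCard.1 hS).2]
    rw [sum_congr rfl e]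
    split_ifs with hk
    swap
    · simp
    rw [← mul_sum, sum_add_distrib, sum_const, nsmul_eq_mul, card_powersetCard, ← sum_div, sum_comm]
    have hpos : 0 ≤ 1 - r ^ k := sub_nonneg.2 (pow_le_one₀ hr0 hr1)
    have h4 : (∑ i, ∑ S ∈ powersetCard k Dd,
        (((S ∩ P i).card : ℝ) - k * ((Dd ∩ P i).card / Dd.card)) ^ 2) / n ≤ Dd.card.choose k * q := by
      rw [div_le_iff₀ hn0]
      calc _ ≤ ∑ i : Fin q, (Dd.card.choose k : ℝ) * Dd.card := sum_le_sum fun i _ => hypergeom_bound _ _ _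
        _ = (Dd.card.choose k * q) * N := by
            rw [sum_const, nsmul_eq_mul, card_univ, Fintype.card_fin, hDc]; ring
        _ ≤ _ := by gcongr
    calc _ ≤ r ^ (k * (N - k)) * (1 - r ^ k) ^ (k - 1) *
          ((Dd.card.choose k) * (1 + 1 / (1 - x₀) + ((k : ℝ) - N * (1 - r ^ k)) ^ 2 / n) +
            Dd.card.choose k * q) := by gcongr
      _ = compWeight r N k * (K + ((k : ℝ) - N * (1 - r ^ k)) ^ 2 / n) := by
          rw [compWeight, hDc, hK]; ring
      _ ≤ compWeight r N k * (K * (1 + ((k : ℝ) - N * (1 - r ^ k)) ^ 2 / n)) := by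
          have := compWeight_nonneg (N := N) (k := k) hr0 hr1
          gcongr
          have : 0 ≤ ((k : ℝ) - N * (1 - r ^ k)) ^ 2 / n := by positivity
          nlinarith
      _ = _ := by ring
  refine (sum_le_sum hlevel).trans ?_
  rw [← sum_filter, ← mul_sum, hDc]
  gcongr
  exact hwin n N hn (by linarith) (by linarith) hNn

theorem pow_mul_exp_neg_le {c x : ℝ} (hc : 0 < c) (hx : 0 ≤ x) (k : ℕ) :
    x ^ k * Real.exp (-(c * x)) ≤ k.factorial / c ^ k := by
  have h := Real.pow_div_factorial_le_exp (c * x) (by positivity) k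
  have hf : (0 : ℝ) < k.factorial := by exact_mod_cast k.factorial_pos
  rw [Real.exp_neg, ← div_eq_mul_inv, div_le_div_iff₀ (Real.exp_pos _) (by positivity)]
  rw [div_le_iff₀ hf, mul_pow] at h
  linarith

theorem reach_inter_class {n q : ℕ} {σ : Conf n q} {E : Finset (Fin n × Fin n)} {A : Finset (Fin n)}
    {s : Fin q} (hE : E ⊆ monoPairs σ) (hA : ∀ v ∈ A, σ v = s) :
    reach (E ∩ monoIn σ (univ.filter fun v => σ v = s)) A = reach E A := by
  apply subset_antisymm (reach_mono inter_subset_left subset_rfl)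
  apply reach_subset_of_closed subset_reach
  intro x hx y hxy
  have hxS : σ x = s := by
    have := reach_subset_of_monoIn (A := A) (B := univ.filter fun v => σ v = s) (inter_subset_right)
      (fun v hv => mem_filter.2 ⟨mem_univ _, hA v hv⟩) hx
    exact (mem_filter.1 this).2
  have hyS : σ y = s := by
    rw [← hxS]
    rcases (graphOf_adj.1 hxy).2 with h | h
    · exact (mem_monoPairs.1 (hE h)).2.symm
    · exact (mem_monoPairs.1 (hE h)).2
  refine reach_adj hx (adj_inter hxy fun p hp hpe => ?_)
  have := mem_monoPairs.1 (hE hp)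
  rw [mem_monoIn]
  rcases hpe with rfl | rfl <;> simp_all

theorem isCompOf_reach {n : ℕ} (E : Finset (Fin n × Fin n)) (v : Fin n) : IsCompOf E (reach E {v}) := by
  refine ⟨⟨v, subset_reach (mem_singleton_self v)⟩, fun u hu => ?_⟩
  have hvu : (graphOf E).Reachable v u := by
    obtain ⟨a, ha, h⟩ := mem_reach.1 hu
    rwa [mem_singleton.1 ha] at h
  ext w
  simp only [mem_reach, mem_singleton, exists_eq_left]
  exact ⟨fun h => hvu.trans h, fun h => hvu.symm.trans h⟩

/-- Probability that some component of the class has size between `m` and `κ n`. -/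
theorem bex_middle_le {q : ℕ} {β a y r₀ κ x₀ D ρ c : ℝ} (h : StepConsts q β a y r₀ κ x₀ D ρ c)
    (hβ : 0 < β) :
    ∃ c' : ℝ, 0 < c' ∧ ∀ n m : ℕ, 1 ≤ m → ∀ (σ : Conf n q) (s : Fin q),
      (a - r₀) * n ≤ cntN σ s →
      bex (Real.exp (-(β / n))) (monoPairs σ) (fun E =>
        ∑ S ∈ (univ.filter fun v => σ v = s).powerset.filter
          (fun S => m ≤ S.card ∧ (S.card : ℝ) ≤ κ * n),
        if IsCompOf E S then 1 else 0) ≤ (n + 1) * n * Real.exp (-(c' * m)) := by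
  obtain ⟨c', hc', hlow⟩ := compWeight_low hβ h.hκ h.hc (by linarith [h.hr, h.hra]) h.below
  refine ⟨c', hc', fun n m hm σ s hN => ?_⟩
  obtain ⟨hr0, hr1, -⟩ := exp_neg_div_bounds hβ n
  set r := Real.exp (-(β / n)) with hr
  set N := cntN σ s with hNdef
  have hNn : N ≤ n := cntN_le σ s
  set Dd := univ.filter fun v => σ v = s with hDd
  have hDc : Dd.card = N := rfl
  rw [bex_sum]
  have hone : ∀ S ∈ Dd.powerset.filter (fun S => m ≤ S.card ∧ (S.card : ℝ) ≤ κ * n),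
      bex r (monoPairs σ) (fun E => if IsCompOf E S then 1 else 0) ≤
        r ^ (S.card * (N - S.card)) * (1 - r ^ S.card) ^ (S.card - 1) := by
    intro S hS
    obtain ⟨hS1, hS2, hS3⟩ := by simpa using hS
    have := bex_isCompOf_le (σ := σ) (S := S) (s := s) hr0 hr1 (card_pos.1 (by omega))
      (fun v hv => (mem_filter.1 (hS1 hv)).2) (fun _ => 1) (fun _ => 1) (fun _ => zero_le_one)
      (fun _ _ _ => le_rfl)
    rwa [bex_const, mul_one] at this
  refine (sum_le_sum hone).trans ?_
  rw [sum_filter, sum_powerset]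
  have hlevel : ∀ k ∈ range (Dd.card + 1), ∑ S ∈ powersetCard k Dd,
      (if m ≤ S.card ∧ (S.card : ℝ) ≤ κ * n then
        r ^ (S.card * (N - S.card)) * (1 - r ^ S.card) ^ (S.card - 1) else 0) ≤
      n * Real.exp (-(c' * m)) := by
    intro k hk
    have e : ∀ S ∈ powersetCard k Dd, (if m ≤ S.card ∧ (S.card : ℝ) ≤ κ * n then
        r ^ (S.card * (N - S.card)) * (1 - r ^ S.card) ^ (S.card - 1) else 0) =
        if m ≤ k ∧ (k : ℝ) ≤ κ * n then r ^ (k * (N - k)) * (1 - r ^ k) ^ (k - 1) else 0 := by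
      intro S hS
      simp only [(mem_powersetCard.1 hS).2]
    rw [sum_congr rfl e, sum_const, card_powersetCard, nsmul_eq_mul, hDc]
    split_ifs with hk2
    · have hkN : k ≤ N := by rw [mem_range, hDc] at hk; omega
      have := hlow n N k (by omega) hkN hk2.2 hN
      rw [compWeight] at this
      refine this.trans ?_
      gcongr
      exact hk2.1
    · rw [mul_zero]; positivity
  refine (sum_le_sum hlevel).trans ?_
  rw [sum_const, card_range, nsmul_eq_mul, ← mul_assoc, hDc]
  push_cast
  gcongr

theorem reach_singleton_subset_class {n q : ℕ} {σ : Conf n q} {E : Finset (Fin n × Fin n)}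
    (hE : E ⊆ monoPairs σ) (v : Fin n) : reach E {v} ⊆ univ.filter fun u => σ u = σ v := by
  apply reach_subset_of_closed
  · simp
  · intro x hx y hxy
    have hx := (mem_filter.1 hx).2
    refine mem_filter.2 ⟨mem_univ _, ?_⟩
    rw [← hx]
    rcases (graphOf_adj.1 hxy).2 with h | h
    · exact (mem_monoPairs.1 (hE h)).2.symm
    · exact (mem_monoPairs.1 (hE h)).2

theorem exp_neg_div_le_convex {x k : ℝ} (hk : 1 ≤ k) :
    1 - Real.exp (-x) ≤ k * (1 - Real.exp (-(x / k))) := by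
  have h := one_add_mul_self_le_rpow_one_add (s := Real.exp (-(x / k)) - 1)
    (by linarith [Real.exp_pos (-(x / k))]) hk
  rw [show 1 + (Real.exp (-(x / k)) - 1) = Real.exp (-(x / k)) by ring, ← Real.exp_mul,
    show -(x / k) * k = -x by field_simp] at h
  linarith

theorem one_sub_exp_neg_ge {x : ℝ} (hx : 0 ≤ x) : x / (1 + x) ≤ 1 - Real.exp (-x) := by
  have h := Real.add_one_le_exp x
  have h2 : Real.exp (-x) ≤ 1 / (1 + x) := by
    rw [Real.exp_neg, ← one_div]
    exact one_div_le_one_div_of_le (by linarith) (by linarith)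
  have : x / (1 + x) = 1 - 1 / (1 + x) := by field_simp; ring
  linarith

set_option maxHeartbeats 1000000 in
theorem bex_nowindow_le {q : ℕ} {β a y r₀ κ x₀ D ρ c : ℝ} (h : StepConsts q β a y r₀ κ x₀ D ρ c)
    (hβ : 0 < β) :
    ∃ C : ℝ, 0 < C ∧ ∀ n : ℕ, 1 ≤ n → ∀ (σ : Conf n q) (s : Fin q), (a - r₀) * n ≤ cntN σ s →
      bex (Real.exp (-(β / n))) (monoPairs σ) (fun E =>
        if ∀ S ∈ wsets κ σ s, ¬ IsCompOf E S then 1 else 0) ≤ C / Real.sqrt n := by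
  obtain ⟨c', hc', hmid⟩ := bex_middle_le h hβ
  set α := a - r₀ with hα
  have hα0 : 0 < α := by linarith [h.hr, h.hra]
  have hc := h.hc
  have hκ := h.hκ
  set u := κ / α with hu
  have hu0 : 0 < u := by positivity
  have hu1 : u * (1 + c) ≤ 1 - Real.exp (-(β * κ)) := by
    have := h.below
    rw [hu, div_mul_eq_mul_div, div_le_iff₀ hα0]; linarith
  have hu2 : Real.exp (-(β * κ / (1 + c))) ≤ 1 - u := by
    have := exp_neg_div_le_convex (x := β * κ) (k := 1 + c) (by linarith)
    nlinarith
  have hs1 : 0 < 1 - u := (Real.exp_pos _).trans_le hu2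
  set α' := α * (c / 2) / (1 + c / 2) with hα'
  have hα'0 : 0 < α' := by positivity
  set n₀ : ℝ := β * (1 + c / 2) / (c / 2) with hn₀
  have hn₀0 : 0 < n₀ := by positivity
  set w := u * α' / 2 with hw
  have hw0 : 0 < w := by positivity
  set C₁ : ℝ := 2 * ((Nat.factorial 5 : ℕ) / c' ^ 5) with hC₁
  set C₂ : ℝ := Real.exp (2 * u) * ((Nat.factorial 1 : ℕ) / w ^ 1) with hC₂
  have hC₁0 : 0 < C₁ := by positivity
  have hC₂0 : 0 < C₂ := by positivity
  set C₃ : ℝ := Real.sqrt n₀ + 2 / Real.sqrt α' with hC₃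
  have hC₃0 : 0 < C₃ := by positivity
  refine ⟨C₁ + C₂ + C₃, by positivity, fun n hn σ s hN => ?_⟩
  have hn0 : (0 : ℝ) < n := by exact_mod_cast hn
  have hsq : 0 < Real.sqrt n := Real.sqrt_pos.2 hn0
  have hsqsq : Real.sqrt n * Real.sqrt n = n := Real.mul_self_sqrt hn0.le
  obtain ⟨hr0, hr1, -⟩ := exp_neg_div_bounds hβ n
  by_cases hsmall : Real.sqrt n ≤ C₃
  · refine (bex_le_const hr0 hr1 (c := 1) fun E _ => by split_ifs <;> norm_num).trans ?_
    rw [le_div_iff₀ hsq]; linarith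
  push Not at hsmall
  have hs1' : (1 : ℝ) ≤ Real.sqrt n := by
    rw [Real.one_le_sqrt]; exact_mod_cast hn
  have hbig : n₀ ≤ n := by
    have h1 : Real.sqrt n₀ ≤ Real.sqrt n := by
      have : 0 < 2 / Real.sqrt α' := by positivity
      linarith
    exact (Real.sqrt_le_sqrt_iff hn0.le).1 h1
  have hbig2 : 4 ≤ α' * n := by
    have h1 : 2 / Real.sqrt α' ≤ Real.sqrt n := by
      have : 0 < Real.sqrt n₀ := by positivity
      linarith
    rw [div_le_iff₀ (by positivity), ← Real.sqrt_mul hn0.le] at h1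
    have := Real.le_sqrt' (y := n * α') (x := 2) (by norm_num)
    have := this.1 h1
    linarith
  set r := Real.exp (-(β / n)) with hr
  set N := cntN σ s with hNdef
  set Dd := univ.filter fun v => σ v = s with hDd
  have hDc : Dd.card = N := rfl
  set m := ⌈Real.sqrt n⌉₊ with hm
  have hm1 : 1 ≤ m := Nat.one_le_ceil_iff.2 hsq
  have hmge : Real.sqrt n ≤ m := Nat.le_ceil _
  have hmle : (m : ℝ) ≤ 2 * Real.sqrt n := by
    have := (Nat.ceil_lt_add_one hsq.le).le
    linarith
  have hm0 : (0 : ℝ) < m := by exact_mod_cast hm1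
  set d := ⌈α * n / (1 + c / 2)⌉₊ with hd
  have hdge : α * n / (1 + c / 2) ≤ d := Nat.le_ceil _
  have hdle : (d : ℝ) ≤ α * n / (1 + c / 2) + 1 := (Nat.ceil_lt_add_one (by positivity)).le
  set t := ⌊(α' * n - 1) / m⌋₊ with ht
  have htle : (t : ℝ) * m ≤ α' * n - 1 := by
    have : (t : ℝ) ≤ (α' * n - 1) / m := Nat.floor_le (by
      apply div_nonneg _ hm0.le; linarith)
    rwa [le_div_iff₀ hm0] at this
  have htge : α' * Real.sqrt n / 2 - 2 ≤ t := by
    have h1 : (α' * n - 1) / m - 1 ≤ t := by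
      have := Nat.lt_floor_add_one ((α' * n - 1) / (m : ℝ)); linarith
    have h2 : α' * Real.sqrt n / 2 - 1 ≤ (α' * n - 1) / m := by
      rw [le_div_iff₀ hm0]
      have h3 : α' * Real.sqrt n / 2 * m ≤ α' * Real.sqrt n / 2 * (2 * Real.sqrt n) := by gcongr
      have h4 : α' * Real.sqrt n / 2 * (2 * Real.sqrt n) = α' * n := by
        linear_combination α' * hsqsq
      have : (1 : ℝ) ≤ m := by exact_mod_cast hm1
      nlinarith
    linarith
  have htmd : t * m + d ≤ N := by
    have : ((t * m + d : ℕ) : ℝ) ≤ N := by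
      push_cast
      have : α' * n + α * n / (1 + c / 2) = α * n := by rw [hα']; field_simp; ring
      linarith
    exact_mod_cast this
  have htN : t ≤ Dd.card := by
    rw [hDc]; nlinarith
  obtain ⟨A, hAD, hAt⟩ := exists_subset_card_eq htN
  have hAs : ∀ v ∈ A, σ v = s := fun v hv => (mem_filter.1 (hAD hv)).2
  have hpow : (r + (1 - r) * (1 - u)) ^ d ≤ 1 - u := by
    have h1 : r + (1 - r) * (1 - u) ≤ Real.exp (-((1 - r) * u)) := by
      have := Real.add_one_le_exp (-((1 - r) * u)); nlinarith
    have h0 : 0 ≤ r + (1 - r) * (1 - u) := by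
      have := mul_nonneg (sub_nonneg.2 hr1) hs1.le; linarith
    refine (pow_le_pow_left₀ h0 h1 d).trans (le_trans ?_ hu2)
    rw [← Real.exp_nat_mul, Real.exp_le_exp]
    have hr2 : β / (n + β) ≤ 1 - r := by
      have := one_sub_exp_neg_ge (x := β / n) (by positivity)
      refine le_trans (le_of_eq ?_) this
      field_simp
    have h2 : β * α / (1 + c) ≤ d * (1 - r) := by
      calc β * α / (1 + c) ≤ (α * n / (1 + c / 2)) * (β / (n + β)) := by
            rw [div_mul_div_comm, div_le_div_iff₀ (by positivity) (by positivity)]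
            have : β * (1 + c / 2) ≤ c / 2 * n := by
              rw [hn₀, div_le_iff₀ (by positivity)] at hbig; linarith
            have h5 : (1 + c / 2) * (n + β) ≤ n * (1 + c) := by nlinarith
            have h6 : 0 ≤ α * β := by positivity
            nlinarith [mul_le_mul_of_nonneg_left h5 h6]
        _ ≤ _ := by
          have : 0 ≤ 1 - r := sub_nonneg.2 hr1
          gcongr
    have h3 : β * κ / (1 + c) = β * α / (1 + c) * u := by rw [hu]; field_simp
    rw [h3]
    have := mul_le_mul_of_nonneg_right h2 hu0.le
    linarith
  have hsmallreach : bex r (monoPairs σ) (fun E => if (reach E A).card + d ≤ Dd.card then 1 else 0) ≤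
      (1 - u) ^ t := by
    rw [← hAt]
    refine le_trans (le_of_eq ?_) (bex_reach_small_le (σ := σ) (B := Dd) hr0 hr1 hs1.le (by linarith) hpow hAD ?_)
    · refine bex_restrict (g := fun E => if (reach E A).card + d ≤ Dd.card then 1 else 0) monoIn_subset ?_
      intro E hE
      simp only [hDd, reach_inter_class hE hAs]
    · intro x hx y hy
      rw [(mem_filter.1 hx).2, (mem_filter.1 hy).2]
  have hpt : ∀ E ⊆ monoPairs σ, (if ∀ S ∈ wsets κ σ s, ¬ IsCompOf E S then (1 : ℝ) else 0) ≤
      (∑ S ∈ Dd.powerset.filter (fun S => m ≤ S.card ∧ (S.card : ℝ) ≤ κ * n),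
        if IsCompOf E S then 1 else 0) + if (reach E A).card + d ≤ Dd.card then 1 else 0 := by
    intro E hE
    have hnn : ∀ S ∈ Dd.powerset.filter (fun S => m ≤ S.card ∧ (S.card : ℝ) ≤ κ * n),
      (0 : ℝ) ≤ if IsCompOf E S then 1 else 0 := fun S _ => by split_ifs <;> norm_num
    have hsn := sum_nonneg hnn
    have h0 : (0 : ℝ) ≤ if (reach E A).card + d ≤ Dd.card then 1 else 0 := by split_ifs <;> norm_num
    split_ifs with hnw hre
    · linarith
    swap
    · linarith
    swap
    · linarith
    by_cases hall : ∀ v ∈ A, (reach E {v}).card ≤ m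
    · exfalso
      apply hre
      have : (reach E A).card ≤ A.card * m := by
        rw [reach_eq_biUnion]
        exact card_biUnion_le_card_mul _ _ _ hall
      rw [hAt] at this
      rw [hDc]; omega
    · push Not at hall
      obtain ⟨v, hv, hvm⟩ := hall
      have hsub : reach E {v} ⊆ Dd := by
        have := reach_singleton_subset_class hE v
        rwa [hAs v hv] at this
      have hw := hnw (reach E {v})
      have hκn : ((reach E {v}).card : ℝ) ≤ κ * n := by
        by_contra hcon
        push Not at hcon
        exact hw (mem_filter.2 ⟨mem_powerset.2 hsub, hcon.le⟩) (isCompOf_reach E v)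
      have := single_le_sum hnn (a := reach E {v})
        (mem_filter.2 ⟨mem_powerset.2 hsub, hvm.le, hκn⟩)
      rw [if_pos (isCompOf_reach E v)] at this
      linarith
  refine (bex_mono hr0 hr1 hpt).trans ?_
  rw [bex_add]
  have hA := hmid n m hm1 σ s hN
  have hA2 : ((n : ℝ) + 1) * n * Real.exp (-(c' * m)) ≤ C₁ / Real.sqrt n := by
    rw [le_div_iff₀ hsq]
    calc ((n : ℝ) + 1) * n * Real.exp (-(c' * m)) * Real.sqrt n
        ≤ (2 * n) * n * Real.exp (-(c' * Real.sqrt n)) * Real.sqrt n := by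
          have : (1 : ℝ) ≤ n := by exact_mod_cast hn
          gcongr
          linarith
      _ = 2 * (Real.sqrt n ^ 5 * Real.exp (-(c' * Real.sqrt n))) := by
          linear_combination (-2 * (n + Real.sqrt n * Real.sqrt n) * Real.sqrt n * Real.exp (-(c' * Real.sqrt n))) * hsqsq
      _ ≤ C₁ := by
          have := pow_mul_exp_neg_le hc' hsq.le 5
          rw [hC₁]; linarith
  have hB : (1 - u) ^ t ≤ C₂ / Real.sqrt n := by
    rw [le_div_iff₀ hsq]
    calc (1 - u) ^ t * Real.sqrt n ≤ Real.exp (-u) ^ t * Real.sqrt n := by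
          have := Real.add_one_le_exp (-u)
          gcongr
          linarith
      _ ≤ (Real.exp (2 * u) * Real.exp (-(w * Real.sqrt n))) * Real.sqrt n := by
          rw [← Real.exp_nat_mul, ← Real.exp_add]
          gcongr
          rw [hw]
          nlinarith
      _ = Real.exp (2 * u) * (Real.sqrt n ^ 1 * Real.exp (-(w * Real.sqrt n))) := by ring
      _ ≤ C₂ := by
          have := pow_mul_exp_neg_le hw0 hsq.le 1
          rw [hC₂]; gcongr
  have hC3 : 0 ≤ C₃ / Real.sqrt n := by positivity
  have : (C₁ + C₂ + C₃) / Real.sqrt n = C₁ / Real.sqrt n + C₂ / Real.sqrt n + C₃ / Real.sqrt n := by ring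
  rw [this]
  linarith

/-- The vertices of `B` isolated in `E`. -/
noncomputable def isoIn {n : ℕ} (E : Finset (Fin n × Fin n)) (B : Finset (Fin n)) : Finset (Fin n) :=
  B.filter fun v => reach E {v} = {v}

theorem reach_singleton_eq_iff {n q : ℕ} {σ : Conf n q} {E : Finset (Fin n × Fin n)} {v : Fin n}
    (hE : E ⊆ monoPairs σ) : reach E {v} = {v} ↔ Disjoint E (crossPairs σ {v}) := by
  constructor
  · intro h
    have : IsCompOf E {v} := ⟨singleton_nonempty v, fun u hu => by rw [mem_singleton.1 hu, h]⟩
    exact this.disjoint_cross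
  · intro h
    apply subset_antisymm _ subset_reach
    apply reach_subset_of_closed subset_rfl
    intro x hx y hxy
    rw [mem_singleton] at hx ⊢
    subst hx
    by_contra hy
    rw [disjoint_left] at h
    rcases (graphOf_adj.1 hxy).2 with hp | hp
    · exact h hp (mem_filter.2 ⟨hE hp, by simp [hy]⟩)
    · exact h hp (mem_filter.2 ⟨hE hp, by simp [hy]⟩)

theorem card_crossPairs_singleton_le {n q : ℕ} (σ : Conf n q) (v : Fin n) :
    (crossPairs σ {v}).card ≤ n := by
  have : crossPairs σ {v} ⊆ starAt v univ := by
    rintro ⟨x, y⟩ hp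
    obtain ⟨h1, h2⟩ := mem_filter.1 hp
    have hlt := (mem_monoPairs.1 h1).1
    simp only [mem_singleton] at h2 hlt
    by_cases hx : x = v
    · subst hx; exact mem_star.2 ⟨y, mem_univ _, min_eq_left hlt.le, max_eq_right hlt.le⟩
    · have hy : y = v := by tauto
      subst hy; exact mem_star.2 ⟨x, mem_univ _, min_eq_right hlt.le, max_eq_left hlt.le⟩
  refine (card_le_card this).trans (card_image_le.trans ?_)
  simp

theorem card_crossPairs_inter_le {n q : ℕ} (σ : Conf n q) {u v : Fin n} (huv : u ≠ v) :
    (crossPairs σ {u} ∩ crossPairs σ {v}).card ≤ 1 := by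
  have : crossPairs σ {u} ∩ crossPairs σ {v} ⊆ {(min u v, max u v)} := by
    rintro ⟨x, y⟩ hp
    obtain ⟨hp1, hp2⟩ := mem_inter.1 hp
    obtain ⟨h1, h2⟩ := mem_filter.1 hp1
    obtain ⟨-, h3⟩ := mem_filter.1 hp2
    have hlt := (mem_monoPairs.1 h1).1
    simp only [mem_singleton, Prod.mk.injEq] at h2 h3 hlt ⊢
    have : (x = u ∧ y = v) ∨ (x = v ∧ y = u) := by
      by_cases hxu : x = u
      · left; refine ⟨hxu, ?_⟩
        by_contra hyv
        apply h3; subst hxu; simp [huv, hyv]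
      · right
        have hyu : y = u := by tauto
        refine ⟨?_, hyu⟩
        by_contra hxv
        apply h3; subst hyu; simp [huv, hxv]
    rcases this with ⟨rfl, rfl⟩ | ⟨rfl, rfl⟩
    · exact ⟨(min_eq_left hlt.le).symm, (max_eq_right hlt.le).symm⟩
    · exact ⟨(min_eq_right hlt.le).symm, (max_eq_left hlt.le).symm⟩
  exact (card_le_card this).trans (by simp)

set_option maxHeartbeats 1000000 in
theorem bex_few_isolated_le {β l : ℝ} (hβ : 0 < β) (hl : 0 < l) :
    ∃ C : ℝ, 0 < C ∧ ∀ n : ℕ, 1 ≤ n → ∀ (q : ℕ) (σ : Conf n q) (B : Finset (Fin n)),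
      l * n ≤ B.card → bex (Real.exp (-(β / n))) (monoPairs σ) (fun E =>
        if ((isoIn E B).card : ℝ) < l * Real.exp (-β) / 2 * n then 1 else 0) ≤ C / n := by
  set C₁ : ℝ := 1 + β * Real.exp β with hC₁
  have hC₁0 : 0 < C₁ := by positivity
  set e := l * Real.exp (-β) with he
  have he0 : 0 < e := by positivity
  refine ⟨4 * C₁ / e ^ 2, by positivity, fun n hn q σ B hB => ?_⟩
  have hn0 : (0 : ℝ) < n := by exact_mod_cast hn
  obtain ⟨hr0, hr1, -⟩ := exp_neg_div_bounds hβ n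
  set r := Real.exp (-(β / n)) with hr
  have hrpos : 0 < r := Real.exp_pos _
  set I : Fin n → Finset (Fin n × Fin n) → ℝ := fun v E => if Disjoint E (crossPairs σ {v}) then 1 else 0
    with hI
  have hcard : ∀ E ⊆ monoPairs σ, ((isoIn E B).card : ℝ) = ∑ v ∈ B, I v E := by
    intro E hE
    rw [isoIn, card_filter]; push_cast
    exact sum_congr rfl fun v _ => by simp only [hI, reach_singleton_eq_iff hE]
  set p : Fin n → ℝ := fun v => r ^ (crossPairs σ {v}).card with hp
  have hp1 : ∀ v, p v ≤ 1 := fun v => pow_le_one₀ hr0 hr1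
  have hp0 : ∀ v, 0 ≤ p v := fun v => pow_nonneg hr0 _
  have hpe : ∀ v, Real.exp (-β) ≤ p v := by
    intro v
    calc Real.exp (-β) = r ^ n := by
          rw [hr, exp_pow_div, div_self hn0.ne', mul_one]
      _ ≤ _ := pow_le_pow_of_le_one hr0 hr1 (card_crossPairs_singleton_le σ v)
  have hEI : ∀ v, bex r (monoPairs σ) (I v) = p v := fun v => bex_avoid (filter_subset _ _)
  have hEII : ∀ u v, bex r (monoPairs σ) (fun E => I u E * I v E) ≤
      p u * p v * r⁻¹ + if u = v then 1 else 0 := by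
    intro u v
    split_ifs with huv
    · refine (bex_le_const hr0 hr1 (c := 1) ?_).trans ?_
      · intro E _; simp only [hI]; split_ifs <;> norm_num
      · have : 0 ≤ p u * p v * r⁻¹ := mul_nonneg (mul_nonneg (hp0 _) (hp0 _)) (inv_nonneg.2 hr0)
        linarith
    · have h1 : bex r (monoPairs σ) (fun E => I u E * I v E) =
          r ^ (crossPairs σ {u} ∪ crossPairs σ {v}).card := by
        rw [← bex_avoid (r := r) (U := monoPairs σ) (W := crossPairs σ {u} ∪ crossPairs σ {v})
          (union_subset (filter_subset _ _) (filter_subset _ _))]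
        refine bex_congr fun E _ => ?_
        simp only [hI, disjoint_union_right]
        by_cases h1 : Disjoint E (crossPairs σ {u}) <;> by_cases h2 : Disjoint E (crossPairs σ {v}) <;>
          simp [h1, h2]
      rw [h1, add_zero, le_mul_inv_iff₀ hrpos, ← pow_succ, hp]
      simp only
      rw [← pow_add]
      apply pow_le_pow_of_le_one hr0 hr1
      have := card_union_add_card_inter (crossPairs σ {u}) (crossPairs σ {v})
      have := card_crossPairs_inter_le σ huv
      omega
  set M := ∑ v ∈ B, p v with hM
  have hBn : (B.card : ℝ) ≤ n := by
    have := card_le_univ B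
    rw [Fintype.card_fin] at this
    exact_mod_cast this
  have hMn : M ≤ n := by
    calc M ≤ ∑ v ∈ B, (1 : ℝ) := sum_le_sum fun v _ => hp1 v
      _ ≤ n := by simpa using hBn
  have hMe : e * n ≤ M := by
    calc e * n = (l * n) * Real.exp (-β) := by rw [he]; ring
      _ ≤ B.card * Real.exp (-β) := by gcongr
      _ = ∑ v ∈ B, Real.exp (-β) := by rw [sum_const, nsmul_eq_mul]
      _ ≤ M := sum_le_sum fun v _ => hpe v
  have hM0 : 0 < M := by have : 0 < e * n := by positivity
                         linarith
  have hvar : bex r (monoPairs σ) (fun E => (∑ v ∈ B, I v E - M) ^ 2) ≤ C₁ * n := by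
    have h1 : bex r (monoPairs σ) (fun E => (∑ v ∈ B, I v E - M) ^ 2) =
        ∑ u ∈ B, ∑ v ∈ B, bex r (monoPairs σ) (fun E => I u E * I v E) - M ^ 2 := by
      have e1 : ∀ E, (∑ v ∈ B, I v E - M) ^ 2 =
          (∑ u ∈ B, ∑ v ∈ B, I u E * I v E) + ((-2 * M) * (∑ v ∈ B, I v E) + M ^ 2) := by
        intro E
        rw [← sum_mul_sum]; ring
      simp only [e1]
      rw [bex_add, bex_add, bex_const, bex_mul_left, bex_sum, bex_sum]
      simp only [bex_sum, hEI]
      rw [← hM]; ring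
    have h2 : ∑ u ∈ B, ∑ v ∈ B, bex r (monoPairs σ) (fun E => I u E * I v E) ≤ M * M * r⁻¹ + n := by
      calc _ ≤ ∑ u ∈ B, ∑ v ∈ B, (p u * p v * r⁻¹ + if u = v then 1 else 0) :=
            sum_le_sum fun u _ => sum_le_sum fun v _ => hEII u v
        _ = M * M * r⁻¹ + B.card := by
            simp only [sum_add_distrib]
            congr 1
            · rw [hM, sum_mul_sum, sum_mul]; simp only [sum_mul]
            · simp
        _ ≤ _ := by gcongr
    have h3 : r⁻¹ - 1 ≤ β * Real.exp β / n := by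
      have h4 : β / n ≤ β := div_le_self hβ.le (by exact_mod_cast hn)
      have h5 : r⁻¹ = Real.exp (β / n) := by rw [hr, ← Real.exp_neg, neg_neg]
      have h6 := Real.add_one_le_exp (-(β / n))
      have h7 : Real.exp (β / n) * Real.exp (-(β / n)) = 1 := by rw [← Real.exp_add]; simp
      have h8 : Real.exp (β / n) ≤ Real.exp β := Real.exp_le_exp.2 h4
      rw [h5]
      have h9 : 0 < Real.exp (β / n) := Real.exp_pos _
      have h10 : Real.exp (β / n) - 1 ≤ Real.exp (β / n) * (β / n) := by nlinarith
      calc _ ≤ Real.exp (β / n) * (β / n) := h10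
        _ ≤ Real.exp β * (β / n) := by gcongr
        _ = _ := by ring
    have h11 : M * M * (r⁻¹ - 1) ≤ β * Real.exp β * n := by
      calc M * M * (r⁻¹ - 1) ≤ M * M * (β * Real.exp β / n) := by gcongr
        _ ≤ n * n * (β * Real.exp β / n) := by gcongr
        _ = _ := by field_simp
    rw [h1, hC₁]
    nlinarith
  calc _ ≤ bex r (monoPairs σ) (fun E => 4 / M ^ 2 * (∑ v ∈ B, I v E - M) ^ 2) := by
        refine bex_mono hr0 hr1 fun E hE => ?_
        rw [hcard E hE]
        split_ifs with hlt
        · rw [div_mul_eq_mul_div, le_div_iff₀ (by positivity)]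
          nlinarith
        · positivity
    _ ≤ 4 / M ^ 2 * (C₁ * n) := by rw [bex_mul_left]; gcongr
    _ ≤ 4 / (e * n) ^ 2 * (C₁ * n) := by gcongr
    _ = _ := by field_simp

/-- `D * |L - y a n|` is controlled by the distance of `N` from `a n` and the error of the giant. -/
theorem giant_stable {q : ℕ} {β a y r₀ κ x₀ D ρ c : ℝ} (h : StepConsts q β a y r₀ κ x₀ D ρ c)
    (hq : 1 ≤ q) (hβ : 0 < β) (hy : 0 < y) (ha : 0 < a) (hexp : Real.exp (-(β * a * y)) = 1 - y)
    {n N L : ℝ} (hn : 0 < n) (hN : |N - a * n| ≤ r₀ * n) (hL : κ * n ≤ L) :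
    (1 - 1 / (q : ℝ)) * |L - y * a * n| ≤
      ρ * |N - a * n| + 1 / D * |L - N * (1 - Real.exp (-(β * (L / n))))| := by
  have hD := h.hD
  have hκ := h.hκ
  have hq1 : 0 ≤ 1 - 1 / (q : ℝ) := by
    have : (1 : ℝ) ≤ q := by exact_mod_cast hq
    rw [sub_nonneg, div_le_one (by linarith)]; exact this
  have hκy : κ ≤ y * a := by
    by_contra hcon
    push Not at hcon
    have hya : 0 < y * a := by positivity
    have h1 := exp_neg_div_le_convex (x := β * κ) (k := κ / (y * a)) (by rw [le_div_iff₀ hya]; linarith)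
    rw [show β * κ / (κ / (y * a)) = β * a * y by field_simp, hexp] at h1
    have h2 : κ / (y * a) * (1 - (1 - y)) = κ / a := by field_simp; ring
    rw [h2, le_div_iff₀ ha] at h1
    have h3 := h.below
    have h4 : 0 ≤ 1 - Real.exp (-(β * κ)) := by
      rw [sub_nonneg, Real.exp_le_one_iff]; nlinarith
    have := mul_pos h.hc hκ
    nlinarith [mul_nonneg h.hr.le h4]
  set ν := N / n with hν
  have hν1 : ν ≤ a + r₀ := by
    rw [hν, div_le_iff₀ hn]; linarith [(abs_le.1 hN).2]
  have hν0 : 0 ≤ ν := by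
    rw [hν]; apply div_nonneg _ hn.le
    have := (abs_le.1 hN).1
    nlinarith [h.hra, h.hr]
  have key : ∀ x z, κ ≤ z → z ≤ x →
      D * (x - z) ≤ (x - ν * (1 - Real.exp (-(β * x)))) - (z - ν * (1 - Real.exp (-(β * z)))) := by
    intro x z hz hzx
    have h1 : Real.exp (-(β * z)) - Real.exp (-(β * x)) ≤ β * (x - z) * Real.exp (-(β * κ)) := by
      have e1 : Real.exp (-(β * x)) = Real.exp (-(β * z)) * Real.exp (-(β * (x - z))) := by
        rw [← Real.exp_add]; congr 1; ring
      have e2 := Real.add_one_le_exp (-(β * (x - z)))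
      have e3 : Real.exp (-(β * z)) ≤ Real.exp (-(β * κ)) := by
        rw [Real.exp_le_exp]; nlinarith
      have e4 := Real.exp_pos (-(β * z))
      have e5 : 0 ≤ β * (x - z) := mul_nonneg hβ.le (by linarith)
      rw [e1]
      nlinarith [mul_le_mul_of_nonneg_left e3 e5, mul_le_mul_of_nonneg_left e2 e4.le]
    have h2 : ν * (β * (x - z) * Real.exp (-(β * κ))) ≤ (1 - D) * (x - z) := by
      have h0 : 0 ≤ β * (x - z) * Real.exp (-(β * κ)) := 
        mul_nonneg (mul_nonneg hβ.le (by linarith)) (Real.exp_pos _).le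
      calc _ ≤ (a + r₀) * (β * (x - z) * Real.exp (-(β * κ))) := mul_le_mul_of_nonneg_right hν1 h0
        _ = ((a + r₀) * β * Real.exp (-(β * κ))) * (x - z) := by ring
        _ ≤ _ := mul_le_mul_of_nonneg_right h.slope (by linarith)
    nlinarith [mul_le_mul_of_nonneg_left h1 hν0]
  have keyabs : ∀ x z, κ ≤ z → κ ≤ x →
      D * |x - z| ≤ |(x - ν * (1 - Real.exp (-(β * x)))) - (z - ν * (1 - Real.exp (-(β * z))))| := by
    intro x z hz hx
    rcases le_total z x with hzx | hzx
    · rw [abs_of_nonneg (sub_nonneg.2 hzx)]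
      exact (key x z hz hzx).trans (le_abs_self _)
    · rw [abs_sub_comm x z, abs_of_nonneg (sub_nonneg.2 hzx), abs_sub_comm]
      exact (key z x hx hzx).trans (le_abs_self _)
  have hk := keyabs (L / n) (y * a) hκy (by rw [le_div_iff₀ hn]; exact hL)
  rw [show β * (y * a) = β * a * y by ring, hexp] at hk
  have h5 := abs_sub (L / n - ν * (1 - Real.exp (-(β * (L / n))))) (y * a - ν * (1 - (1 - y)))
  have h6 : |L / n - ν * (1 - Real.exp (-(β * (L / n))))| =
      |L - N * (1 - Real.exp (-(β * (L / n))))| / n := by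
    rw [← abs_of_pos hn, ← abs_div, abs_of_pos hn, hν]; congr 1; field_simp
  have h7 : |y * a - ν * (1 - (1 - y))| = y * |N - a * n| / n := by
    rw [abs_sub_comm, ← abs_of_pos hn, ← abs_of_pos hy, ← abs_mul, ← abs_div, abs_of_pos hn,
      abs_of_pos hy, hν]; congr 1; field_simp; ring
  have h8 : |L / n - y * a| = |L - y * a * n| / n := by
    rw [← abs_of_pos hn, ← abs_div, abs_of_pos hn]; congr 1; field_simp
  rw [h6, h7] at h5
  rw [h8] at hk
  set A := |L - N * (1 - Real.exp (-(β * (L / n))))|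
  set M := |N - a * n|
  set Q := |L - y * a * n|
  have h9 : D * Q ≤ A + y * M := by
    have := hk.trans h5
    rw [← add_div, mul_div_assoc', div_le_div_iff_of_pos_right hn] at this
    exact this
  have hM : 0 ≤ M := abs_nonneg _
  have hA : 0 ≤ A := abs_nonneg _
  have h10 : Q ≤ A / D + y * M / D := by
    rw [← add_div, le_div_iff₀ hD]; linarith
  calc (1 - 1 / (q : ℝ)) * Q ≤ (1 - 1 / (q : ℝ)) * (A / D + y * M / D) := by gcongr
    _ = (1 - 1 / (q : ℝ)) * (1 / D * A) + ((1 - 1 / (q : ℝ)) * y) * M / D := by ring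
    _ ≤ 1 * (1 / D * A) + (ρ * D) * M / D := by
        have := h.contr
        have : 1 - 1 / (q : ℝ) ≤ 1 := by
          have : 0 ≤ 1 / (q : ℝ) := by positivity
          linarith
        gcongr
    _ = _ := by field_simp; ring

/-- Averaging over the uniform colouring of the components of `(V, E)`. -/
noncomputable def colE {n : ℕ} (q : ℕ) (E : Finset (Fin n × Fin n)) (f : Conf n q → ℝ) : ℝ :=
  ∑ τ : Conf n q, (if ∀ u v : Fin n, (graphOf E).Reachable u v → τ u = τ v then
    ((q : ℝ))⁻¹ ^ numComps E else 0) * f τ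

theorem sum_swStep {n q : ℕ} {β : ℝ} (σ : Conf n q) (f : Conf n q → ℝ) :
    ∑ τ, swStep n q β σ τ * f τ = bex (Real.exp (-(β / n))) (monoPairs σ) (fun E => colE q E f) := by
  simp only [swStep, bex, colE, sum_mul, mul_sum]
  rw [sum_comm]
  exact sum_congr rfl fun E _ => sum_congr rfl fun τ _ => by ring

/-- A representative of the component of `v`. -/
noncomputable def rootE {n : ℕ} (E : Finset (Fin n × Fin n)) (v : Fin n) : Fin n :=
  ((graphOf E).connectedComponentMk v).out

section root
variable {n q : ℕ} {E : Finset (Fin n × Fin n)} {u v : Fin n}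

theorem rootE_reachable : (graphOf E).Reachable (rootE E v) v := by
  apply SimpleGraph.ConnectedComponent.exact
  exact Quot.out_eq _

theorem rootE_eq_iff : rootE E u = rootE E v ↔ (graphOf E).Reachable u v := by
  constructor
  · intro h
    have h1 := rootE_reachable (E := E) (v := u)
    rw [h] at h1
    exact h1.symm.trans rootE_reachable
  · intro h
    rw [rootE, rootE, SimpleGraph.ConnectedComponent.sound h]

theorem card_image_rootE : (univ.image (rootE E)).card = numComps E := by
  have hinj : Function.Injective (fun C : (graphOf E).ConnectedComponent => (Quot.out C : Fin n)) := by
    intro a b hab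
    rw [← Quot.out_eq a, ← Quot.out_eq b]
    exact congrArg _ hab
  rw [numComps, Nat.card_eq_fintype_card, ← card_univ, ← card_image_of_injective _ hinj]
  congr 1
  ext v
  rw [mem_image, mem_image]
  constructor
  · rintro ⟨u, -, rfl⟩; exact ⟨_, mem_univ _, rfl⟩
  · rintro ⟨C, -, rfl⟩
    refine ⟨Quot.out C, mem_univ _, ?_⟩
    rw [rootE]
    congr 1
    exact Quot.out_eq C

theorem card_agree (A : Finset (Fin n)) (g : Conf n q) :
    (univ.filter fun c : Conf n q => ∀ v ∈ A, c v = g v).card = q ^ (n - A.card) := by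
  have : (univ.filter fun c : Conf n q => ∀ v ∈ A, c v = g v) =
      Fintype.piFinset fun v => if v ∈ A then {g v} else univ := by
    ext c
    simp only [mem_filter, mem_univ, true_and, Fintype.mem_piFinset]
    refine forall_congr' fun v => ?_
    split_ifs with h <;> simp [h]
  rw [this, Fintype.card_piFinset]
  have e : ∀ v, (if v ∈ A then ({g v} : Finset (Fin q)) else univ).card = if v ∈ A then 1 else q := by
    intro v; split_ifs <;> simp
  simp only [e]
  rw [prod_ite, prod_const_one, one_mul, prod_const]
  congr 1
  rw [filter_not, card_sdiff_of_subset (filter_subset _ _), card_univ, Fintype.card_fin]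
  simp

theorem colE_eq (hq : 0 < q) (f : Conf n q → ℝ) :
    colE q E f = ((q : ℝ) ^ n)⁻¹ * ∑ c : Conf n q, f (fun v => c (rootE E v)) := by
  have hq0 : (q : ℝ) ≠ 0 := by positivity
  have h1 : ∑ c : Conf n q, f (fun v => c (rootE E v)) =
      ∑ τ : Conf n q, ((univ.filter fun c : Conf n q => (fun v => c (rootE E v)) = τ).card : ℝ) * f τ := by
    rw [← sum_fiberwise univ (fun c : Conf n q => (fun v => c (rootE E v)))]
    refine sum_congr rfl fun τ _ => ?_
    rw [← nsmul_eq_mul, ← sum_const]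
    exact sum_congr rfl fun c hc => by rw [(mem_filter.1 hc).2]
  rw [h1, colE, mul_sum]
  refine sum_congr rfl fun τ _ => ?_
  rw [← mul_assoc]
  congr 1
  split_ifs with hτ
  · have e : (univ.filter fun c : Conf n q => (fun v => c (rootE E v)) = τ) =
        univ.filter fun c : Conf n q => ∀ v ∈ univ.image (rootE E), c v = τ v := by
      ext c
      simp only [mem_filter, mem_univ, true_and, mem_image, forall_exists_index, funext_iff,
        forall_apply_eq_imp_iff]
      exact forall_congr' fun v => by rw [hτ _ _ rootE_reachable]
    rw [e, card_agree, card_image_rootE]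
    have hle : numComps E ≤ n := by
      rw [← card_image_rootE]
      exact card_image_le.trans (by simp)
    push_cast
    rw [inv_pow, pow_sub₀ _ hq0 hle]
    field_simp
  · symm
    rw [mul_eq_zero]; right
    rw [Nat.cast_eq_zero, card_eq_zero, filter_eq_empty_iff]
    rintro c - rfl
    exact hτ fun u v huv => by simp only [rootE_eq_iff.2 huv]

theorem colE_add (f g : Conf n q → ℝ) : colE q E (fun τ => f τ + g τ) = colE q E f + colE q E g := by
  simp only [colE, mul_add, sum_add_distrib]

theorem colE_mul_left (k : ℝ) (f : Conf n q → ℝ) : colE q E (fun τ => k * f τ) = k * colE q E f := by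
  simp only [colE, mul_sum]
  exact sum_congr rfl fun _ _ => by ring

theorem colE_sum {ι : Type*} (s : Finset ι) (f : ι → Conf n q → ℝ) :
    colE q E (fun τ => ∑ i ∈ s, f i τ) = ∑ i ∈ s, colE q E (f i) := by
  simp only [colE, mul_sum]
  exact sum_comm

theorem colE_const (hq : 0 < q) (k : ℝ) : colE q E (fun _ : Conf n q => k) = k := by
  have : (q : ℝ) ≠ 0 := by positivity
  rw [colE_eq hq]
  rw [sum_const, card_univ, Fintype.card_fun, Fintype.card_fin, Fintype.card_fin, nsmul_eq_mul]
  push_cast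
  field_simp

theorem colE_mono {f g : Conf n q → ℝ}
    (h : ∀ τ, (∀ u v, (graphOf E).Reachable u v → τ u = τ v) → f τ ≤ g τ) : colE q E f ≤ colE q E g := by
  refine sum_le_sum fun τ _ => ?_
  split_ifs with hτ
  · exact mul_le_mul_of_nonneg_left (h τ hτ) (by positivity)
  · simp

theorem colE_single (hq : 0 < q) (j : Fin q) :
    colE q E (fun τ => if τ v = j then 1 else 0) = 1 / q := by
  have hq0 : (q : ℝ) ≠ 0 := by positivity
  rw [colE_eq hq, sum_boole]
  have := card_agree (q := q) {rootE E v} (fun _ => j)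
  simp only [mem_singleton, forall_eq, card_singleton] at this
  rw [this]
  have hn : 1 ≤ n := Fin.pos v
  push_cast
  rw [pow_sub₀ _ hq0 hn]; field_simp

theorem colE_pair (hq : 0 < q) (huv : ¬ (graphOf E).Reachable u v) (j : Fin q) :
    colE q E (fun τ => if τ u = j ∧ τ v = j then 1 else 0) = 1 / q ^ 2 := by
  have hq0 : (q : ℝ) ≠ 0 := by positivity
  have hne : rootE E u ≠ rootE E v := fun h => huv (rootE_eq_iff.1 h)
  rw [colE_eq hq, sum_boole]
  have := card_agree (q := q) {rootE E u, rootE E v} (fun _ => j)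
  rw [card_pair hne] at this
  simp only [mem_insert, mem_singleton, forall_eq_or_imp, forall_eq] at this
  rw [this]
  have hn : 2 ≤ n := by
    have := card_le_univ ({rootE E u, rootE E v} : Finset (Fin n))
    rwa [card_pair hne, Fintype.card_fin] at this
  push_cast
  rw [pow_sub₀ _ hq0 hn]; field_simp

/-- The number of vertices of `B` of colour `j` has variance at most the susceptibility. -/
theorem colE_noise_sq_le (hq : 0 < q) (B : Finset (Fin n)) (j : Fin q) :
    colE q E (fun τ => (((B.filter fun v => τ v = j).card : ℝ) - B.card / q) ^ 2) ≤
      ∑ u ∈ B, ((reach E {u}).card : ℝ) := by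
  have hq0 : (q : ℝ) ≠ 0 := by positivity
  have e : ∀ τ : Conf n q, (((B.filter fun v => τ v = j).card : ℝ) - B.card / q) ^ 2 =
      (∑ u ∈ B, ∑ v ∈ B, if τ u = j ∧ τ v = j then (1 : ℝ) else 0) +
      ((-2 * (B.card / q)) * (∑ u ∈ B, if τ u = j then (1 : ℝ) else 0) + (B.card / q) ^ 2) := by
    intro τ
    have h1 : ((B.filter fun v => τ v = j).card : ℝ) = ∑ u ∈ B, if τ u = j then (1 : ℝ) else 0 := by
      simp
    have h2 : (∑ u ∈ B, ∑ v ∈ B, if τ u = j ∧ τ v = j then (1 : ℝ) else 0) =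
        (∑ u ∈ B, if τ u = j then (1 : ℝ) else 0) * (∑ u ∈ B, if τ u = j then (1 : ℝ) else 0) := by
      rw [sum_mul_sum]
      refine sum_congr rfl fun u _ => sum_congr rfl fun v _ => ?_
      by_cases h1 : τ u = j <;> by_cases h2 : τ v = j <;> simp [h1, h2]
    rw [h2, h1]; ring
  simp only [e]
  rw [colE_add, colE_add, colE_const hq, colE_mul_left, colE_sum, colE_sum]
  simp only [colE_sum, colE_single hq]
  have h3 : ∀ u ∈ B, ∑ v ∈ B, colE q E (fun τ => if τ u = j ∧ τ v = j then (1 : ℝ) else 0) ≤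
      ((reach E {u}).card : ℝ) + B.card * (1 / q ^ 2) := by
    intro u _
    have h4 : ∀ v ∈ B, colE q E (fun τ => if τ u = j ∧ τ v = j then (1 : ℝ) else 0) ≤
        (if v ∈ reach E {u} then 1 else 0) + 1 / (q : ℝ) ^ 2 := by
      intro v _
      split_ifs with hv
      · have : colE q E (fun τ => if τ u = j ∧ τ v = j then (1 : ℝ) else 0) ≤ colE q E (fun _ : Conf n q => 1) :=
          colE_mono fun τ _ => by split_ifs <;> norm_num
        rw [colE_const hq] at this
        have : (0 : ℝ) ≤ 1 / (q : ℝ) ^ 2 := by positivity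
        linarith
      · rw [zero_add, colE_pair hq]
        intro h; exact hv (mem_reach.2 ⟨u, mem_singleton_self u, h⟩)
    refine (sum_le_sum h4).trans ?_
    rw [sum_add_distrib, sum_const, nsmul_eq_mul, sum_boole]
    gcongr
    intro x hx; exact (mem_filter.1 hx).2
  have h5 := sum_le_sum h3
  rw [sum_add_distrib, sum_const, nsmul_eq_mul] at h5
  rw [sum_const, nsmul_eq_mul]
  have h6 : (B.card : ℝ) * (B.card * (1 / q ^ 2)) + (-2 * (B.card / q) * (B.card * (1 / q)) + (B.card / q) ^ 2) = 0 := by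
    ring
  linarith

end root

/-- Weighted distance of `X` from the reference profile `c` when `s` is regarded as dominant. -/
noncomputable def distS {n q : ℕ} (a y B : ℝ) (P : Fin q → Finset (Fin n)) (c : Fin q → ℝ)
    (X : Conf n q) (s : Fin q) : ℝ :=
  ∑ i, |(projCnt P X i s : ℝ) - c i| + B * |(cntN X s : ℝ) - a * n| +
    ∑ j ∈ univ.erase s, |(cntN X j : ℝ) - (1 - y * a) / q * n|

/-- Distance of `X` from the reference profile `c`, up to the choice of the dominant spin. -/
noncomputable def swDist {n q : ℕ} (a y B : ℝ) (P : Fin q → Finset (Fin n)) (c : Fin q → ℝ)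
    (X : Conf n q) : ℝ := ⨅ s, distS a y B P c X s

/-- Expected evolution of the reference profile in one step. -/
noncomputable def ctrStep {n q : ℕ} (y : ℝ) (P : Fin q → Finset (Fin n)) (c : Fin q → ℝ) : Fin q → ℝ :=
  fun i => (1 - 1 / q) * y * c i + (P i).card / q

/-- Deviation from its mean of the number of vertices of `B` of colour `j`. -/
noncomputable def noise {n q : ℕ} (B : Finset (Fin n)) (j : Fin q) (τ : Conf n q) : ℝ :=
  ((B.filter fun v => τ v = j).card : ℝ) - B.card / q

section drift
variable {n q : ℕ} {a y B : ℝ} {P : Fin q → Finset (Fin n)} {c : Fin q → ℝ} {X : Conf n q}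

theorem swDist_le (s : Fin q) : swDist a y B P c X ≤ distS a y B P c X s :=
  ciInf_le (Set.finite_range _).bddBelow s

theorem exists_swDist_eq (hq : 0 < q) : ∃ s, swDist a y B P c X = distS a y B P c X s := by
  have : Nonempty (Fin q) := ⟨⟨0, hq⟩⟩
  obtain ⟨s, hs⟩ := exists_eq_ciInf_of_finite (f := fun s => distS a y B P c X s)
  exact ⟨s, hs.symm⟩

theorem distS_nonneg (hB : 0 ≤ B) (s : Fin q) : 0 ≤ distS a y B P c X s := by
  unfold distS; positivity

theorem swDist_nonneg (hB : 0 ≤ B) : 0 ≤ swDist a y B P c X := Real.iInf_nonneg fun s => distS_nonneg hB s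

theorem projCnt_split {τ : Conf n q} {S : Finset (Fin n)} {g : Fin q} (hg : ∀ v ∈ S, τ v = g)
    (i j : Fin q) : (projCnt P τ i j : ℝ) =
      (if j = g then ((S ∩ P i).card : ℝ) else 0) + noise (P i \ S) j τ +
        ((P i).card - (S ∩ P i).card) / q := by
  have h1 : (P i).filter (fun v => τ v = j) =
      (if j = g then S ∩ P i else ∅) ∪ (P i \ S).filter fun v => τ v = j := by
    ext v
    by_cases hv : v ∈ S
    · split_ifs with h
      · subst h; simp [hv, hg v hv]
      · have : g ≠ j := fun h' => h h'.symm
        simp [hv, hg v hv, this]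
    · split_ifs with h <;> simp [hv]
  have h2 : Disjoint (if j = g then S ∩ P i else ∅) ((P i \ S).filter fun v => τ v = j) := by
    split_ifs
    · rw [disjoint_left]; intro v h1 h2
      exact (mem_sdiff.1 (mem_filter.1 h2).1).2 (mem_inter.1 h1).1
    · exact disjoint_empty_left _
  have h3 : ((P i \ S).card : ℝ) = (P i).card - (S ∩ P i).card := by
    rw [card_sdiff, Nat.cast_sub (card_le_card inter_subset_right)]
  rw [projCnt, h1, card_union_of_disjoint h2, noise, h3]
  push_cast
  split_ifs
  · ring
  · rw [card_empty]; push_cast; ring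

theorem cntN_split {τ : Conf n q} {S : Finset (Fin n)} {g : Fin q} (hg : ∀ v ∈ S, τ v = g)
    (j : Fin q) : (cntN τ j : ℝ) =
      (if j = g then (S.card : ℝ) else 0) + noise Sᶜ j τ + (n - S.card) / q := by
  have := projCnt_split (P := fun _ : Fin q => (univ : Finset (Fin n))) hg j j
  simp only [projCnt, inter_univ, card_univ, Fintype.card_fin, ← compl_eq_univ_sdiff] at this
  exact this

set_option maxHeartbeats 1000000 in
theorem distS_step_le {β r₀ κ x₀ D ρ k₀ : ℝ} (h : StepConsts q β a y r₀ κ x₀ D ρ k₀)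
    (hq : 2 ≤ q) (hβ : 0 < β) (hy : 0 < y) (hy1 : y < 1) (ha : 0 < a)
    (hfix : a = 1 / q + (1 - 1 / q) * y * a)
    (hexp : Real.exp (-(β * a * y)) = 1 - y) (hB : 1 ≤ B) (hn : 1 ≤ n)
    (hc : ∀ i, 0 ≤ c i) (hcn : ∑ i, c i ≤ n) {s : Fin q} (hN : |(cntN X s : ℝ) - a * n| ≤ r₀ * n)
    {S : Finset (Fin n)} (hS : ∀ v ∈ S, X v = s) (hL : κ * n ≤ S.card)
    {τ : Conf n q} {g : Fin q} (hg : ∀ v ∈ S, τ v = g) :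
    distS a y B P (ctrStep y P c) τ g ≤
      (1 - 1 / q) * ∑ i, |(projCnt P X i s : ℝ) - c i| +
      (B * ρ + (3 / (a - r₀) + 2)) * |(cntN X s : ℝ) - a * n| +
      (B / D + (1 / (a - r₀) + 1) * (2 / D) + B + 1) *
        (|(S.card : ℝ) - cntN X s * (1 - Real.exp (-(β / n)) ^ S.card)| +
        ∑ i, |((S ∩ P i).card : ℝ) - S.card * (projCnt P X i s / cntN X s)| +
        (∑ i, |noise (P i \ S) g τ| + ∑ j, |noise Sᶜ j τ|)) := by
  have hn0 : (0 : ℝ) < n := by exact_mod_cast hn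
  have hq2 : (2 : ℝ) ≤ q := by exact_mod_cast hq
  have hq0 : (0 : ℝ) < q := by linarith
  have hD := h.hD
  have hρ1 := h.hρ1
  have hk0 : 0 < a - r₀ := by linarith [h.hr, h.hra]
  set N : ℝ := (cntN X s : ℝ) with hNdef
  set L : ℝ := (S.card : ℝ) with hLdef
  have hNge : (a - r₀) * n ≤ N := by linarith [(abs_le.1 hN).1]
  have hN0 : 0 < N := lt_of_lt_of_le (by positivity) hNge
  have hLN : L ≤ N := by
    have : S.card ≤ cntN X s := card_le_card fun v hv => mem_filter.2 ⟨mem_univ _, hS v hv⟩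
    rw [hLdef, hNdef]; exact_mod_cast this
  have hL0 : 0 ≤ L := Nat.cast_nonneg _
  set k := 1 / (a - r₀) with hk
  have hkpos : 0 < k := by positivity
  have hst := giant_stable h (by omega) hβ hy ha hexp hn0 hN hL
  rw [← exp_pow_div] at hst
  set M := |N - a * n| with hM
  set A := |L - N * (1 - Real.exp (-(β / n)) ^ S.card)| with hA
  set Q := |L - y * a * n| with hQ
  have hM0 : 0 ≤ M := abs_nonneg _
  have hA0 : 0 ≤ A := abs_nonneg _
  have hQ0 : 0 ≤ Q := abs_nonneg _
  have hqi : 1 / (q : ℝ) ≤ 1 / 2 := one_div_le_one_div_of_le (by norm_num) hq2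
  have hqi0 : 0 < 1 / (q : ℝ) := by positivity
  have hQle : Q ≤ 2 * M + 2 / D * A := by
    have h1 : 1 / 2 * Q ≤ (1 - 1 / (q : ℝ)) * Q := by gcongr; linarith
    have h2 : ρ * M ≤ M := by nlinarith
    have h3 : 2 / D * A = 2 * (1 / D * A) := by ring
    linarith
  have hLy : |L / N - y| * ∑ i, c i ≤ k * (Q + M) := by
    have h1 : |L / N - y| = |L - y * N| / N := by
      rw [← abs_of_pos hN0, ← abs_div, abs_of_pos hN0]; congr 1; field_simp
    have h2 : |L - y * N| ≤ Q + M := by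
      have e : L - y * N = (L - y * a * n) - y * (N - a * n) := by ring
      rw [e]
      refine (abs_sub _ _).trans ?_
      rw [abs_mul, abs_of_pos hy]
      nlinarith
    rw [h1]
    calc |L - y * N| / N * ∑ i, c i ≤ (Q + M) / ((a - r₀) * n) * n := by
          have := sum_nonneg (fun i (_ : i ∈ univ) => hc i)
          gcongr
      _ = _ := by rw [hk]; field_simp
  have hone : ∀ i, |(projCnt P τ i g : ℝ) - ctrStep y P c i| ≤
      (1 - 1 / q) * |(projCnt P X i s : ℝ) - c i| + |L / N - y| * c i +
        |((S ∩ P i).card : ℝ) - L * (projCnt P X i s / N)| + |noise (P i \ S) g τ| := by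
    intro i
    rw [projCnt_split hg, if_pos rfl, ctrStep]
    set G : ℝ := ((S ∩ P i).card : ℝ)
    set Di : ℝ := (projCnt P X i s : ℝ)
    have e : G + noise (P i \ S) g τ + ((P i).card - G) / q - ((1 - 1 / q) * y * c i + (P i).card / q) =
        (1 - 1 / q) * (L / N * (Di - c i)) + (1 - 1 / q) * ((L / N - y) * c i) +
          (1 - 1 / q) * (G - L * (Di / N)) + noise (P i \ S) g τ := by
      field_simp; ring
    rw [e]
    have h1 : 0 ≤ 1 - 1 / (q : ℝ) := by linarith
    have h1' : 1 - 1 / (q : ℝ) ≤ 1 := by linarith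
    refine (abs_add_le _ _).trans (add_le_add ((abs_add_le _ _).trans (add_le_add
      ((abs_add_le _ _).trans (add_le_add ?_ ?_)) ?_)) le_rfl)
    · rw [abs_mul, abs_of_nonneg h1, abs_mul, abs_of_nonneg (div_nonneg hL0 hN0.le)]
      gcongr
      exact mul_le_of_le_one_left (abs_nonneg _) ((div_le_one hN0).2 hLN)
    · rw [abs_mul, abs_of_nonneg h1, abs_mul, abs_of_nonneg (hc i)]
      exact mul_le_of_le_one_left (mul_nonneg (abs_nonneg _) (hc i)) h1'
    · rw [abs_mul, abs_of_nonneg h1]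
      exact mul_le_of_le_one_left (abs_nonneg _) h1'
  have hdom : |(cntN τ g : ℝ) - a * n| ≤ ρ * M + 1 / D * A + |noise Sᶜ g τ| := by
    rw [cntN_split hg, if_pos rfl]
    have e : (S.card : ℝ) + noise Sᶜ g τ + (n - S.card) / q - a * n =
        (1 - 1 / q) * (L - y * a * n) + noise Sᶜ g τ := by
      rw [← hLdef]; linear_combination (-n : ℝ) * hfix
    rw [e]
    refine (abs_add_le _ _).trans (add_le_add ?_ le_rfl)
    rw [abs_mul, abs_of_nonneg (by linarith)]
    exact hst
  have hoth : ∀ j ∈ univ.erase g, |(cntN τ j : ℝ) - (1 - y * a) / q * n| ≤ Q / q + |noise Sᶜ j τ| := by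
    intro j hj
    rw [cntN_split hg, if_neg (ne_of_mem_erase hj)]
    have e : 0 + noise Sᶜ j τ + ((n : ℝ) - S.card) / q - (1 - y * a) / q * n =
        -((L - y * a * n) / q) + noise Sᶜ j τ := by
      rw [← hLdef]; ring
    rw [e]
    refine (abs_add_le _ _).trans (add_le_add ?_ le_rfl)
    rw [abs_neg, abs_div, abs_of_pos hq0]
  have h1 := sum_le_sum (s := univ) fun i _ => hone i
  have h2 := sum_le_sum hoth
  simp only [sum_add_distrib, ← mul_sum] at h1 h2
  rw [sum_const, card_erase_of_mem (mem_univ _), card_univ, Fintype.card_fin, nsmul_eq_mul] at h2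
  have h3 : ((q - 1 : ℕ) : ℝ) * (Q / q) ≤ Q := by
    have : ((q - 1 : ℕ) : ℝ) ≤ q := by exact_mod_cast Nat.sub_le _ _
    calc _ ≤ (q : ℝ) * (Q / q) := by gcongr
      _ = Q := by field_simp
  have hsplit : |noise Sᶜ g τ| + ∑ j ∈ univ.erase g, |noise Sᶜ j τ| = ∑ j, |noise Sᶜ j τ| :=
    add_sum_erase univ (fun j => |noise Sᶜ j τ|) (mem_univ g)
  have hne : 0 ≤ ∑ j ∈ univ.erase g, |noise Sᶜ j τ| := sum_nonneg fun _ _ => abs_nonneg _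
  have hg0 : 0 ≤ |noise Sᶜ g τ| := abs_nonneg _
  set H := ∑ i, |((S ∩ P i).card : ℝ) - L * (projCnt P X i s / N)| with hH
  have hH0 : 0 ≤ H := sum_nonneg fun _ _ => abs_nonneg _
  set Z := ∑ i, |noise (P i \ S) g τ| with hZ
  have hZ0 : 0 ≤ Z := sum_nonneg fun _ _ => abs_nonneg _
  set Y := ∑ j, |noise Sᶜ j τ| with hY
  have hY0 : 0 ≤ Y := sum_nonneg fun _ _ => abs_nonneg _
  have hB2 := mul_le_mul_of_nonneg_left hdom (by linarith : 0 ≤ B)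
  unfold distS
  have hBD : 0 < B / D := by positivity
  have hkD : 0 < (k + 1) * (2 / D) := by positivity
  have h3k : 3 / (a - r₀) = 3 * k := by rw [hk]; ring
  rw [h3k]
  have h4 : k * (Q + M) + Q ≤ (3 * k + 2) * M + (k + 1) * (2 / D) * A := by
    have := mul_le_mul_of_nonneg_left hQle (by linarith : 0 ≤ k + 1)
    nlinarith
  have h5 : B * |noise Sᶜ g τ| + ∑ j ∈ univ.erase g, |noise Sᶜ j τ| ≤ B * Y := by
    rw [← hsplit]; nlinarith
  have h6 : (B / D + (k + 1) * (2 / D) + B + 1) * (A + H + (Z + Y)) ≥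
      B / D * A + (k + 1) * (2 / D) * A + H + Z + B * Y := by
    have e : (B / D + (k + 1) * (2 / D) + B + 1) * (A + H + (Z + Y)) -
        (B / D * A + (k + 1) * (2 / D) * A + H + Z + B * Y) =
        (B / D + (k + 1) * (2 / D)) * (H + (Z + Y)) + B * (A + (H + Z)) + (A + Y) := by ring
    have e0 : 0 ≤ (B / D + (k + 1) * (2 / D)) * (H + (Z + Y)) + B * (A + (H + Z)) + (A + Y) :=
      add_nonneg (add_nonneg (mul_nonneg (add_nonneg hBD.le hkD.le)
        (add_nonneg hH0 (add_nonneg hZ0 hY0))) (mul_nonneg (by linarith)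
        (add_nonneg hA0 (add_nonneg hH0 hZ0)))) (add_nonneg hA0 hY0)
    linarith
  have h7 : B * (1 / D * A) = B / D * A := by ring
  have h8 : B * (ρ * M + 1 / D * A + |noise Sᶜ g τ|) = B * ρ * M + B / D * A + B * |noise Sᶜ g τ| := by ring
  rw [h8] at hB2
  have h9 : (B * ρ + (3 * k + 2)) * M = B * ρ * M + (3 * k + 2) * M := by ring
  rw [h9]
  linarith only [h1, h2, h3, h4, h5, h6, hB2, hLy]

end drift

theorem abs_le_add_sq_div {x s : ℝ} (hs : 0 < s) : |x| ≤ s + x ^ 2 / s := by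
  have h : x ^ 2 / s * s = x ^ 2 := div_mul_cancel₀ _ hs.ne'
  have h2 : |x| * s ≤ (s + x ^ 2 / s) * s := by
    rw [add_mul, h, ← sq_abs x]
    nlinarith [sq_nonneg (|x| - s), mul_nonneg (abs_nonneg x) hs.le]
  exact le_of_mul_le_mul_right h2 hs

section drift
variable {n q : ℕ} {a y B : ℝ} {P : Fin q → Finset (Fin n)} {c : Fin q → ℝ} {X : Conf n q}

theorem colE_abs_noise_le {E : Finset (Fin n × Fin n)} (hq : 0 < q) {W S : Finset (Fin n)}
    (hW : W ⊆ Sᶜ) (j : Fin q) {s : ℝ} (hs : 0 < s) :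
    colE q E (fun τ => |noise W j τ|) ≤ s + (∑ u ∈ Sᶜ, ((reach E {u}).card : ℝ)) / s := by
  calc colE q E (fun τ => |noise W j τ|) ≤ colE q E (fun τ => s + s⁻¹ * noise W j τ ^ 2) :=
        colE_mono fun τ _ => by
          have := abs_le_add_sq_div (x := noise W j τ) hs
          rwa [div_eq_inv_mul] at this
    _ = s + s⁻¹ * colE q E (fun τ => noise W j τ ^ 2) := by
        rw [colE_add, colE_const hq, colE_mul_left]
    _ ≤ s + s⁻¹ * ∑ u ∈ Sᶜ, ((reach E {u}).card : ℝ) := by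
        have h1 := colE_noise_sq_le (E := E) hq W j
        have h2 : ∑ u ∈ W, ((reach E {u}).card : ℝ) ≤ ∑ u ∈ Sᶜ, ((reach E {u}).card : ℝ) :=
          sum_le_sum_of_subset_of_nonneg hW fun _ _ _ => Nat.cast_nonneg _
        have h3 : colE q E (fun τ => noise W j τ ^ 2) ≤ ∑ u ∈ Sᶜ, ((reach E {u}).card : ℝ) := h1.trans h2
        gcongr
    _ = _ := by ring

set_option maxHeartbeats 1000000 in
theorem colE_swDist_le {β r₀ κ x₀ D ρ k₀ ρ₁ C : ℝ} (h : StepConsts q β a y r₀ κ x₀ D ρ k₀)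
    (hq : 2 ≤ q) (hβ : 0 < β) (hy : 0 < y) (hy1 : y < 1) (ha : 0 < a)
    (hfix : a = 1 / q + (1 - 1 / q) * y * a)
    (hexp : Real.exp (-(β * a * y)) = 1 - y) (hB : 1 ≤ B)
    (hρq : 1 - 1 / (q : ℝ) ≤ ρ₁) (hρ0 : 0 ≤ ρ₁) (hBρ : B * ρ + (3 / (a - r₀) + 2) ≤ ρ₁ * B)
    (hC : C = (B / D + (1 / (a - r₀) + 1) * (2 / D) + B + 1))
    (hn : 1 ≤ n)
    (hc : ∀ i, 0 ≤ c i) (hcn : ∑ i, c i ≤ n) {s : Fin q} (hN : |(cntN X s : ℝ) - a * n| ≤ r₀ * n)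
    {S : Finset (Fin n)} (hS : S ∈ wsets κ X s) {E : Finset (Fin n × Fin n)} (hE : IsCompOf E S) :
    colE q E (swDist a y B P (ctrStep y P c)) ≤ ρ₁ * distS a y B P c X s +
      C * (1 + q) ^ 2 * (Real.sqrt n * (1 + errPsi β P X s E S / n)) := by
  have hn0 : (0 : ℝ) < n := by exact_mod_cast hn
  have hq0 : 0 < q := by omega
  have hsq : 0 < Real.sqrt n := Real.sqrt_pos.2 hn0
  have hk0 : 0 < a - r₀ := by linarith [h.hr, h.hra]
  have hD := h.hD
  have hCpos : 0 < C := by rw [hC]; positivity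
  set w := Real.sqrt n with hw
  have hww : w * w = n := Real.mul_self_sqrt hn0.le
  obtain ⟨hS1, hS2⟩ := mem_filter.1 hS
  have hSs : ∀ v ∈ S, X v = s := fun v hv => (mem_filter.1 ((mem_powerset.1 hS1) hv)).2
  obtain ⟨v₀, hv₀⟩ := hE.1
  set A := |(S.card : ℝ) - cntN X s * (1 - Real.exp (-(β / n)) ^ S.card)| with hA
  set H := ∑ i, |((S ∩ P i).card : ℝ) - S.card * (projCnt P X i s / cntN X s)| with hH
  have hpt : ∀ τ : Conf n q, (∀ u v, (graphOf E).Reachable u v → τ u = τ v) →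
      swDist a y B P (ctrStep y P c) τ ≤ (ρ₁ * distS a y B P c X s + C * (A + H)) +
        C * (∑ i, ∑ j, |noise (P i \ S) j τ| + ∑ j, |noise Sᶜ j τ|) := by
    intro τ hτ
    have hg : ∀ v ∈ S, τ v = τ v₀ := by
      intro v hv
      refine hτ v v₀ ?_
      have := hE.2 v hv
      rw [← this] at hv₀
      obtain ⟨b, hb, hr⟩ := mem_reach.1 hv₀
      rwa [mem_singleton.1 hb] at hr
    refine (swDist_le (τ v₀)).trans ?_
    refine (distS_step_le h hq hβ hy hy1 ha hfix hexp hB hn hc hcn hN hSs hS2 hg).trans ?_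
    rw [← hC, ← hA, ← hH]
    have h1 : ∑ i, |noise (P i \ S) (τ v₀) τ| ≤ ∑ i, ∑ j, |noise (P i \ S) j τ| :=
      sum_le_sum fun i _ => single_le_sum (f := fun j => |noise (P i \ S) j τ|)
        (fun _ _ => abs_nonneg _) (mem_univ (τ v₀))
    have h2 : (1 - 1 / (q : ℝ)) * ∑ i, |(projCnt P X i s : ℝ) - c i| ≤
        ρ₁ * ∑ i, |(projCnt P X i s : ℝ) - c i| := by
      gcongr
    have h3 := mul_le_mul_of_nonneg_right hBρ (abs_nonneg ((cntN X s : ℝ) - a * n))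
    have h4 : 0 ≤ ρ₁ * ∑ j ∈ univ.erase s, |(cntN X j : ℝ) - (1 - y * a) / q * n| :=
      mul_nonneg hρ0 (sum_nonneg fun _ _ => abs_nonneg _)
    have h5 : ρ₁ * distS a y B P c X s = ρ₁ * ∑ i, |(projCnt P X i s : ℝ) - c i| +
        ρ₁ * B * |(cntN X s : ℝ) - a * n| +
        ρ₁ * ∑ j ∈ univ.erase s, |(cntN X j : ℝ) - (1 - y * a) / q * n| := by unfold distS; ring
    have h6 := mul_le_mul_of_nonneg_left h1 hCpos.le
    rw [h5, mul_add, mul_add, mul_add, mul_add]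
    linarith
  refine (colE_mono hpt).trans ?_
  rw [colE_add, colE_const hq0, colE_mul_left, colE_add, colE_sum, colE_sum]
  simp only [colE_sum]
  set χ := ∑ u ∈ Sᶜ, ((reach E {u}).card : ℝ) with hχ
  have hχ0 : 0 ≤ χ := sum_nonneg fun _ _ => Nat.cast_nonneg _
  have hno1 : ∑ i, ∑ j, colE q E (fun τ => |noise (P i \ S) j τ|) ≤ q * (q * (w + χ / w)) := by
    calc _ ≤ ∑ i : Fin q, ∑ j : Fin q, (w + χ / w) := sum_le_sum fun i _ => sum_le_sum fun j _ =>
          colE_abs_noise_le hq0 (fun v hv => mem_compl.2 (mem_sdiff.1 hv).2) j hsq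
      _ = _ := by simp; ring
  have hno2 : ∑ j, colE q E (fun τ => |noise Sᶜ j τ|) ≤ q * (w + χ / w) := by
    calc _ ≤ ∑ j : Fin q, (w + χ / w) := sum_le_sum fun j _ => colE_abs_noise_le hq0 subset_rfl j hsq
      _ = _ := by simp; ring
  set A2 := ((S.card : ℝ) - cntN X s * (1 - Real.exp (-(β / n)) ^ S.card)) ^ 2 with hA2
  set H2 := ∑ i, (((S ∩ P i).card : ℝ) - S.card * (projCnt P X i s / cntN X s)) ^ 2 with hH2
  have hAle : A ≤ w + A2 / w := abs_le_add_sq_div hsq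
  have hHle : H ≤ q * w + H2 / w := by
    calc H ≤ ∑ i : Fin q, (w + (((S ∩ P i).card : ℝ) - S.card * (projCnt P X i s / cntN X s)) ^ 2 / w) :=
          sum_le_sum fun i _ => abs_le_add_sq_div hsq
      _ = _ := by rw [sum_add_distrib, ← sum_div, ← hH2]; simp
  have hA20 : 0 ≤ A2 := sq_nonneg _
  have hH20 : 0 ≤ H2 := sum_nonneg fun _ _ => sq_nonneg _
  have herr : errPsi β P X s E S = A2 + H2 + χ := rfl
  have hfin : w * (1 + errPsi β P X s E S / n) = w + A2 / w + H2 / w + χ / w := by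
    rw [herr, ← hww]; field_simp; ring
  rw [hfin]
  have hsum : A + H + (∑ i, ∑ j, colE q E (fun τ => |noise (P i \ S) j τ|) +
      ∑ j, colE q E (fun τ => |noise Sᶜ j τ|)) ≤ (1 + q) ^ 2 * (w + A2 / w + H2 / w + χ / w) := by
    have e1 : 0 ≤ A2 / w := div_nonneg hA20 hsq.le
    have e2 : 0 ≤ H2 / w := div_nonneg hH20 hsq.le
    have e3 : 0 ≤ χ / w := div_nonneg hχ0 hsq.le
    have e4 : (0 : ℝ) ≤ q := Nat.cast_nonneg q
    have e5 := mul_nonneg e4 e1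
    have e6 := mul_nonneg e4 e2
    have e7 := mul_nonneg e4 e3
    have e8 := mul_nonneg e4 e5
    have e9 := mul_nonneg e4 e6
    have e10 := mul_nonneg e4 hsq.le
    linarith
  have := mul_le_mul_of_nonneg_left hsum hCpos.le
  linarith

theorem swDist_le_const (hq : 0 < q) (hB : 0 ≤ B) (ha0 : 0 ≤ a) (ha1 : a ≤ 1) (hy0 : 0 ≤ y) (hy1 : y ≤ 1)
    (hc : ∀ i, 0 ≤ c i) (hcP : ∀ i, c i ≤ (P i).card) (hP : ∑ i, ((P i).card : ℝ) ≤ n) :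
    swDist a y B P c X ≤ (1 + B + q) * n := by
  have hn0 : (0 : ℝ) ≤ n := Nat.cast_nonneg n
  have hq1 : (1 : ℝ) ≤ q := by exact_mod_cast hq
  have habs : ∀ u v z : ℝ, 0 ≤ u → u ≤ z → 0 ≤ v → v ≤ z → |u - v| ≤ z := fun u v z h1 h2 h3 h4 =>
    abs_le.2 ⟨by linarith, by linarith⟩
  have hcnt : ∀ j, (cntN X j : ℝ) ≤ n := fun j => by exact_mod_cast cntN_le X j
  refine (swDist_le ⟨0, hq⟩).trans ?_
  unfold distS
  have h1 : ∑ i, |(projCnt P X i ⟨0, hq⟩ : ℝ) - c i| ≤ n :=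
    (sum_le_sum fun i _ => habs _ _ ((P i).card : ℝ) (Nat.cast_nonneg _)
      (by exact_mod_cast card_filter_le _ _) (hc i) (hcP i)).trans hP
  have h2 : |(cntN X ⟨0, hq⟩ : ℝ) - a * n| ≤ n := habs _ _ _ (Nat.cast_nonneg _) (hcnt _)
    (by positivity) (by nlinarith)
  have hya : y * a ≤ 1 := mul_le_one₀ hy1 ha0 ha1
  have hb : (1 - y * a) / q ≤ 1 := by
    rw [div_le_one (by linarith)]
    have := mul_nonneg hy0 ha0
    linarith
  have hb0 : 0 ≤ (1 - y * a) / q := div_nonneg (by linarith) (by linarith)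
  have h3 : ∑ j ∈ univ.erase ⟨0, hq⟩, |(cntN X j : ℝ) - (1 - y * a) / q * n| ≤ q * n := by
    refine (sum_le_sum (g := fun _ => (n : ℝ)) fun j _ => habs _ _ _ (Nat.cast_nonneg _) (hcnt _)
      (by positivity) (by nlinarith)).trans ?_
    rw [sum_const, card_erase_of_mem (mem_univ _), card_univ, Fintype.card_fin, nsmul_eq_mul]
    gcongr
    exact_mod_cast Nat.sub_le _ _
  have h4 := mul_le_mul_of_nonneg_left h2 hB
  linarith

theorem ctrStep_mem (hq : 1 ≤ q) (hy0 : 0 ≤ y) (hy1 : y ≤ 1) (hc : ∀ i, 0 ≤ c i)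
    (hcP : ∀ i, c i ≤ (P i).card) (i : Fin q) :
    0 ≤ ctrStep y P c i ∧ ctrStep y P c i ≤ (P i).card := by
  have hq1 : (1 : ℝ) ≤ q := by exact_mod_cast hq
  have h1 : 1 / (q : ℝ) ≤ 1 := by rw [div_le_one (by linarith)]; exact hq1
  have h0 : 0 ≤ 1 - 1 / (q : ℝ) := by linarith
  have := hc i
  unfold ctrStep
  constructor
  · positivity
  · calc (1 - 1 / (q : ℝ)) * y * c i + (P i).card / q ≤ (1 - 1 / (q : ℝ)) * 1 * (P i).card + (P i).card / q := by
          gcongr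
          exact hcP i
      _ = _ := by ring

set_option maxHeartbeats 1000000 in
theorem exists_drift {β r₀ κ x₀ D ρ k₀ : ℝ} (h : StepConsts q β a y r₀ κ x₀ D ρ k₀)
    (hq : 2 ≤ q) (hβ : 0 < β) (hy : 0 < y) (hy1 : y < 1) (ha : 0 < a) (ha1 : a ≤ 1)
    (hfix : a = 1 / q + (1 - 1 / q) * y * a)
    (hexp : Real.exp (-(β * a * y)) = 1 - y) :
    ∃ B ρ₁ C : ℝ, 1 ≤ B ∧ 0 ≤ ρ₁ ∧ ρ₁ < 1 ∧ 0 < C ∧ ∀ n : ℕ, 1 ≤ n → ∀ (P : Fin q → Finset (Fin n))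
      (c : Fin q → ℝ) (X : Conf n q), ∑ i, ((P i).card : ℝ) ≤ n → (∀ i, 0 ≤ c i) →
      (∀ i, c i ≤ (P i).card) → swDist a y B P c X ≤ r₀ * n →
      ∑ τ, swStep n q β X τ * swDist a y B P (ctrStep y P c) τ ≤
        ρ₁ * swDist a y B P c X + C * Real.sqrt n := by
  have hq2 : (2 : ℝ) ≤ q := by exact_mod_cast hq
  have hρ1 := h.hρ1
  have hρ := h.hρ
  have hk0 : 0 < a - r₀ := by linarith [h.hr, h.hra]
  have hD := h.hD
  obtain ⟨C₁, hC₁, hwin⟩ := bex_window_le h hβ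
  obtain ⟨C₂, hC₂, hnow⟩ := bex_nowindow_le h hβ
  set ρ₁ := max (1 - 1 / (q : ℝ)) ((1 + ρ) / 2) with hρ₁
  have hρ₁0 : 0 < ρ₁ := lt_of_lt_of_le (by linarith) (le_max_right _ _)
  have hρ₁1 : ρ₁ < 1 := by
    apply max_lt
    · have : 0 < 1 / (q : ℝ) := by positivity
      linarith
    · linarith
  set k := 3 / (a - r₀) + 2 with hk
  have hkpos : 0 < k := by positivity
  set B := 1 + 2 * k / (1 - ρ) with hB
  have hB1 : 1 ≤ B := by
    have : 0 ≤ 2 * k / (1 - ρ) := div_nonneg (by linarith) (by linarith)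
    linarith
  have hBρ : B * ρ + k ≤ ρ₁ * B := by
    have h1 : (1 + ρ) / 2 ≤ ρ₁ := le_max_right _ _
    have h2 : k ≤ (1 - ρ) / 2 * B := by
      have : (1 - ρ) / 2 * (2 * k / (1 - ρ)) = k := by
        have : 1 - ρ ≠ 0 := by linarith
        field_simp
      rw [hB, mul_add, this]; linarith
    nlinarith
  set C := (B / D + (1 / (a - r₀) + 1) * (2 / D) + B + 1) with hC
  have hCpos : 0 < C := by positivity
  refine ⟨B, ρ₁, C * (1 + q) ^ 2 * C₁ + (1 + B + q) * C₂, hB1, hρ₁0.le, hρ₁1, by positivity, ?_⟩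
  intro n hn P c X hP hc hcP hV
  have hn0 : (0 : ℝ) < n := by exact_mod_cast hn
  have hsq : 0 < Real.sqrt n := Real.sqrt_pos.2 hn0
  have hww : Real.sqrt n * Real.sqrt n = n := Real.mul_self_sqrt hn0.le
  obtain ⟨hr0, hr1, -⟩ := exp_neg_div_bounds hβ n
  obtain ⟨s, hs⟩ := exists_swDist_eq (a := a) (y := y) (B := B) (P := P) (c := c) (X := X) (by omega : 0 < q)
  have hd := hV
  rw [hs, distS] at hd
  have hp1 : 0 ≤ ∑ i, |(projCnt P X i s : ℝ) - c i| := sum_nonneg fun _ _ => abs_nonneg _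
  have hp2 : 0 ≤ |(cntN X s : ℝ) - a * n| := abs_nonneg _
  have hp3 : 0 ≤ ∑ j ∈ univ.erase s, |(cntN X j : ℝ) - (1 - y * a) / q * n| :=
    sum_nonneg fun _ _ => abs_nonneg _
  have hp4 : |(cntN X s : ℝ) - a * n| ≤ B * |(cntN X s : ℝ) - a * n| := le_mul_of_one_le_left hp2 hB1
  have hN : |(cntN X s : ℝ) - a * n| ≤ r₀ * n := by linarith
  have hoth : ∀ j, j ≠ s → |(cntN X j : ℝ) - (1 - y * a) / q * n| ≤ r₀ * n := by
    intro j hj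
    have := single_le_sum (f := fun j => |(cntN X j : ℝ) - (1 - y * a) / q * n|)
      (fun _ _ => abs_nonneg _) (mem_erase.2 ⟨hj, mem_univ j⟩)
    linarith
  have hNge : (a - r₀) * n ≤ cntN X s := by linarith [(abs_le.1 hN).1]
  have hcn : ∑ i, c i ≤ n := (sum_le_sum fun i _ => hcP i).trans hP
  have hV0 : 0 ≤ swDist a y B P c X := swDist_nonneg (by linarith)
  have hc' := ctrStep_mem (P := P) (by omega : 1 ≤ q) hy.le hy1.le hc hcP
  set K := C * (1 + q) ^ 2 with hK
  have hKpos : 0 < K := by positivity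
  rw [sum_swStep]
  have hpt : ∀ E ⊆ monoPairs X, colE q E (swDist a y B P (ctrStep y P c)) ≤
      ρ₁ * swDist a y B P c X + (K * Real.sqrt n * (∑ S ∈ wsets κ X s,
        if IsCompOf E S then 1 + errPsi β P X s E S / n else 0) + ((1 + B + q) * n) *
        (if ∀ S ∈ wsets κ X s, ¬ IsCompOf E S then 1 else 0)) := by
    intro E hE
    have hnn : ∀ S ∈ wsets κ X s, (0 : ℝ) ≤ if IsCompOf E S then 1 + errPsi β P X s E S / n else 0 := by
      intro S _
      split_ifs
      · have := div_nonneg (errPsi_nonneg (β := β) (P := P) (σ := X) (s := s) (E := E) (S := S)) hn0.le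
        linarith
      · exact le_rfl
    by_cases hcase : ∀ S ∈ wsets κ X s, ¬ IsCompOf E S
    · rw [if_pos hcase, mul_one]
      have h1 : colE q E (swDist a y B P (ctrStep y P c)) ≤ (1 + B + q) * n := by
        rw [← colE_const (E := E) (n := n) (by omega : 0 < q) ((1 + B + q) * (n : ℝ))]
        exact colE_mono fun τ _ => swDist_le_const (by omega) (by linarith) ha.le ha1 hy.le hy1.le
          (fun i => (hc' i).1) (fun i => (hc' i).2) hP
      have h2 := mul_nonneg hρ₁0.le hV0
      have h3 := mul_nonneg (mul_nonneg hKpos.le hsq.le) (sum_nonneg hnn)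
      linarith
    · rw [if_neg hcase, mul_zero, add_zero]
      push Not at hcase
      obtain ⟨S, hS, hES⟩ := hcase
      have h1 := colE_swDist_le (P := P) (c := c) (X := X) h hq hβ hy hy1 ha hfix hexp hB1 (le_max_left _ _) hρ₁0.le
        hBρ hC hn hc hcn hN hS hES
      rw [hs]
      refine h1.trans ?_
      have h2 := single_le_sum hnn hS
      rw [if_pos hES] at h2
      rw [← mul_assoc]
      have := mul_le_mul_of_nonneg_left h2 (mul_nonneg hKpos.le hsq.le)
      linarith
  refine (bex_mono hr0 hr1 hpt).trans ?_
  rw [bex_add, bex_const, bex_add, bex_mul_left, bex_mul_left]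
  have h1 := hwin n hn P X s hN hoth
  have h2 := hnow n hn X s hNge
  have h3 := mul_le_mul_of_nonneg_left h1 (mul_nonneg hKpos.le hsq.le)
  have h4 := mul_le_mul_of_nonneg_left h2 (show 0 ≤ (1 + B + q) * (n : ℝ) by positivity)
  have h5 : (1 + B + q) * (n : ℝ) * (C₂ / Real.sqrt n) = (1 + B + q) * C₂ * Real.sqrt n := by
    rw [← hww, Real.sqrt_mul_self hsq.le]; field_simp
  rw [h5] at h4
  linarith

end drift

/-- Configurations agreeing with `τ` off `A` and having `t j` vertices of colour `j` in `A`. -/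
noncomputable def colorings {n q : ℕ} (A : Finset (Fin n)) (τ : Conf n q) (t : Fin q → ℕ) :
    Finset (Conf n q) :=
  univ.filter fun c => (∀ v, v ∉ A → c v = τ v) ∧ ∀ j, (A.filter fun v => c v = j).card = t j

theorem card_colorings_mul {n q : ℕ} (A : Finset (Fin n)) (τ : Conf n q) (t : Fin q → ℕ)
    (ht : ∑ j, t j = A.card) :
    (colorings A τ t).card * ∏ j, (t j).factorial = A.card.factorial := by
  induction A using Finset.induction_on generalizing τ t with
  | empty =>
    have h0 : ∀ j, t j = 0 := fun j => by simpa using (sum_eq_zero_iff.1 (by simpa using ht)) j (mem_univ j)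
    have : colorings ∅ τ t = {τ} := by
      ext c
      simp only [colorings, mem_filter, mem_univ, true_and, notMem_empty, not_false_eq_true, forall_const,
        filter_empty, card_empty, mem_singleton, h0, implies_true, and_true]
      exact funext_iff.symm
    simp [this, h0]
  | insert v A hv ih =>
    have hcard : ∀ (c : Conf n q) k, ((insert v A).filter fun u => c u = k).card =
        (if c v = k then 1 else 0) + (A.filter fun u => c u = k).card := by
      intro c k
      rw [filter_insert]
      split_ifs with hk
      · rw [card_insert_of_notMem (fun h => hv (mem_filter.1 h).1), add_comm]
      · simp
    have hfib : ∀ j, ((colorings (insert v A) τ t).filter fun c => c v = j).card * ∏ k, (t k).factorial =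
        t j * A.card.factorial := by
      intro j
      rcases Nat.eq_zero_or_pos (t j) with h0 | hpos
      · rw [h0, zero_mul]
        have : (colorings (insert v A) τ t).filter (fun c => c v = j) = ∅ := by
          rw [filter_eq_empty_iff]
          intro c hc hcv
          have := (mem_filter.1 hc).2.2 j
          rw [hcard, if_pos hcv, h0] at this
          omega
        rw [this, card_empty, zero_mul]
      · have hset : (colorings (insert v A) τ t).filter (fun c => c v = j) =
            colorings A (Function.update τ v j) (Function.update t j (t j - 1)) := by
          ext c
          simp only [colorings, mem_filter, mem_univ, true_and]
          constructor
          · rintro ⟨⟨h1, h2⟩, h3⟩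
            refine ⟨fun u hu => ?_, fun k => ?_⟩
            · by_cases huv : u = v
              · subst huv; simp [h3]
              · rw [Function.update_of_ne huv]; exact h1 u (by simp [huv, hu])
            · have := h2 k
              rw [hcard, h3] at this
              by_cases hk : k = j
              · subst hk; rw [Function.update_self]; rw [if_pos rfl] at this; omega
              · rw [Function.update_of_ne hk]; rw [if_neg (Ne.symm hk)] at this; omega
          · rintro ⟨h1, h2⟩
            have h3 : c v = j := by have := h1 v hv; rwa [Function.update_self] at this
            refine ⟨⟨fun u hu => ?_, fun k => ?_⟩, h3⟩
            · rw [mem_insert, not_or] at hu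
              have := h1 u hu.2
              rwa [Function.update_of_ne hu.1] at this
            · have := h2 k
              rw [hcard, h3]
              by_cases hk : k = j
              · subst hk; rw [Function.update_self] at this; rw [if_pos rfl]; omega
              · rw [Function.update_of_ne hk] at this; rw [if_neg (Ne.symm hk)]; omega
        have hprod : ∏ k, (t k).factorial =
            t j * ∏ k, (Function.update t j (t j - 1) k).factorial := by
          rw [← mul_prod_erase univ _ (mem_univ j),
            ← mul_prod_erase univ (fun k => (Function.update t j (t j - 1) k).factorial) (mem_univ j),
            Function.update_self, ← mul_assoc, Nat.mul_factorial_pred hpos.ne']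
          congr 1
          refine prod_congr rfl fun k hk => ?_
          rw [Function.update_of_ne (ne_of_mem_erase hk)]
        have hsum : ∑ k, Function.update t j (t j - 1) k = A.card := by
          rw [card_insert_of_notMem hv, ← add_sum_erase univ _ (mem_univ j)] at ht
          rw [← add_sum_erase univ _ (mem_univ j), Function.update_self]
          have : ∑ k ∈ univ.erase j, Function.update t j (t j - 1) k = ∑ k ∈ univ.erase j, t k :=
            sum_congr rfl fun k hk => Function.update_of_ne (ne_of_mem_erase hk) _ _
          omega
        rw [hset, hprod, mul_left_comm, ih _ _ hsum]
    rw [card_eq_sum_card_fiberwise (f := fun c : Conf n q => c v) (t := univ) (fun _ _ => mem_univ _),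
      sum_mul, sum_congr rfl fun j _ => hfib j, ← sum_mul, ht, card_insert_of_notMem hv,
      Nat.factorial_succ]

theorem multinomial_lower {q : ℕ} (hq : 1 ≤ q) {A : ℕ} (hA : 1 ≤ A) {t : Fin q → ℕ} (ht : ∑ j, t j = A)
    (ht1 : ∀ j, 1 ≤ t j) {Δ : ℝ} (hΔ : ∑ j, ((t j : ℝ) - A / q) ^ 2 ≤ Δ * A) :
    Real.exp (-(q * (Δ + 1))) * q ^ A / Real.sqrt A ^ (q - 1) ≤ (A.factorial : ℝ) / ∏ j, ((t j).factorial : ℝ) := by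
  have hA0 : (0 : ℝ) < A := by exact_mod_cast hA
  have hq0 : (0 : ℝ) < q := by exact_mod_cast hq
  have hsA : 0 < Real.sqrt A := Real.sqrt_pos.2 hA0
  have ht0 : ∀ j, (0 : ℝ) < t j := fun j => by exact_mod_cast ht1 j
  have htA : ∀ j, t j ≤ A := fun j => ht ▸ single_le_sum (fun _ _ => Nat.zero_le _) (mem_univ j)
  have htR : ∑ j, (t j : ℝ) = A := by exact_mod_cast ht
  have hst : Real.sqrt A * (A / Real.exp 1) ^ A ≤ (A.factorial : ℝ) := by
    refine le_trans ?_ (Stirling.le_factorial_stirling A)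
    refine mul_le_mul_of_nonneg_right (Real.sqrt_le_sqrt ?_) (by positivity)
    nlinarith [Real.pi_gt_three]
  have hup : ∀ j, ((t j).factorial : ℝ) ≤
      Real.exp 1 * Real.sqrt A * ((A / q / Real.exp 1) ^ t j * Real.exp (t j * (q * t j / A - 1))) := by
    intro j
    refine (factorial_le_stirling (ht1 j)).trans ?_
    refine mul_le_mul (mul_le_mul_of_nonneg_left (Real.sqrt_le_sqrt (by exact_mod_cast htA j))
      (Real.exp_pos 1).le) ?_ (by positivity) (by positivity)
    have h1 : (t j : ℝ) / Real.exp 1 = (A / q / Real.exp 1) * (q * t j / A) := by field_simp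
    rw [h1, mul_pow]
    refine mul_le_mul_of_nonneg_left ?_ (by positivity)
    rw [Real.exp_nat_mul]
    refine pow_le_pow_left₀ (by positivity) ?_ _
    have := Real.add_one_le_exp (q * (t j : ℝ) / A - 1)
    linarith
  have hprod : ∏ j, ((t j).factorial : ℝ) ≤
      (Real.exp 1 * Real.sqrt A) ^ q * ((A / q / Real.exp 1) ^ A * Real.exp (q * Δ)) := by
    refine (prod_le_prod (fun j _ => by positivity) fun j _ => hup j).trans ?_
    rw [prod_mul_distrib, prod_const, card_univ, Fintype.card_fin, prod_mul_distrib, prod_pow_eq_pow_sum, ht,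
      ← Real.exp_sum]
    refine mul_le_mul_of_nonneg_left (mul_le_mul_of_nonneg_left (Real.exp_le_exp.2 ?_) (by positivity))
      (by positivity)
    have h2 : ∑ j, ((t j : ℝ) - A / q) ^ 2 = ∑ j, (t j : ℝ) ^ 2 - A ^ 2 / q := by
      have e : ∀ j : Fin q, ((t j : ℝ) - A / q) ^ 2 = (t j : ℝ) ^ 2 - 2 * (A / q) * t j + (A / q) ^ 2 :=
        fun j => by ring
      simp only [e]
      rw [sum_add_distrib, sum_sub_distrib, ← mul_sum, htR, sum_const, card_univ, Fintype.card_fin,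
        nsmul_eq_mul]
      field_simp; ring
    have h3 : ∑ j, (t j : ℝ) * (q * t j / A - 1) = q / A * ∑ j, ((t j : ℝ) - A / q) ^ 2 := by
      have e : ∀ j : Fin q, (t j : ℝ) * (q * t j / A - 1) = q / A * (t j : ℝ) ^ 2 - t j :=
        fun j => by field_simp
      simp only [e]
      rw [sum_sub_distrib, ← mul_sum, htR, h2]
      field_simp
    rw [h3]
    calc q / A * ∑ j, ((t j : ℝ) - A / q) ^ 2 ≤ q / A * (Δ * A) := by gcongr
      _ = q * Δ := by field_simp
  have hppos : 0 < ∏ j, ((t j).factorial : ℝ) := prod_pos fun j _ => by positivity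
  rw [le_div_iff₀ hppos]
  refine (mul_le_mul_of_nonneg_left hprod (by positivity)).trans ((le_of_eq ?_).trans hst)
  obtain ⟨k, rfl⟩ : ∃ k, q = k + 1 := ⟨q - 1, by omega⟩
  have hexp : Real.exp (-(((k + 1 : ℕ) : ℝ) * (Δ + 1))) * Real.exp (((k + 1 : ℕ) : ℝ) * Δ) * Real.exp 1 ^ (k + 1) = 1 := by
    rw [← Real.exp_nat_mul, ← Real.exp_add, ← Real.exp_add, Real.exp_eq_one_iff]
    ring
  have hqA : (((k + 1 : ℕ) : ℝ)) ^ A * (A / ((k + 1 : ℕ) : ℝ) / Real.exp 1) ^ A = (A / Real.exp 1) ^ A := by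
    rw [← mul_pow]; congr 1; field_simp
  rw [Nat.add_sub_cancel, div_mul_eq_mul_div, div_eq_iff (by positivity), mul_pow, pow_succ (Real.sqrt A),
    ← hqA]
  linear_combination (((k + 1 : ℕ) : ℝ)) ^ A * (A / ((k + 1 : ℕ) : ℝ) / Real.exp 1) ^ A *
    (Real.sqrt A ^ k * Real.sqrt A) * hexp

theorem card_colorings_lower {n q : ℕ} (hq : 1 ≤ q) {A : Finset (Fin n)} (hA : 1 ≤ A.card) (τ : Conf n q)
    {t : Fin q → ℕ} (ht : ∑ j, t j = A.card) (ht1 : ∀ j, 1 ≤ t j) {Δ : ℝ}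
    (hΔ : ∑ j, ((t j : ℝ) - A.card / q) ^ 2 ≤ Δ * A.card) :
    Real.exp (-(q * (Δ + 1))) / Real.sqrt n ^ (q - 1) * q ^ A.card ≤ ((colorings A τ t).card : ℝ) := by
  have hA0 : (0 : ℝ) < A.card := by exact_mod_cast hA
  have h1 := multinomial_lower hq hA ht ht1 hΔ
  have h2 := card_colorings_mul A τ t ht
  have hppos : 0 < ∏ j, ((t j).factorial : ℝ) := prod_pos fun j _ => by positivity
  have h3 : ((A.card.factorial : ℕ) : ℝ) / ∏ j, ((t j).factorial : ℝ) = (colorings A τ t).card := by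
    rw [div_eq_iff hppos.ne', ← h2]; push_cast; rfl
  rw [h3] at h1
  refine le_trans ?_ h1
  rw [div_mul_eq_mul_div]
  have hn : (A.card : ℝ) ≤ n := by
    have := card_le_univ A
    rw [Fintype.card_fin] at this
    exact_mod_cast this
  have := Real.sqrt_pos.2 hA0
  gcongr

/-- Configurations agreeing with `τ` off the classes `I i`, `i ∈ J`, with prescribed colour counts. -/
noncomputable def colorFam {n q : ℕ} (J : Finset (Fin q)) (I : Fin q → Finset (Fin n)) (τ : Conf n q)
    (t : Fin q → Fin q → ℕ) : Finset (Conf n q) :=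
  univ.filter fun c => (∀ v, (∀ i ∈ J, v ∉ I i) → c v = τ v) ∧
    ∀ i ∈ J, ∀ j, ((I i).filter fun v => c v = j).card = t i j

theorem card_colorFam_lower {n q : ℕ} {I : Fin q → Finset (Fin n)} (hI : ∀ i j, i ≠ j → Disjoint (I i) (I j))
    {t : Fin q → Fin q → ℕ} {L : Fin q → ℝ} (hL : ∀ i, 0 ≤ L i)
    (h : ∀ i τ, L i ≤ ((colorings (I i) τ (t i)).card : ℝ)) (J : Finset (Fin q)) (τ : Conf n q) :
    ∏ i ∈ J, L i ≤ ((colorFam J I τ t).card : ℝ) := by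
  induction J using Finset.induction_on with
  | empty =>
    have : colorFam ∅ I τ t = {τ} := by
      ext c
      simp [colorFam, funext_iff]
    simp [this]
  | insert i J hi ih =>
    rw [prod_insert hi]
    have hsub : (colorFam J I τ t).biUnion (fun c => colorings (I i) c (t i)) ⊆ colorFam (insert i J) I τ t := by
      intro c' hc'
      obtain ⟨c, hc, hcc⟩ := mem_biUnion.1 hc'
      have hc := (mem_filter.1 hc).2
      have hcc := (mem_filter.1 hcc).2
      refine mem_filter.2 ⟨mem_univ _, fun v hv => ?_, fun k hk j => ?_⟩
      · rw [hcc.1 v (hv i (mem_insert_self _ _)), hc.1 v fun k hk => hv k (mem_insert_of_mem hk)]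
      · rcases mem_insert.1 hk with rfl | hk
        · exact hcc.2 j
        · rw [← hc.2 k hk j]
          congr 1
          refine filter_congr fun v hv => ?_
          rw [hcc.1 v fun hvi => disjoint_left.1 (hI k i fun hki => hi (hki ▸ hk)) hv hvi]
    have hdisj : ∀ c ∈ colorFam J I τ t, ∀ d ∈ colorFam J I τ t, c ≠ d →
        Disjoint (colorings (I i) c (t i)) (colorings (I i) d (t i)) := by
      intro c hc d hd hcd
      rw [disjoint_left]
      intro c' h1 h2
      apply hcd
      funext v
      have hc := (mem_filter.1 hc).2.1
      have hd := (mem_filter.1 hd).2.1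
      by_cases hv : v ∈ I i
      · have hJ : ∀ k ∈ J, v ∉ I k := fun k hk hvk =>
          disjoint_left.1 (hI k i fun hki => hi (hki ▸ hk)) hvk hv
        rw [hc v hJ, hd v hJ]
      · rw [← (mem_filter.1 h1).2.1 v hv, ← (mem_filter.1 h2).2.1 v hv]
    have hcard := card_le_card hsub
    rw [card_biUnion hdisj] at hcard
    calc L i * ∏ k ∈ J, L k ≤ L i * ((colorFam J I τ t).card : ℝ) := mul_le_mul_of_nonneg_left ih (hL i)
      _ = ∑ c ∈ colorFam J I τ t, L i := by rw [sum_const, nsmul_eq_mul, mul_comm]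
      _ ≤ ∑ c ∈ colorFam J I τ t, ((colorings (I i) c (t i)).card : ℝ) := sum_le_sum fun c _ => h i c
      _ ≤ _ := by exact_mod_cast hcard

/-- Recolouring isolated vertices: if every good colouring can be completed to a target colouring in many
ways by changing only the isolated set `I`, the target has large probability. -/
theorem colE_resample {n q : ℕ} (hq : 0 < q) {E : Finset (Fin n × Fin n)} {I : Finset (Fin n)}
    (hI : ∀ v ∈ I, reach E {v} = {v}) {Good Tgt : Conf n q → Prop} {L : ℝ}
    (h : ∀ τ, Good τ → L * q ^ I.card ≤
      ((univ.filter fun τ' : Conf n q => (∀ v, v ∉ I → τ' v = τ v) ∧ Tgt τ').card : ℝ)) :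
    L * colE q E (fun τ => if Good τ then 1 else 0) ≤ colE q E (fun τ => if Tgt τ then 1 else 0) := by
  have hq0 : (0 : ℝ) < q := by exact_mod_cast hq
  have hroot : ∀ v, (rootE E v ∈ I ↔ v ∈ I) ∧ (v ∈ I → rootE E v = v) := by
    have h1 : ∀ v ∈ I, ∀ u, (graphOf E).Reachable v u → u = v := by
      intro v hv u hu
      have : u ∈ reach E {v} := mem_reach.2 ⟨v, mem_singleton_self v, hu⟩
      rw [hI v hv] at this
      exact mem_singleton.1 this
    intro v
    have h2 : v ∈ I → rootE E v = v := fun hv => h1 v hv _ rootE_reachable.symm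
    refine ⟨⟨fun hv => ?_, fun hv => by rw [h2 hv]; exact hv⟩, h2⟩
    have := h1 _ hv v rootE_reachable
    rw [this]; exact hv
  set T : Conf n q → ℝ := fun c => if Tgt (fun v => c (rootE E v)) then 1 else 0 with hT
  have hdc : ∑ c : Conf n q, ∑ c' : Conf n q, (if ∀ v, v ∉ I → c' v = c v then T c' else 0) =
      q ^ I.card * ∑ c', T c' := by
    rw [sum_comm, mul_sum]
    refine sum_congr rfl fun c' _ => ?_
    have := card_agree (q := q) Iᶜ c'
    have e : n - (Iᶜ).card = I.card := by
      have := card_le_univ I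
      rw [Fintype.card_fin] at this
      rw [card_compl, Fintype.card_fin]; omega
    rw [e] at this
    rw [← sum_filter, sum_const, nsmul_eq_mul]
    congr 1
    rw [← Nat.cast_pow, ← this]
    congr 2
    ext c
    simp only [mem_filter, mem_univ, true_and, mem_compl]
    exact forall₂_congr fun _ _ => eq_comm
  have hlow : ∀ c : Conf n q, (L * q ^ I.card) * (if Good (fun v => c (rootE E v)) then 1 else 0) ≤
      ∑ c' : Conf n q, (if ∀ v, v ∉ I → c' v = c v then T c' else 0) := by
    intro c
    have hTn : ∀ c' : Conf n q, (0 : ℝ) ≤ if ∀ v, v ∉ I → c' v = c v then T c' else 0 := by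
      intro c'
      simp only [hT]
      split_ifs <;> norm_num
    split_ifs with hg
    · rw [mul_one]
      refine (h _ hg).trans ?_
      have e : ∀ c' : Conf n q, (if ∀ v, v ∉ I → c' v = c v then T c' else 0) =
          if (∀ v, v ∉ I → c' v = c v) ∧ Tgt (fun v => c' (rootE E v)) then (1 : ℝ) else 0 := by
        intro c'
        simp only [hT]
        by_cases h1 : ∀ v, v ∉ I → c' v = c v
        · rw [if_pos h1]
          exact if_congr (and_iff_right h1).symm rfl rfl
        · rw [if_neg h1, if_neg fun h2 => h1 h2.1]
      refine le_of_le_of_eq ?_ (sum_congr rfl fun c' _ => (e c').symm)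
      rw [sum_boole]
      norm_cast
      refine card_le_card_of_injOn (fun τ' v => if v ∈ I then τ' v else c v) ?_ ?_
      · intro τ' hτ'
        simp only [coe_filter, mem_univ, true_and, Set.mem_ofPred_eq] at hτ' ⊢
        refine ⟨fun v hv => by rw [if_neg hv], ?_⟩
        have : (fun v => if rootE E v ∈ I then τ' (rootE E v) else c (rootE E v)) = τ' := by
          funext v
          by_cases hv : v ∈ I
          · rw [if_pos ((hroot v).1.2 hv), (hroot v).2 hv]
          · rw [if_neg fun h' => hv ((hroot v).1.1 h'), hτ'.1 v hv]
        rw [this]; exact hτ'.2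
      · intro τ₁ h₁ τ₂ h₂ heq
        simp only [coe_filter, mem_univ, true_and, Set.mem_ofPred_eq] at h₁ h₂
        funext v
        by_cases hv : v ∈ I
        · have := congrFun heq v
          simpa [hv] using this
        · rw [h₁.1 v hv, h₂.1 v hv]
    · rw [mul_zero]
      exact sum_nonneg fun c' _ => hTn c'
  have hsum := sum_le_sum fun c (_ : c ∈ (univ : Finset (Conf n q))) => hlow c
  rw [hdc, ← mul_sum] at hsum
  rw [colE_eq hq, colE_eq hq, mul_left_comm]
  refine mul_le_mul_of_nonneg_left ?_ (by positivity)
  have hp : (0 : ℝ) < q ^ I.card := by positivity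
  refine le_of_mul_le_mul_left ?_ hp
  calc _ = L * q ^ I.card * ∑ c : Conf n q, (if Good (fun v => c (rootE E v)) then (1 : ℝ) else 0) := by ring
    _ ≤ _ := hsum

/-- `S` gets colour `j₀` and every `B i` is nearly equidistributed. -/
def GoodCol {n q : ℕ} (S : Finset (Fin n)) (B : Fin q → Finset (Fin n)) (j₀ : Fin q) (K : ℝ)
    (τ : Conf n q) : Prop :=
  (∀ v ∈ S, τ v = j₀) ∧ ∀ i j, |noise (B i) j τ| ≤ K

theorem colE_goodCol_ge {n q : ℕ} (hq : 2 ≤ q) (hn : 1 ≤ n) {E : Finset (Fin n × Fin n)} {S : Finset (Fin n)}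
    (hS : IsCompOf E S) {K₁ K₂ : ℝ} (hK₂ : 0 < K₂) (hK : 2 * q ^ 3 * K₁ ≤ K₂ ^ 2)
    (hχ : ∑ u ∈ Sᶜ, ((reach E {u}).card : ℝ) ≤ K₁ * n) {B : Fin q → Finset (Fin n)} (hB : ∀ i, B i ⊆ Sᶜ)
    (j₀ : Fin q) :
    1 / (2 * (q : ℝ)) ≤ colE q E (fun τ => if GoodCol S B j₀ (K₂ * Real.sqrt n) τ then 1 else 0) := by
  have hn0 : (0 : ℝ) < n := by exact_mod_cast hn
  have hq0 : (0 : ℝ) < q := by positivity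
  have hsn : 0 < Real.sqrt n := Real.sqrt_pos.2 hn0
  have hsn2 : Real.sqrt n ^ 2 = n := Real.sq_sqrt hn0.le
  obtain ⟨v₀, hv₀⟩ := hS.1
  have hpt : ∀ τ : Conf n q, (∀ u v, (graphOf E).Reachable u v → τ u = τ v) →
      (if τ v₀ = j₀ then (1 : ℝ) else 0) + (-(K₂ ^ 2 * n)⁻¹) * ∑ i, ∑ j, noise (B i) j τ ^ 2 ≤
        if GoodCol S B j₀ (K₂ * Real.sqrt n) τ then 1 else 0 := by
    intro τ hτ
    have hinv : 0 ≤ (K₂ ^ 2 * (n : ℝ))⁻¹ := by positivity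
    have hs0 : 0 ≤ ∑ i, ∑ j, noise (B i) j τ ^ 2 := sum_nonneg fun _ _ => sum_nonneg fun _ _ => sq_nonneg _
    have hm := mul_nonneg hinv hs0
    by_cases hG : GoodCol S B j₀ (K₂ * Real.sqrt n) τ
    · rw [if_pos hG]
      split_ifs <;> linarith
    · rw [if_neg hG]
      by_cases hj : τ v₀ = j₀
      · rw [if_pos hj]
        have hSj : ∀ v ∈ S, τ v = j₀ := by
          intro v hv
          rw [← hj]
          refine hτ v v₀ ?_
          rw [← hS.2 v hv] at hv₀
          obtain ⟨b, hb, hr⟩ := mem_reach.1 hv₀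
          rwa [mem_singleton.1 hb] at hr
        have : ∃ i j, K₂ * Real.sqrt n < |noise (B i) j τ| := by
          by_contra hcon
          push Not at hcon
          exact hG ⟨hSj, hcon⟩
        obtain ⟨i, j, hij⟩ := this
        have h1 : K₂ ^ 2 * n ≤ noise (B i) j τ ^ 2 := by
          rw [← hsn2, ← mul_pow, ← sq_abs (noise (B i) j τ)]
          exact pow_le_pow_left₀ (by positivity) hij.le 2
        have h2 : noise (B i) j τ ^ 2 ≤ ∑ i, ∑ j, noise (B i) j τ ^ 2 :=
          (single_le_sum (f := fun j => noise (B i) j τ ^ 2) (fun _ _ => sq_nonneg _) (mem_univ j)).trans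
            (single_le_sum (f := fun i => ∑ j, noise (B i) j τ ^ 2)
              (fun _ _ => sum_nonneg fun _ _ => sq_nonneg _) (mem_univ i))
        have h3 : (K₂ ^ 2 * (n : ℝ))⁻¹ * (K₂ ^ 2 * n) = 1 := inv_mul_cancel₀ (by positivity)
        have h4 := mul_le_mul_of_nonneg_left (h1.trans h2) hinv
        linarith
      · rw [if_neg hj]; linarith
  refine le_trans ?_ (colE_mono hpt)
  rw [colE_add, colE_single (by omega), colE_mul_left, colE_sum]
  have h1 : ∑ i, colE q E (fun τ => ∑ j, noise (B i) j τ ^ 2) ≤ q * (q * (K₁ * n)) := by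
    calc _ ≤ ∑ _i : Fin q, (q : ℝ) * (K₁ * n) := by
          refine sum_le_sum fun i _ => ?_
          rw [colE_sum]
          calc _ ≤ ∑ _j : Fin q, K₁ * (n : ℝ) := by
                refine sum_le_sum fun j _ => ?_
                refine (colE_noise_sq_le (by omega) (B i) j).trans (le_trans ?_ hχ)
                refine sum_le_sum_of_subset_of_nonneg (fun v hv => ?_) fun _ _ _ => Nat.cast_nonneg _
                exact hB i hv
            _ = _ := by simp
      _ = _ := by simp
  have h2 : (K₂ ^ 2 * (n : ℝ))⁻¹ * (q * (q * (K₁ * n))) ≤ 1 / (2 * q) := by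
    rw [inv_mul_le_iff₀ (by positivity), mul_one_div, le_div_iff₀ (by positivity)]
    have := mul_le_mul_of_nonneg_right hK hn0.le
    linarith
  have h3 := mul_le_mul_of_nonneg_left h1 (show 0 ≤ (K₂ ^ 2 * (n : ℝ))⁻¹ by positivity)
  have h4 : 1 / (q : ℝ) = 1 / (2 * q) + 1 / (2 * q) := by field_simp; norm_num
  rw [h4]
  linarith

theorem card_filter_split {n : ℕ} {S I A : Finset (Fin n)} (hIA : I ⊆ A) (hIS : Disjoint I S)
    (p : Fin n → Prop) [DecidablePred p] : (A.filter p).card =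
      ((S ∩ A).filter p).card + ((A \ (S ∪ I)).filter p).card + (I.filter p).card := by
  have e : A = (S ∩ A ∪ A \ (S ∪ I)) ∪ I := by
    ext v
    have := @hIA v
    simp only [mem_union, mem_sdiff, mem_inter]
    tauto
  have h1 : Disjoint (S ∩ A ∪ A \ (S ∪ I)) I := by
    rw [disjoint_left]
    intro v hv h1
    rcases mem_union.1 hv with h | h
    · exact disjoint_left.1 hIS h1 (mem_inter.1 h).1
    · exact (mem_sdiff.1 h).2 (mem_union_right _ h1)
  have h2 : Disjoint (S ∩ A) (A \ (S ∪ I)) := by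
    rw [disjoint_left]
    intro v hv hv'
    exact (mem_sdiff.1 hv').2 (mem_union_left _ (mem_inter.1 hv).1)
  conv_lhs => rw [e]
  rw [filter_union, filter_union, card_union_of_disjoint (by rw [← filter_union]; exact disjoint_filter_filter h1),
    card_union_of_disjoint (disjoint_filter_filter h2)]

set_option maxHeartbeats 1000000 in
theorem colE_proj_lower {n q : ℕ} (hq : 2 ≤ q) (hn : 1 ≤ n) {P : Fin q → Finset (Fin n)}
    (hP : ∀ i j, i ≠ j → Disjoint (P i) (P j)) {E : Finset (Fin n × Fin n)} {S : Finset (Fin n)}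
    (hS : IsCompOf E S) (hS2 : 2 ≤ S.card) {δ K₁ K₂ K₃ K₄ : ℝ} (hδ : 0 < δ) (hK₂ : 0 < K₂) (hK₃ : 0 ≤ K₃)
    (hK₄ : 0 ≤ K₄)
    (hK : 2 * q ^ 3 * K₁ ≤ K₂ ^ 2) {g : Fin q → ℝ}
    (hg : ∀ i, |((S ∩ P i).card : ℝ) - g i| ≤ K₃ * Real.sqrt n)
    (hχ : ∑ u ∈ Sᶜ, ((reach E {u}).card : ℝ) ≤ K₁ * n)
    (hiso : ∀ i, δ * n ≤ ((isoIn E (P i)).card : ℝ)) {j₀ : Fin q} {T : Fin q → Fin q → ℕ}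
    (hT : ∀ i, ∑ j, T i j = (P i).card)
    (hTg : ∀ i j, |(T i j : ℝ) - (((P i).card - g i) / q + if j = j₀ then g i else 0)| ≤ K₄ * Real.sqrt n)
    (hlarge : 1 ≤ δ * n / q - (K₄ + K₂ + 2 * K₃) * Real.sqrt n) :
    (Real.exp (-(q * (q * (K₄ + K₂ + 2 * K₃) ^ 2 / δ + 1))) / Real.sqrt n ^ (q - 1)) ^ q * (1 / (2 * q)) ≤
      colE q E (fun τ => if projCnt P τ = T then 1 else 0) := by
  have hn0 : (0 : ℝ) < n := by exact_mod_cast hn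
  have hq0 : (0 : ℝ) < q := by positivity
  have hq1 : (1 : ℝ) ≤ q := by exact_mod_cast (by omega : 1 ≤ q)
  have hsn : 0 < Real.sqrt n := Real.sqrt_pos.2 hn0
  have hsn2 : Real.sqrt n ^ 2 = n := Real.sq_sqrt hn0.le
  set Kt := K₄ + K₂ + 2 * K₃ with hKt
  have hKt0 : 0 < Kt := by linarith
  set I : Fin q → Finset (Fin n) := fun i => isoIn E (P i) with hI
  set B : Fin q → Finset (Fin n) := fun i => P i \ (S ∪ I i) with hB
  set U := univ.biUnion I with hU
  have hIP : ∀ i, I i ⊆ P i := fun i => filter_subset _ _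
  have hIS : ∀ i, Disjoint (I i) S := by
    intro i
    rw [disjoint_left]
    intro v hv hvS
    have h1 := (mem_filter.1 hv).2
    rw [hS.2 v hvS] at h1
    rw [h1, card_singleton] at hS2
    omega
  have hUiso : ∀ v ∈ U, reach E {v} = {v} := by
    intro v hv
    obtain ⟨i, -, hi⟩ := mem_biUnion.1 hv
    exact (mem_filter.1 hi).2
  have hIdisj : ∀ i j, i ≠ j → Disjoint (I i) (I j) := fun i j hij =>
    disjoint_of_subset_left (hIP i) (disjoint_of_subset_right (hIP j) (hP i j hij))
  have hUcard : U.card = ∑ i, (I i).card := card_biUnion fun i _ j _ hij => hIdisj i j hij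
  have hsplit : ∀ (τ : Conf n q) i j, ((P i).filter fun v => τ v = j).card =
      ((S ∩ P i).filter fun v => τ v = j).card + ((B i).filter fun v => τ v = j).card +
        ((I i).filter fun v => τ v = j).card := fun τ i j => card_filter_split (hIP i) (hIS i) _
  have hcardP : ∀ i, (P i).card = (S ∩ P i).card + (B i).card + (I i).card := by
    intro i
    have := card_filter_split (hIP i) (hIS i) fun _ => True
    simpa using this
  have hgood := colE_goodCol_ge hq hn hS hK₂ hK hχ (B := B)
    (fun i v hv => mem_compl.2 fun hvS => (mem_sdiff.1 hv).2 (mem_union_left _ hvS)) j₀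
  set e := Real.exp (-(q * (q * Kt ^ 2 / δ + 1))) / Real.sqrt n ^ (q - 1) with he
  have he0 : 0 < e := by positivity
  have hres : ∀ τ, GoodCol S B j₀ (K₂ * Real.sqrt n) τ → e ^ q * q ^ U.card ≤
      ((univ.filter fun τ' : Conf n q => (∀ v, v ∉ U → τ' v = τ v) ∧ projCnt P τ' = T).card : ℝ) := by
    intro τ hG
    set b : Fin q → Fin q → ℕ := fun i j =>
      (if j = j₀ then (S ∩ P i).card else 0) + ((B i).filter fun v => τ v = j).card with hb
    set t : Fin q → Fin q → ℕ := fun i j => T i j - b i j with ht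
    have hA1 : ∀ i, δ * n / q ≤ ((I i).card : ℝ) / q := fun i => by have := hiso i; gcongr
    have hdev : ∀ i j, |(T i j : ℝ) - b i j - (I i).card / q| ≤ Kt * Real.sqrt n := by
      intro i j
      have h1 := abs_le.1 (hTg i j)
      have h2 := abs_le.1 (hg i)
      have h3 := abs_le.1 (hG.2 i j)
      have h4 : ((P i).card : ℝ) = (S ∩ P i).card + (B i).card + (I i).card := by exact_mod_cast hcardP i
      have h5 : |(((S ∩ P i).card : ℝ) - g i) / q| ≤ K₃ * Real.sqrt n := by
        rw [abs_div, abs_of_pos hq0]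
        exact (div_le_self (abs_nonneg _) hq1).trans (hg i)
      have h5 := abs_le.1 h5
      have h6 : 0 ≤ K₃ * Real.sqrt n := by positivity
      have h7 : (T i j : ℝ) - b i j - (I i).card / q =
          ((T i j : ℝ) - (((P i).card - g i) / q + if j = j₀ then g i else 0)) +
          (((S ∩ P i).card : ℝ) - g i) / q - noise (B i) j τ -
          (if j = j₀ then ((S ∩ P i).card : ℝ) - g i else 0) := by
        rw [h4, hb, noise]
        push_cast
        split_ifs <;> ring
      rw [h7, hKt, abs_le]
      split_ifs at h1 ⊢ <;> constructor <;> linarith only [h1, h2, h3, h5, h6]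
    have hbT : ∀ i j, b i j + 1 ≤ T i j := by
      intro i j
      have h1 := (abs_le.1 (hdev i j)).1
      have h2 := hA1 i
      have : (b i j : ℝ) + 1 ≤ T i j := by linarith
      exact_mod_cast this
    have htR : ∀ i j, (t i j : ℝ) = T i j - b i j := fun i j => by
      rw [ht]; exact Nat.cast_sub (by have := hbT i j; omega)
    have hbsum : ∀ i, ∑ j, b i j = (S ∩ P i).card + (B i).card := by
      intro i
      rw [hb, sum_add_distrib, sum_ite_eq' univ j₀, if_pos (mem_univ _)]
      congr 1
      exact (card_eq_sum_card_fiberwise fun _ _ => mem_univ _).symm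
    have htsum : ∀ i, ∑ j, t i j = (I i).card := by
      intro i
      have h1 : ∑ j, t i j + ∑ j, b i j = ∑ j, T i j := by
        rw [← sum_add_distrib]
        refine sum_congr rfl fun j _ => ?_
        have := hbT i j
        simp only [ht]; omega
      rw [hbsum, hT, hcardP] at h1
      omega
    have hIone : ∀ i, 1 ≤ (I i).card := by
      intro i
      have h1 : (0 : ℝ) < δ * n := by positivity
      exact_mod_cast h1.trans_le (hiso i)
    have hΔ : ∀ i, ∑ j, ((t i j : ℝ) - (I i).card / q) ^ 2 ≤ q * Kt ^ 2 / δ * (I i).card := by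
      intro i
      calc ∑ j, ((t i j : ℝ) - (I i).card / q) ^ 2 ≤ ∑ _j : Fin q, Kt ^ 2 * (n : ℝ) := by
            refine sum_le_sum fun j _ => ?_
            rw [htR, ← sq_abs, ← hsn2, ← mul_pow]
            exact pow_le_pow_left₀ (abs_nonneg _) (hdev i j) 2
        _ = q * Kt ^ 2 / δ * (δ * n) := by
            rw [sum_const, card_univ, Fintype.card_fin, nsmul_eq_mul]; field_simp
        _ ≤ _ := by have := hiso i; gcongr
    have hfam := card_colorFam_lower hIdisj (t := t) (L := fun i => e * q ^ (I i).card) (fun i => by positivity)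
      (fun i τ => card_colorings_lower (by omega) (hIone i) τ (htsum i)
        (fun j => by have := hbT i j; simp only [ht]; omega) (hΔ i)) univ τ
    rw [prod_mul_distrib, prod_const, card_univ, Fintype.card_fin, prod_pow_eq_pow_sum, ← hUcard] at hfam
    refine hfam.trans ?_
    norm_cast
    refine card_le_card fun τ' hτ' => ?_
    have hτ' := (mem_filter.1 hτ').2
    have hoff : ∀ v, v ∉ U → τ' v = τ v := fun v hv =>
      hτ'.1 v fun i _ hvi => hv (mem_biUnion.2 ⟨i, mem_univ i, hvi⟩)
    refine mem_filter.2 ⟨mem_univ _, hoff, ?_⟩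
    have hUP : ∀ i v, v ∈ P i → v ∈ U → v ∈ I i := by
      intro i v hvP hvU
      obtain ⟨k, -, hk⟩ := mem_biUnion.1 hvU
      by_cases hki : k = i
      · exact hki ▸ hk
      · exact absurd hvP (disjoint_left.1 (hP k i hki) (hIP k hk))
    funext i j
    have h1 : ((S ∩ P i).filter fun v => τ' v = j).card = if j = j₀ then (S ∩ P i).card else 0 := by
      have hval : ∀ v ∈ S ∩ P i, τ' v = j₀ := by
        intro v hv
        obtain ⟨hvS, hvP⟩ := mem_inter.1 hv
        rw [hoff v fun hvU => disjoint_left.1 (hIS i) (hUP i v hvP hvU) hvS]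
        exact hG.1 v hvS
      split_ifs with hj
      · rw [filter_true_of_mem fun v hv => by rw [hval v hv, hj]]
      · rw [card_eq_zero, filter_eq_empty_iff]
        intro v hv hvj
        exact hj (by rw [← hvj, hval v hv])
    have h2 : ((B i).filter fun v => τ' v = j).card = ((B i).filter fun v => τ v = j).card := by
      congr 1
      refine filter_congr fun v hv => ?_
      obtain ⟨hvP, hvn⟩ := mem_sdiff.1 hv
      rw [hoff v fun hvU => hvn (mem_union_right _ (hUP i v hvP hvU))]
    have h3 := hτ'.2 i (mem_univ i) j
    rw [projCnt, hsplit, h1, h2, h3]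
    have := hbT i j
    simp only [ht, hb] at this ⊢
    omega
  have hcol := colE_resample (L := e ^ q) (Good := GoodCol S B j₀ (K₂ * Real.sqrt n))
    (Tgt := fun τ => projCnt P τ = T) (by omega) hUiso fun τ hG => by
      refine (hres τ hG).trans (Nat.cast_le.2 (card_le_card fun τ' h => ?_))
      simp only [mem_filter, mem_univ, true_and] at h ⊢
      exact h
  refine ((mul_le_mul_of_nonneg_left hgood (by positivity)).trans hcol).trans ?_
  refine colE_mono fun τ _ => ?_
  by_cases h : projCnt P τ = T
  · rw [if_pos h, if_pos h]
  · rw [if_neg h, if_neg h]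

theorem exists_box {n q : ℕ} (hq : 2 ≤ q) (hn : 1 ≤ n) (P : Fin q → Finset (Fin n)) {g : Fin q → ℝ}
    (hg : ∀ i, 0 ≤ g i) (hgP : ∀ i, g i ≤ (P i).card) (hP : ∀ i, 2 * q ^ 2 * Real.sqrt n ≤ (P i).card)
    (j₀ : Fin q) :
    ∃ Box : Finset (Fin q → Fin q → ℕ), Box.Nonempty ∧ (Real.sqrt n ^ (q - 1)) ^ q ≤ (Box.card : ℝ) ∧
      ∀ T ∈ Box, (∀ i, ∑ j, T i j = (P i).card) ∧
        ∀ i j, |(T i j : ℝ) - (((P i).card - g i) / q + if j = j₀ then g i else 0)| ≤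
          2 * q * Real.sqrt n := by
  have hn0 : (1 : ℝ) ≤ n := by exact_mod_cast hn
  have hq0 : (0 : ℝ) < q := by positivity
  have hq1 : (1 : ℝ) ≤ q := by exact_mod_cast (by omega : 1 ≤ q)
  have hsn : 1 ≤ Real.sqrt n := Real.one_le_sqrt.2 hn0
  set m := ⌈Real.sqrt n⌉₊ with hm
  have hm1 : Real.sqrt n ≤ m := Nat.le_ceil _
  have hm2 : (m : ℝ) ≤ 2 * Real.sqrt n := by
    have := Nat.ceil_lt_add_one (show 0 ≤ Real.sqrt n by linarith)
    linarith
  have hm0 : 0 < m := by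
    have : (0 : ℝ) < m := by linarith
    exact_mod_cast this
  have hx : ∀ i, 0 ≤ ((P i).card - g i) / q := fun i => div_nonneg (by linarith [hgP i]) hq0.le
  set f : Fin q → ℕ := fun i => ⌊((P i).card - g i) / q⌋₊ with hf
  have hf1 : ∀ i, (f i : ℝ) ≤ ((P i).card - g i) / q := fun i => Nat.floor_le (hx i)
  have hf2 : ∀ i, ((P i).card - g i) / q < f i + 1 := fun i => Nat.lt_floor_add_one _
  have hcard : Fintype.card {j : Fin q // j ≠ j₀} = q - 1 := by
    rw [Fintype.card_subtype_compl, Fintype.card_fin, Fintype.card_subtype_eq]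
  let T : (Fin q → {j : Fin q // j ≠ j₀} → Fin m) → Fin q → Fin q → ℕ := fun e i j =>
    if h : j = j₀ then (P i).card - ∑ k : {j : Fin q // j ≠ j₀}, (f i + e i k) else f i + e i ⟨j, h⟩
  have hinj : Function.Injective T := by
    intro e₁ e₂ h
    funext i k
    have := congrFun (congrFun h i) k.1
    simp only [T, dif_neg k.2] at this
    have h2 : f i + (e₁ i k : ℕ) = f i + (e₂ i k : ℕ) := this
    exact Fin.ext (by omega)
  have hsumdev : ∀ (e : Fin q → {j : Fin q // j ≠ j₀} → Fin m) i, |(∑ k : {j : Fin q // j ≠ j₀}, ((f i : ℝ) + ((e i k : ℕ) : ℝ))) -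
      (q - 1) * (((P i).card - g i) / q)| ≤ (q - 1) * m := by
    intro e i
    have e1 : (∑ k : {j : Fin q // j ≠ j₀}, ((f i : ℝ) + ((e i k : ℕ) : ℝ))) - (q - 1) * (((P i).card - g i) / q) =
        ∑ k : {j : Fin q // j ≠ j₀}, ((f i : ℝ) + ((e i k : ℕ) : ℝ) - ((P i).card - g i) / q) := by
      rw [sum_sub_distrib, sum_const, card_univ, hcard, nsmul_eq_mul, Nat.cast_sub (by omega), Nat.cast_one]
    rw [e1]
    refine (abs_sum_le_sum_abs _ _).trans ?_
    calc _ ≤ ∑ _k : {j : Fin q // j ≠ j₀}, (m : ℝ) := by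
          refine sum_le_sum fun k _ => ?_
          have h1 : ((e i k : Fin m) : ℝ) + 1 ≤ m := by exact_mod_cast (e i k).2
          have h2 : (0 : ℝ) ≤ ((e i k : Fin m) : ℝ) := Nat.cast_nonneg _
          rw [abs_le]
          constructor <;> linarith [hf1 i, hf2 i]
      _ = _ := by rw [sum_const, card_univ, hcard, nsmul_eq_mul, Nat.cast_sub (by omega), Nat.cast_one]
  have hle : ∀ (e : Fin q → {j : Fin q // j ≠ j₀} → Fin m) i, ∑ k : {j : Fin q // j ≠ j₀}, (f i + (e i k : ℕ)) ≤ (P i).card := by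
    intro e i
    have h1 := (abs_le.1 (hsumdev e i)).2
    have h2 : ((q : ℝ) - 1) * (((P i).card - g i) / q) ≤ (q - 1) * ((P i).card / q) := by
      have := hg i
      have : ((P i).card - g i) / q ≤ ((P i).card : ℝ) / q := by gcongr; linarith
      exact mul_le_mul_of_nonneg_left this (by linarith)
    have h3 : ((q : ℝ) - 1) * m ≤ (P i).card / q := by
      rw [le_div_iff₀ hq0]
      have h4 : ((q : ℝ) - 1) * m * q ≤ q * (2 * Real.sqrt n) * q := by
        gcongr
        linarith
      have := hP i
      linarith
    have h5 : ((q : ℝ) - 1) * ((P i).card / q) + (P i).card / q = (P i).card := by field_simp; ring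
    have : ((∑ k : {j : Fin q // j ≠ j₀}, (f i + (e i k : ℕ)) : ℕ) : ℝ) ≤ (P i).card := by
      push_cast
      linarith
    exact_mod_cast this
  have : Nonempty (Fin m) := ⟨⟨0, hm0⟩⟩
  refine ⟨univ.image T, univ_nonempty.image _, ?_, ?_⟩
  · rw [card_image_of_injective _ hinj, card_univ, Fintype.card_fun, Fintype.card_fun, hcard, Fintype.card_fin,
      Fintype.card_fin]
    push_cast
    gcongr
  · intro T' hT'
    obtain ⟨e, -, rfl⟩ := mem_image.1 hT'
    refine ⟨fun i => ?_, fun i j => ?_⟩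
    · have h1 : ∑ j ∈ univ.erase j₀, T e i j = ∑ k : {j : Fin q // j ≠ j₀}, (f i + (e i k : ℕ)) := by
        rw [sum_subtype (univ.erase j₀) (p := fun j => j ≠ j₀) (by simp) (fun j => T e i j)]
        exact sum_congr rfl fun k _ => by simp only [T, dif_neg k.2]
      rw [← add_sum_erase univ _ (mem_univ j₀), h1]
      simp only [T, dif_pos]
      have := hle e i
      omega
    · by_cases hj : j = j₀
      · subst hj
        simp only [T, dif_pos, if_pos]
        rw [Nat.cast_sub (hle e i)]
        push_cast
        have h1 := abs_le.1 (hsumdev e i)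
        have h2 : ((P i).card : ℝ) = (q - 1) * (((P i).card - g i) / q) + ((P i).card - g i) / q + g i := by
          field_simp; ring
        have h3 : ((q : ℝ) - 1) * m ≤ 2 * q * Real.sqrt n := by
          calc ((q : ℝ) - 1) * m ≤ q * (2 * Real.sqrt n) := by gcongr; linarith
            _ = _ := by ring
        rw [abs_le]
        constructor <;> linarith
      · simp only [T, dif_neg hj, if_neg hj, add_zero]
        have h1 : ((e i ⟨j, hj⟩ : Fin m) : ℝ) + 1 ≤ m := by exact_mod_cast (e i ⟨j, hj⟩).2
        have h2 : (0 : ℝ) ≤ ((e i ⟨j, hj⟩ : Fin m) : ℝ) := Nat.cast_nonneg _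
        have h3 : 2 * Real.sqrt n ≤ 2 * q * Real.sqrt n := by nlinarith
        push_cast
        rw [abs_le]
        constructor <;> linarith [hf1 i, hf2 i]

theorem giant_proportions {n q : ℕ} {β a y r₀ κ x₀ D ρ k₀ : ℝ} (h : StepConsts q β a y r₀ κ x₀ D ρ k₀)
    (hq : 2 ≤ q) (hn : 1 ≤ n) (hβ : 0 < β) (hy : 0 < y) (hy1 : y < 1) (ha : 0 < a)
    (hexp : Real.exp (-(β * a * y)) = 1 - y) {P : Fin q → Finset (Fin n)} {c : Fin q → ℝ} {X : Conf n q}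
    {s : Fin q} {K K₁ : ℝ} (hK₁ : 0 ≤ K₁)
    (hN : |(cntN X s : ℝ) - a * n| ≤ K * Real.sqrt n) (hN' : |(cntN X s : ℝ) - a * n| ≤ r₀ * n)
    (hc : ∀ i, |(projCnt P X i s : ℝ) - c i| ≤ K * Real.sqrt n) {E : Finset (Fin n × Fin n)}
    {S : Finset (Fin n)} (hS : κ * n ≤ S.card) (hψ : errPsi β P X s E S ≤ K₁ * n) :
    (∀ i, |((S ∩ P i).card : ℝ) - y * c i| ≤
      (Real.sqrt K₁ + 2 * (K + Real.sqrt K₁ / D) + 2 * K) * Real.sqrt n) ∧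
    ∑ u ∈ Sᶜ, ((reach E {u}).card : ℝ) ≤ K₁ * n := by
  have hn0 : (0 : ℝ) < n := by exact_mod_cast hn
  have hw := Real.sqrt_nonneg (n : ℝ)
  have hq2 : (2 : ℝ) ≤ q := by exact_mod_cast hq
  have hNpos : (0 : ℝ) < cntN X s := by
    have := (abs_le.1 hN').1
    have h1 : r₀ * n < a * n := by
      have := h.hra
      exact mul_lt_mul_of_pos_right (by linarith) hn0
    linarith
  have hgs := giant_stable h (by omega) hβ hy ha hexp hn0 hN' hS
  rw [← exp_pow_div] at hgs
  set N : ℝ := (cntN X s : ℝ) with hNdef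
  set L : ℝ := (S.card : ℝ) with hL
  set A := (L - N * (1 - Real.exp (-(β / n)) ^ S.card)) ^ 2 with hA
  have hA0 : 0 ≤ A := sq_nonneg _
  have hχ0 : 0 ≤ ∑ u ∈ Sᶜ, ((reach E {u}).card : ℝ) := sum_nonneg fun _ _ => Nat.cast_nonneg _
  have hB0 : ∀ i ∈ univ, 0 ≤ (((S ∩ P i).card : ℝ) - L * (projCnt P X i s / N)) ^ 2 := fun i _ => sq_nonneg _
  have hψ' : A + ∑ i, (((S ∩ P i).card : ℝ) - L * (projCnt P X i s / N)) ^ 2 +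
    ∑ u ∈ Sᶜ, ((reach E {u}).card : ℝ) ≤ K₁ * n := hψ
  have hBs := sum_nonneg hB0
  have hsq : ∀ x : ℝ, x ^ 2 ≤ K₁ * n → |x| ≤ Real.sqrt K₁ * Real.sqrt n := by
    intro x hx
    rw [← Real.sqrt_mul hK₁, ← Real.sqrt_sq_eq_abs]
    exact Real.sqrt_le_sqrt hx
  have h1 := hsq _ (show _ ≤ _ by linarith : A ≤ K₁ * n)
  refine ⟨fun i => ?_, by linarith⟩
  have h2 := hsq _ ((single_le_sum hB0 (mem_univ i)).trans (by linarith))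
  set G : ℝ := ((S ∩ P i).card : ℝ) with hG
  have hDN : (projCnt P X i s : ℝ) ≤ N := by
    rw [hNdef]
    exact_mod_cast card_le_card (filter_subset_filter _ (subset_univ _))
  set Di : ℝ := (projCnt P X i s : ℝ) with hDi
  have hDi0 : 0 ≤ Di := Nat.cast_nonneg _
  have h3 : |L - y * a * n| ≤ 2 * (K + Real.sqrt K₁ / D) * Real.sqrt n := by
    have hD := h.hD
    have h4 : 1 / 2 * |L - y * a * n| ≤ (1 - 1 / (q : ℝ)) * |L - y * a * n| := by
      have : 1 / (q : ℝ) ≤ 1 / 2 := one_div_le_one_div_of_le (by norm_num) hq2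
      exact mul_le_mul_of_nonneg_right (by linarith) (abs_nonneg _)
    have h5 : ρ * |N - a * n| ≤ 1 * (K * Real.sqrt n) := mul_le_mul h.hρ1.le hN (abs_nonneg _) zero_le_one
    have h6 : 1 / D * |L - N * (1 - Real.exp (-(β / n)) ^ S.card)| ≤
        1 / D * (Real.sqrt K₁ * Real.sqrt n) := mul_le_mul_of_nonneg_left h1 (by positivity)
    have e : 2 * (K + Real.sqrt K₁ / D) * Real.sqrt n =
      2 * (1 * (K * Real.sqrt n) + 1 / D * (Real.sqrt K₁ * Real.sqrt n)) := by ring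
    rw [e]
    linarith
  have h4 : |L - y * N| ≤ (2 * (K + Real.sqrt K₁ / D) + K) * Real.sqrt n := by
    have e : L - y * N = (L - y * a * n) - y * (N - a * n) := by ring
    rw [e]
    refine (abs_sub _ _).trans ?_
    rw [abs_mul, abs_of_pos hy]
    have : y * |N - a * n| ≤ 1 * (K * Real.sqrt n) := mul_le_mul hy1.le hN (abs_nonneg _) zero_le_one
    linarith
  have e : G - y * c i = (G - L * (Di / N)) + (L - y * N) * (Di / N) + y * (Di - c i) := by
    field_simp
    ring
  rw [e]
  have h5 : |(L - y * N) * (Di / N)| ≤ (2 * (K + Real.sqrt K₁ / D) + K) * Real.sqrt n := by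
    rw [abs_mul, abs_of_nonneg (div_nonneg hDi0 hNpos.le)]
    exact (mul_le_of_le_one_right (abs_nonneg _) ((div_le_one hNpos).2 hDN)).trans h4
  have h6 : |y * (Di - c i)| ≤ 1 * (K * Real.sqrt n) := by
    rw [abs_mul, abs_of_pos hy]
    exact mul_le_mul hy1.le (hc i) (abs_nonneg _) zero_le_one
  have h7 := abs_add_three (G - L * (Di / N)) ((L - y * N) * (Di / N)) (y * (Di - c i))
  linarith

theorem colE_nonneg {n q : ℕ} {E : Finset (Fin n × Fin n)} {f : Conf n q → ℝ} (hf : ∀ τ, 0 ≤ f τ) :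
    0 ≤ colE q E f :=
  sum_nonneg fun τ _ => mul_nonneg (by split_ifs <;> positivity) (hf τ)

/-- If every percolation outcome outside three rare events recolours to `T` with probability at least
`L`, then so does a whole step with probability at least `L / 2`. -/
theorem half_le_bex {ι : Type*} {r : ℝ} {U : Finset ι} (hr : 0 ≤ r) (hr1 : r ≤ 1) {f A W I : Finset ι → ℝ}
    {L K : ℝ} (hL : 0 ≤ L) (hK : 0 < K) (hA : bex r U A ≤ 1 / 8) (hW : bex r U W ≤ K / 4)
    (hI : bex r U I ≤ 1 / 8) (h : ∀ E ⊆ U, L ≤ f E + (L * A E + (L / K * W E + L * I E))) :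
    L / 2 ≤ bex r U f := by
  have h1 := bex_mono hr hr1 h
  rw [bex_const, bex_add, bex_add, bex_add, bex_mul_left, bex_mul_left, bex_mul_left] at h1
  have h2 := mul_le_mul_of_nonneg_left hA hL
  have h3 := mul_le_mul_of_nonneg_left hW (show 0 ≤ L / K by positivity)
  have h4 := mul_le_mul_of_nonneg_left hI hL
  have e : L / K * (K / 4) = L / 4 := by field_simp
  linarith

theorem exists_minor {q : ℕ} {β a y r₀ κ x₀ D ρ k₀ : ℝ} (h : StepConsts q β a y r₀ κ x₀ D ρ k₀)
    (hq : 2 ≤ q) (hβ : 0 < β) (hy : 0 < y) (hy1 : y < 1) (ha : 0 < a)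
    (hexp : Real.exp (-(β * a * y)) = 1 - y) {lam B K : ℝ} (hlam : 0 < lam) (hB : 1 ≤ B) (hK : 0 < K) :
    ∃ ε M : ℝ, 0 < ε ∧ ε < 1 ∧ ∀ n : ℕ, 1 ≤ n → M ≤ Real.sqrt n → ∀ P : Fin q → Finset (Fin n),
      IsLamPartition lam P → ∀ c : Fin q → ℝ, (∀ i, 0 ≤ c i) → (∀ i, c i ≤ (P i).card) →
      ∃ Box : Finset (Fin q → Fin q → ℕ), Box.Nonempty ∧ ∀ X : Conf n q,
        swDist a y B P c X ≤ K * Real.sqrt n → ∀ T ∈ Box,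
          ε / Box.card ≤ ∑ τ, if projCnt P τ = T then swStep n q β X τ else 0 := by
  have hq0 : (0 : ℝ) < q := by positivity
  have hD := h.hD
  have hκ := h.hκ
  have hr₀ := h.hr
  obtain ⟨C₁, hC₁, hwin⟩ := bex_window_le h hβ
  obtain ⟨C₂, hC₂, hnow⟩ := bex_nowindow_le h hβ
  obtain ⟨C₃, hC₃, hiso⟩ := bex_few_isolated_le hβ hlam
  set δ := lam * Real.exp (-β) / 2 with hδ
  have hδ0 : 0 < δ := by positivity
  set K₁ := 4 * C₁ with hK₁
  have hK₁0 : 0 < K₁ := by positivity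
  set K₂ := Real.sqrt (2 * q ^ 3 * K₁) with hK₂
  have hK₂0 : 0 < K₂ := Real.sqrt_pos.2 (by positivity)
  set K₃ := Real.sqrt K₁ + 2 * (K + Real.sqrt K₁ / D) + 2 * K with hK₃
  have hK₃0 : 0 < K₃ := by positivity
  set Kt := 2 * (q : ℝ) + K₂ + 2 * K₃ with hKt
  have hKt0 : 0 < Kt := by positivity
  set x := Real.exp (-(q * (q * Kt ^ 2 / δ + 1))) with hx
  have hx0 : 0 < x := Real.exp_pos _
  have hx1 : x ≤ 1 := Real.exp_le_one_iff.2 (neg_nonpos.2 (by positivity))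
  refine ⟨x ^ q * (1 / (2 * q)) / 2, K / r₀ + 2 / κ + 2 * q ^ 2 / lam + q * (Kt + 1) / δ + 8 * C₂ + 8 * q * C₃,
    by positivity, ?_, ?_⟩
  · have h1 : x ^ q ≤ 1 := pow_le_one₀ hx0.le hx1
    have h2 : 1 / (2 * (q : ℝ)) ≤ 1 := by
      rw [div_le_one (by positivity)]
      have : (2 : ℝ) ≤ q := by exact_mod_cast hq
      linarith
    have := mul_le_mul h1 h2 (by positivity) zero_le_one
    linarith
  intro n hn hM P hP c hc0 hcP
  have hn1 : (1 : ℝ) ≤ n := by exact_mod_cast hn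
  have hn0 : (0 : ℝ) < n := by linarith
  have hw1 : 1 ≤ Real.sqrt n := Real.one_le_sqrt.2 hn1
  have hww : Real.sqrt n * Real.sqrt n = n := Real.mul_self_sqrt hn0.le
  have p1 : 0 ≤ K / r₀ := by positivity
  have p2 : 0 ≤ 2 / κ := by positivity
  have p3 : 0 ≤ 2 * (q : ℝ) ^ 2 / lam := by positivity
  have p4 : 0 ≤ q * (Kt + 1) / δ := by positivity
  have p5 : 0 ≤ 8 * q * C₃ := by positivity
  set w := Real.sqrt n with hw
  have hw0 : 0 < w := by linarith
  have hwn : w ≤ n := by rw [← hww]; exact le_mul_of_one_le_left hw0.le hw1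
  have scale : ∀ u v : ℝ, 0 < v → u / v ≤ w → u * w ≤ v * n := by
    intro u v hv huv
    rw [div_le_iff₀ hv] at huv
    rw [← hww]
    calc u * w ≤ (w * v) * w := mul_le_mul_of_nonneg_right huv hw0.le
      _ = _ := by ring
  have q1 : K * w ≤ r₀ * n := scale _ _ hr₀ (by linarith)
  have q2 : 2 ≤ κ * n := by
    have := scale 2 κ hκ (by linarith)
    linarith
  have q3 : 2 * q ^ 2 * w ≤ lam * n := scale _ _ hlam (by linarith)
  have q4 : 1 ≤ δ * n / q - Kt * w := by
    have h1 := scale (q * (Kt + 1)) δ hδ0 (by linarith)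
    have h2 : (Kt + 1) * w ≤ δ * n / q := by
      rw [le_div_iff₀ hq0]
      linarith
    linarith
  have q5 : C₂ / w ≤ 1 / 8 := by
    rw [div_le_iff₀ hw0]
    linarith
  have q6 : q * (C₃ / n) ≤ 1 / 8 := by
    rw [← mul_div_assoc, div_le_iff₀ hn0]
    linarith
  have hg0 : ∀ i, 0 ≤ y * c i := fun i => mul_nonneg hy.le (hc0 i)
  have hgP : ∀ i, y * c i ≤ (P i).card := fun i => (mul_le_of_le_one_left (hc0 i) hy1.le).trans (hcP i)
  obtain ⟨Box, hne, hcard, hT⟩ := exists_box hq hn P hg0 hgP (fun i => q3.trans (hP.2 i)) ⟨0, by omega⟩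
  refine ⟨Box, hne, fun X hX T hTB => ?_⟩
  obtain ⟨hT1, hT2⟩ := hT T hTB
  obtain ⟨hr0, hr1, -⟩ := exp_neg_div_bounds hβ n
  obtain ⟨s, hs⟩ := exists_swDist_eq (a := a) (y := y) (B := B) (P := P) (c := c) (X := X) (by omega : 0 < q)
  have hd := hX
  rw [hs, distS] at hd
  have p1 : 0 ≤ ∑ i, |(projCnt P X i s : ℝ) - c i| := sum_nonneg fun _ _ => abs_nonneg _
  have p2 : 0 ≤ |(cntN X s : ℝ) - a * n| := abs_nonneg _
  have p3 : 0 ≤ ∑ j ∈ univ.erase s, |(cntN X j : ℝ) - (1 - y * a) / q * n| :=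
    sum_nonneg fun _ _ => abs_nonneg _
  have p4 : |(cntN X s : ℝ) - a * n| ≤ B * |(cntN X s : ℝ) - a * n| := le_mul_of_one_le_left p2 hB
  have hN : |(cntN X s : ℝ) - a * n| ≤ K * w := by linarith
  have hN' := hN.trans q1
  have hoth : ∀ j, j ≠ s → |(cntN X j : ℝ) - (1 - y * a) / q * n| ≤ r₀ * n := by
    intro j hj
    have := single_le_sum (f := fun j => |(cntN X j : ℝ) - (1 - y * a) / q * n|)
      (fun _ _ => abs_nonneg _) (mem_erase.2 ⟨hj, mem_univ j⟩)
    linarith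
  have hci : ∀ i, |(projCnt P X i s : ℝ) - c i| ≤ K * w := by
    intro i
    have := single_le_sum (f := fun i => |(projCnt P X i s : ℝ) - c i|)
      (fun _ _ => abs_nonneg _) (mem_univ i)
    linarith
  have hNge : (a - r₀) * n ≤ cntN X s := by linarith [(abs_le.1 hN').1]
  set L := (x / w ^ (q - 1)) ^ q * (1 / (2 * q)) with hL
  have hL0 : 0 ≤ L := by positivity
  have e1 : (∑ τ, if projCnt P τ = T then swStep n q β X τ else 0) =
      bex (Real.exp (-(β / n))) (monoPairs X) (fun E => colE q E fun τ => if projCnt P τ = T then 1 else 0) := by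
    rw [← sum_swStep]
    refine sum_congr rfl fun τ _ => ?_
    split_ifs <;> simp
  rw [e1]
  have e2 : x ^ q * (1 / (2 * q)) / 2 / Box.card ≤ L / 2 := by
    have hx' : L = x ^ q * (1 / (2 * q)) / (w ^ (q - 1)) ^ q := by rw [hL, div_pow]; ring
    rw [hx']
    have : 0 < (w ^ (q - 1)) ^ q := by positivity
    calc x ^ q * (1 / (2 * q)) / 2 / Box.card ≤ x ^ q * (1 / (2 * q)) / 2 / (w ^ (q - 1)) ^ q := by gcongr
      _ = _ := by ring
  refine e2.trans (half_le_bex hr0 hr1 (A := fun E => if ∀ S ∈ wsets κ X s, ¬ IsCompOf E S then 1 else 0)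
    (W := fun E => ∑ S ∈ wsets κ X s, if IsCompOf E S then 1 + errPsi β P X s E S / n else 0)
    (I := fun E => ∑ i, if ((isoIn E (P i)).card : ℝ) < δ * n then 1 else 0) hL0 hK₁0
    ((hnow n hn X s hNge).trans q5) ((hwin n hn P X s hN' hoth).trans (by rw [hK₁]; linarith)) ?_ ?_)
  · rw [bex_sum]
    refine le_trans (sum_le_sum (g := fun _ => C₃ / n) fun i _ => hiso n hn q X (P i) (hP.2 i)) ?_
    rw [sum_const, card_univ, Fintype.card_fin, nsmul_eq_mul]
    exact q6
  · intro E _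
    have hcol : 0 ≤ colE q E (fun τ : Conf n q => if projCnt P τ = T then 1 else 0) :=
      colE_nonneg fun τ => by split_ifs <;> norm_num
    have hWt : ∀ S ∈ wsets κ X s, 0 ≤ if IsCompOf E S then 1 + errPsi β P X s E S / n else 0 := by
      intro S _
      have := errPsi_nonneg (β := β) (P := P) (σ := X) (s := s) (E := E) (S := S)
      split_ifs <;> positivity
    have hW0 := sum_nonneg hWt
    have hIt : ∀ i ∈ univ, (0 : ℝ) ≤ if ((isoIn E (P i)).card : ℝ) < δ * n then 1 else 0 := by
      intro i _
      split_ifs <;> norm_num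
    have hI0 := sum_nonneg hIt
    have hA0 : (0 : ℝ) ≤ if ∀ S ∈ wsets κ X s, ¬ IsCompOf E S then 1 else 0 := by split_ifs <;> norm_num
    beta_reduce
    generalize hAv : (if ∀ S ∈ wsets κ X s, ¬ IsCompOf E S then (1 : ℝ) else 0) = Av at hA0 ⊢
    generalize hWv : (∑ S ∈ wsets κ X s, if IsCompOf E S then 1 + errPsi β P X s E S / n else 0) = Wv at hW0 ⊢
    generalize hIv : (∑ i, if ((isoIn E (P i)).card : ℝ) < δ * n then (1 : ℝ) else 0) = Iv at hI0 ⊢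
    have t1 : 0 ≤ L * Av := mul_nonneg hL0 hA0
    have t2 : 0 ≤ L / K₁ * Wv := mul_nonneg (by positivity) hW0
    have t3 : 0 ≤ L * Iv := mul_nonneg hL0 hI0
    by_cases hA : ∀ S ∈ wsets κ X s, ¬ IsCompOf E S
    · rw [if_pos hA] at hAv
      rw [← hAv] at t1 ⊢
      linarith
    push Not at hA
    obtain ⟨S, hS, hSE⟩ := hA
    by_cases hψ : errPsi β P X s E S ≤ K₁ * n
    swap
    · have h1 : K₁ ≤ Wv := by
        rw [← hWv]
        refine le_trans ?_ (single_le_sum hWt hS)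
        rw [if_pos hSE]
        push Not at hψ
        have := (lt_div_iff₀ hn0).2 hψ
        linarith
      have h2 : L ≤ L / K₁ * Wv := by
        calc L = L / K₁ * K₁ := by field_simp
          _ ≤ _ := mul_le_mul_of_nonneg_left h1 (by positivity)
      linarith
    by_cases hI : ∀ i, δ * n ≤ ((isoIn E (P i)).card : ℝ)
    swap
    · push Not at hI
      obtain ⟨i, hi⟩ := hI
      have h1 : 1 ≤ Iv := by
        rw [← hIv]
        refine le_trans ?_ (single_le_sum hIt (mem_univ i))
        rw [if_pos hi]
      have h2 : L ≤ L * Iv := le_mul_of_one_le_right hL0 h1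
      linarith
    have hScard : κ * n ≤ S.card := (mem_filter.1 hS).2
    have hS2 : 2 ≤ S.card := by
      have : (2 : ℝ) ≤ S.card := q2.trans hScard
      exact_mod_cast this
    obtain ⟨hprop, hχ⟩ := giant_proportions h hq hn hβ hy hy1 ha hexp hK₁0.le hN hN' hci hScard hψ
    have := colE_proj_lower hq hn hP.1.1 hSE hS2 hδ0 hK₂0 hK₃0.le (K₄ := 2 * q) (by positivity)
      (by rw [hK₂, Real.sq_sqrt (by positivity)]) hprop hχ hI hT1 hT2 q4
    linarith

theorem swStep_nonneg {n q : ℕ} {β : ℝ} (hβ : 0 < β) (σ τ : Conf n q) : 0 ≤ swStep n q β σ τ := by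
  obtain ⟨hr0, hr1, -⟩ := exp_neg_div_bounds hβ n
  refine sum_nonneg fun E _ => mul_nonneg
    (mul_nonneg (pow_nonneg (by linarith) _) (pow_nonneg hr0 _)) ?_
  split_ifs <;> positivity

theorem sum_swStep_eq_one {n q : ℕ} {β : ℝ} (hq : 0 < q) (σ : Conf n q) : ∑ τ, swStep n q β σ τ = 1 := by
  have := sum_swStep (β := β) σ (fun _ => 1)
  simp only [mul_one, colE_const hq, bex_const] at this
  exact this

/-- A configuration close to the majority profile has a unique dominant spin. -/
theorem exists_dominant {n q : ℕ} (hq : 2 ≤ q) (hn : 1 ≤ n) {β d : ℝ} {X : Conf n q}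
    (hX : linf (alphaVec X) (mVec q β) ≤ d) (hd : 2 * d < aFix q β - (1 - aFix q β) / (q - 1)) :
    ∃ s : Fin q, domIdx X = s ∧ |(cntN X s : ℝ) - aFix q β * n| ≤ d * n ∧
      ∀ j, j ≠ s → |(cntN X j : ℝ) - (1 - aFix q β) / (q - 1) * n| ≤ d * n := by
  have hn0 : (0 : ℝ) < n := by exact_mod_cast hn
  have hi : ∀ i, |alphaVec X i - mVec q β i| ≤ d := fun i =>
    (le_ciSup (f := fun i => |alphaVec X i - mVec q β i|) (Set.finite_range _).bddAbove i).trans hX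
  have hmul : ∀ (j : Fin q) (u : ℝ), |cntFrac X j - u| ≤ d → |(cntN X j : ℝ) - u * n| ≤ d * n := by
    intro j u hu
    have : (cntN X j : ℝ) - u * n = (cntFrac X j - u) * n := by
      rw [cntFrac]; field_simp
    rw [this, abs_mul, abs_of_pos hn0]
    exact mul_le_mul_of_nonneg_right hu hn0.le
  set z : Fin q := ⟨0, by omega⟩ with hz
  have h0 : |(cntN X (Tuple.sort (cntFrac X) z.rev) : ℝ) - aFix q β * n| ≤ d * n := by
    refine hmul _ _ ?_
    have := hi z
    rwa [mVec, kappaVec, if_pos rfl] at this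
  have hj : ∀ j, j ≠ Tuple.sort (cntFrac X) z.rev →
      |(cntN X j : ℝ) - (1 - aFix q β) / (q - 1) * n| ≤ d * n := by
    intro j hj
    refine hmul _ _ ?_
    have := hi ((Tuple.sort (cntFrac X)).symm j).rev
    rw [mVec, kappaVec, if_neg, alphaVec, Fin.rev_rev, Equiv.apply_symm_apply] at this
    · exact this
    · intro h
      apply hj
      have h1 : ((Tuple.sort (cntFrac X)).symm j).rev = z := Fin.ext h
      rw [← h1, Fin.rev_rev, Equiv.apply_symm_apply]
  refine ⟨_, ?_, h0, hj⟩
  set s := Tuple.sort (cntFrac X) z.rev with hs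
  have hlt : ∀ j, j ≠ s → cntN X j < cntN X s := by
    intro j hjs
    have h1 := (abs_le.1 (hj j hjs)).2
    have h2 := (abs_le.1 h0).1
    have h3 := mul_lt_mul_of_pos_right hd hn0
    have : (cntN X j : ℝ) < cntN X s := by linarith
    exact_mod_cast this
  have : {j : ℕ | ∃ hj : j < q, ∀ j' : Fin q, cntN X j' ≤ cntN X ⟨j, hj⟩} = {(s : ℕ)} := by
    ext j
    simp only [Set.mem_ofPred_eq, Set.mem_singleton_iff]
    constructor
    · rintro ⟨hjq, hmax⟩
      by_contra hne
      have h1 := hlt ⟨j, hjq⟩ (fun h => hne (congrArg Fin.val h))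
      have h2 := hmax s
      omega
    · rintro rfl
      refine ⟨s.2, fun j' => ?_⟩
      by_cases hjs : j' = s
      · rw [hjs]
      · exact (hlt j' hjs).le
  rw [domIdx, this, csInf_singleton]

theorem alpha1In_eq {n q : ℕ} {P : Fin q → Finset (Fin n)} {X : Conf n q} {s : Fin q}
    (hs : domIdx X = s) (i : Fin q) : alpha1In X (P i) = (projCnt P X i s : ℝ) / (P i).card := by
  simp only [alpha1In, projCnt, hs, Fin.ext_iff]

theorem distS_le {n q : ℕ} {a y B b k w : ℝ} {P : Fin q → Finset (Fin n)} {c : Fin q → ℝ}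
    {X : Conf n q} {s : Fin q} (hB : 0 ≤ B) (hw : 0 ≤ w) (hb : b = (1 - y * a) / q)
    (h0 : |(cntN X s : ℝ) - a * n| ≤ w) (hj : ∀ j, j ≠ s → |(cntN X j : ℝ) - b * n| ≤ w)
    (hc : ∀ i, |(projCnt P X i s : ℝ) - c i| ≤ k * w) : distS a y B P c X s ≤ (q * k + B + q) * w := by
  rw [distS, ← hb]
  have h1 := sum_le_sum (s := univ) fun i _ => hc i
  have h2 := sum_le_sum (s := univ.erase s) fun j hjm => hj j (ne_of_mem_erase hjm)
  rw [sum_const, card_univ, Fintype.card_fin, nsmul_eq_mul] at h1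
  rw [sum_const, nsmul_eq_mul] at h2
  have h3 : ((univ.erase s).card : ℝ) * w ≤ q * w := by
    refine mul_le_mul_of_nonneg_right ?_ hw
    have := card_le_univ (univ.erase s)
    rw [Fintype.card_fin] at this
    exact_mod_cast this
  have h4 := mul_le_mul_of_nonneg_left h0 hB
  linarith

theorem IsPartition.sum_card {n q : ℕ} {P : Fin q → Finset (Fin n)} (hP : IsPartition P) :
    ∑ i, ((P i).card : ℝ) = n := by
  have h1 : univ.biUnion P = univ := by
    ext v
    simpa using hP.2 v
  have h2 := card_biUnion (s := univ) (t := P) fun i _ j _ hij => hP.1 i j hij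
  rw [h1, card_univ, Fintype.card_fin] at h2
  exact_mod_cast h2.symm

/-- Lemma 3.5: there are a constant `Ĉ > 0` and a constant number of
steps `ℓ` such that, under assumptions A1–A2, some coupling of the two SW chains
(run for `ℓ` steps) has matching projections at some time `i ∈ {1,…,ℓ}`
with probability at least `3/4`. -/
theorem sw_boosting (q : ℕ) (hq : 2 ≤ q) (β : ℝ) (hβ : (q : ℝ) < β)
    (lam : ℝ) (hlam : lam ∈ Set.Ioo (0 : ℝ) 1) :
    ∃ Chat : ℝ, 0 < Chat ∧ ∃ ℓ : ℕ, ∃ N : ℕ, ∀ n : ℕ, N ≤ n →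
      ∀ P : Fin q → Finset (Fin n), IsLamPartition lam P →
      ∀ X₀ Y₀ : Conf n q,
        linf (alphaVec X₀) (mVec q β) ≤ Chat / Real.sqrt n →
        linf (alphaVec Y₀) (mVec q β) ≤ Chat / Real.sqrt n →
        (∀ i : Fin q, |alpha1In X₀ (P i) - alpha1In Y₀ (P i)| ≤
          Chat / Real.sqrt ((P i).card)) →
        ∃ μc : (Fin ℓ → Conf n q × Conf n q) → ℝ,
          (∀ ω, 0 ≤ μc ω) ∧
          (∀ ωx : Fin ℓ → Conf n q,
            (∑ ω : Fin ℓ → Conf n q × Conf n q,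
              if (fun i => (ω i).1) = ωx then μc ω else 0) = pathProb n q β X₀ ℓ ωx) ∧
          (∀ ωy : Fin ℓ → Conf n q,
            (∑ ω : Fin ℓ → Conf n q × Conf n q,
              if (fun i => (ω i).2) = ωy then μc ω else 0) = pathProb n q β Y₀ ℓ ωy) ∧
          3 / 4 ≤ ∑ ω : Fin ℓ → Conf n q × Conf n q,
            (if ∃ i : Fin ℓ, projCnt P (ω i).1 = projCnt P (ω i).2 then μc ω else 0) := by
  have hq2 : (2 : ℝ) ≤ q := by exact_mod_cast hq
  have hβ0 : 0 < β := by linarith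
  obtain ⟨y, hy, hy1, haq, ha1, hfix, hexp⟩ := aFix_spec q hq β hβ
  obtain ⟨r₀, κ, x₀, D, ρ, k₀, h⟩ := exists_stepConsts q hq hβ hy hy1 haq hfix hexp
  set a := aFix q β with ha_def
  have ha : 0 < a := lt_trans (by positivity) haq
  have hr₀ := h.hr
  obtain ⟨B, ρ₁, C, hB, hρ0, hρ1, hC, drift⟩ := exists_drift h hq hβ0 hy hy1 ha ha1.le hfix hexp
  set A := 2 * B + 3 * q + 2 * C with hA
  have hA0 : 0 < A := by positivity
  have hρ' : 0 < 1 - ρ₁ := by linarith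
  set K := 12 * A / (1 - ρ₁) with hK
  have hK0 : 0 < K := by positivity
  obtain ⟨ε, M, hε, hε1, minor⟩ := exists_minor h hq hβ0 hy hy1 ha hexp (lam := lam) hlam.1 hB hK0
  obtain ⟨ℓ, hℓ⟩ := exists_pow_lt_of_lt_one (show (0 : ℝ) < 1 / 12 by norm_num) (show 1 - ε < 1 by linarith)
  set b := (1 - a) / ((q : ℝ) - 1) with hb
  have hb' : b = (1 - y * a) / q := by
    rw [hb, div_eq_div_iff (by linarith) (by linarith)]
    have : (a : ℝ) * q = 1 + (q - 1) * y * a := by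
      have h1 : (q : ℝ) * (1 / q + (1 - 1 / q) * y * a) = 1 + (q - 1) * y * a := by field_simp
      rw [← h1, ← hfix]; ring
    linear_combination -this
  have hab : 0 < a - b := by
    rw [hb, sub_pos, div_lt_iff₀ (by linarith)]
    rw [div_lt_iff₀ (by linarith)] at haq
    linarith
  set G := max M (12 * A * ℓ / (r₀ * (1 - ρ₁)) + 2 / (a - b) + 1) with hG
  refine ⟨1, one_pos, ℓ, ⌈G ^ 2⌉₊ + 1, fun n hN P hP X₀ Y₀ hX hY hXY => ?_⟩
  have hn : 1 ≤ n := by omega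
  have hn0 : (0 : ℝ) < n := by exact_mod_cast hn
  have hGw : G ≤ Real.sqrt n := by
    refine Real.le_sqrt_of_sq_le ((Nat.le_ceil _).trans ?_)
    exact_mod_cast (by omega : ⌈G ^ 2⌉₊ ≤ n)
  have hww : Real.sqrt n * Real.sqrt n = n := Real.mul_self_sqrt hn0.le
  have hw0 : 0 < Real.sqrt n := Real.sqrt_pos.2 hn0
  set w := Real.sqrt n with hw
  have g1 : M ≤ w := (le_max_left _ _).trans hGw
  have g2 : 12 * A * ℓ / (r₀ * (1 - ρ₁)) + 2 / (a - b) + 1 ≤ w := (le_max_right _ _).trans hGw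
  have g3 : 0 ≤ 12 * A * ℓ / (r₀ * (1 - ρ₁)) := by positivity
  have g4 : 0 < 2 / (a - b) := by positivity
  have hd : 2 * (1 / w) < a - b := by
    have : 2 / (a - b) < w := by linarith
    rw [div_lt_iff₀ hab] at this
    rw [← mul_div_assoc, div_lt_iff₀ hw0]
    linarith
  have hwn : 1 / w * n = w := by rw [← hww]; field_simp
  obtain ⟨s, hs, hs0, hsj⟩ := exists_dominant hq hn hX hd
  obtain ⟨t, ht, ht0, htj⟩ := exists_dominant hq hn hY hd
  rw [hwn] at hs0 ht0
  simp only [hwn] at hsj htj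
  have hPc : ∀ i, (0 : ℝ) < (P i).card := fun i => lt_of_lt_of_le (mul_pos hlam.1 hn0) (hP.2 i)
  have hPn : ∀ i, ((P i).card : ℝ) ≤ n := fun i => by
    have := card_le_univ (P i)
    rw [Fintype.card_fin] at this
    exact_mod_cast this
  have hproj : ∀ i, |(projCnt P Y₀ i t : ℝ) - projCnt P X₀ i s| ≤ 1 * w := by
    intro i
    have h1 := hXY i
    rw [alpha1In_eq hs, alpha1In_eq ht, ← sub_div, abs_div, abs_of_pos (hPc i), div_le_iff₀ (hPc i),
      abs_sub_comm] at h1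
    refine h1.trans ?_
    have h2 : 1 / Real.sqrt (P i).card * (P i).card = Real.sqrt (P i).card := by
      rw [one_div_mul_eq_div, Real.div_sqrt]
    rw [h2, one_mul]
    exact Real.sqrt_le_sqrt (hPn i)
  let c : ℕ → Fin q → ℝ := fun t => (ctrStep y P)^[t] fun i => (projCnt P X₀ i s : ℝ)
  have hc_succ : ∀ t, c (t + 1) = ctrStep y P (c t) := fun t => Function.iterate_succ_apply' _ _ _
  have hc : ∀ t, (∀ i, 0 ≤ c t i) ∧ ∀ i, c t i ≤ (P i).card := by
    intro t
    induction t with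
    | zero => exact ⟨fun i => Nat.cast_nonneg _, fun i => Nat.cast_le.2 (card_filter_le _ _)⟩
    | succ t ih =>
      rw [hc_succ]
      exact ⟨fun i => (ctrStep_mem (by omega) hy.le hy1.le ih.1 ih.2 i).1,
        fun i => (ctrStep_mem (by omega) hy.le hy1.le ih.1 ih.2 i).2⟩
  have hdrift : ∀ t X, swDist a y B P (c t) X / w ≤ r₀ * w →
      ∑ τ, swStep n q β X τ * (swDist a y B P (c (t + 1)) τ / w) ≤
        ρ₁ * (swDist a y B P (c t) X / w) + C := by
    intro t X hX
    rw [div_le_iff₀ hw0, mul_assoc, hww] at hX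
    have := drift n hn P (c t) X hP.1.sum_card.le (hc t).1 (hc t).2 hX
    rw [hc_succ]
    simp only [← mul_div_assoc]
    rw [← sum_div, div_le_iff₀ hw0]
    refine this.trans_eq ?_
    rw [← hw]
    field_simp
  obtain ⟨μ, h1, h2, h3, h4⟩ := exists_trajectory_coupling (projCnt P) (swStep n q β)
    (fun t X => swDist a y B P (c t) X / w) K ε ρ₁ C (r₀ * w) (swStep_nonneg hβ0)
    (sum_swStep_eq_one (by omega)) (fun t X => div_nonneg (swDist_nonneg (by linarith)) hw0.le)
    hK0 (by positivity) hε hε1 hρ0 hρ1 hC.le hdrift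
    (fun t => by
      obtain ⟨Box, hne, hBox⟩ := minor n hn g1 P hP (c t) (hc t).1 (hc t).2
      exact ⟨Box, hne, fun X hX T hT => (hBox X ((div_le_iff₀ hw0).1 hX) T hT).trans_eq
        (sum_congr rfl fun τ _ => by split_ifs <;> rfl)⟩) ℓ X₀ Y₀
  refine ⟨μ, h1,
    fun ωx => (sum_congr rfl fun ω _ => by split_ifs <;> rfl).trans (h2 ωx),
    fun ωy => (sum_congr rfl fun ω _ => by split_ifs <;> rfl).trans (h3 ωy),
    le_trans ?_ (h4.trans_eq (sum_congr rfl fun ω _ => by split_ifs <;> rfl))⟩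
  have hWx : swDist a y B P (c 0) X₀ / w ≤ B + q := by
    rw [div_le_iff₀ hw0]
    refine (swDist_le s).trans ((distS_le (k := 0) (by linarith) hw0.le hb' hs0 hsj ?_).trans_eq (by ring))
    intro i
    simp [c]
  have hWy : swDist a y B P (c 0) Y₀ / w ≤ B + 2 * q := by
    rw [div_le_iff₀ hw0]
    exact (swDist_le t).trans ((distS_le (k := 1) (by linarith) hw0.le hb' ht0 htj hproj).trans_eq (by ring))
  have hbound : (swDist a y B P (c 0) X₀ / w + swDist a y B P (c 0) Y₀ / w + 2 * C) *
      ((1 / K + ℓ / (r₀ * w)) / (1 - ρ₁)) ≤ A * ((1 / K + ℓ / (r₀ * w)) / (1 - ρ₁)) :=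
    mul_le_mul_of_nonneg_right (by linarith) (by positivity)
  have e1 : A * ((1 / K + ℓ / (r₀ * w)) / (1 - ρ₁)) = 1 / 12 + A * ℓ / (r₀ * (1 - ρ₁)) / w := by
    rw [hK]
    field_simp
  have e2 : A * ℓ / (r₀ * (1 - ρ₁)) / w ≤ 1 / 12 := by
    rw [div_le_iff₀ hw0]
    have : 12 * A * ℓ / (r₀ * (1 - ρ₁)) = 12 * (A * ℓ / (r₀ * (1 - ρ₁))) := by ring
    linarith
  linarith
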